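/- A standard (1,1) diagram is virtually almost coherent if and only if it is strongly almost coherent. (Proposition 3.5 of the paper.) -/

import Mathlib

/-!
Common combinatorial framework for standard (1,1) diagrams in Rasmussen standard
form, their lifts to the universal cover of the torus, and the combinatorial knot
Floer chain complexes they define.
-/

namespace OneOneKnot

open scoped Classical

noncomputable section

/-- A state in the traversal of the lifts of the `β` curve of a standard (1,1) diagram
to the universal cover `ℝ²` of the torus.  `pos` is the position coordinate of an
intersection point of `β` with a lift of `α`; `up` records whether `β` crosses that
lift of `α` upwards (with respect to the reference orientation of `β`); `top` records
whether `pos` is measured as a top-edge or a bottom-edge coordinate of the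
corresponding fundamental rectangle; `ht` is the index of the lift of `α` (the line
`y = ht`). -/
structure CState where
  pos : ℤ
  up : Bool
  top : Bool
  ht : ℤ

/-- The data of a standard (1,1) diagram in Rasmussen standard form, encoded by a
four-tuple `(p, q, r, s)` with `q, r ≥ 0`, `2q + r ≤ p` and `0 ≤ s < p`. -/
structure StdDiagram where
  p : ℕ
  q : ℕ
  r : ℕ
  s : ℕ
  hp : 0 < p
  h2qr : 2 * q + r ≤ p
  hs : s < p

namespace StdDiagram

variable (D : StdDiagram)

def pz : ℤ := D.p
def qz : ℤ := D.q
def rz : ℤ := D.r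
def sz : ℤ := D.s

/-- One step forward along (a lift of) `β`, with respect to a reference orientation of
`β`.  This is Algorithm 1 of the paper: rainbow arcs occupy top-edge positions
`r, …, r + 2q - 1` and bottom-edge positions `0, …, 2q - 1` (mod `p`), the `i`-th
point of the top edge is identified with the `(i+s)`-th point of the bottom edge, and
`ht` records the line `y = ht` of the universal cover on which the point lies. -/
def step (σ : CState) : CState :=
  let m := σ.pos % D.pz
  if σ.top then
    if σ.up then ⟨σ.pos + D.sz, σ.up, false, σ.ht⟩
    else if m ≤ D.rz - 1 then ⟨σ.pos + 2 * D.qz, σ.up, false, σ.ht - 1⟩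
    else if m ≤ D.rz + 2 * D.qz - 1 then
      ⟨2 * D.rz + 2 * D.qz - 1 - 2 * m + σ.pos, true, true, σ.ht⟩
    else ⟨σ.pos, σ.up, false, σ.ht - 1⟩
  else
    if σ.up = false then ⟨σ.pos - D.sz, σ.up, true, σ.ht⟩
    else if m ≤ 2 * D.qz - 1 then ⟨2 * D.qz - 1 - 2 * m + σ.pos, false, false, σ.ht⟩
    else if m ≤ D.rz + 2 * D.qz - 1 then ⟨σ.pos - 2 * D.qz, σ.up, true, σ.ht + 1⟩
    else ⟨σ.pos, σ.up, true, σ.ht + 1⟩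

/-- One step backward along `β` (the inverse of `step`). -/
def stepB (σ : CState) : CState :=
  let m := σ.pos % D.pz
  if σ.top then
    if σ.up then
      if D.rz ≤ m ∧ m ≤ D.rz + 2 * D.qz - 1 then
        ⟨2 * D.rz + 2 * D.qz - 1 - 2 * m + σ.pos, false, true, σ.ht⟩
      else if m ≤ D.rz - 1 then ⟨σ.pos + 2 * D.qz, true, false, σ.ht - 1⟩
      else ⟨σ.pos, true, false, σ.ht - 1⟩
    else ⟨σ.pos + D.sz, false, false, σ.ht⟩
  else
    if σ.up then ⟨σ.pos - D.sz, true, true, σ.ht⟩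
    else
      if m ≤ 2 * D.qz - 1 then ⟨2 * D.qz - 1 - 2 * m + σ.pos, true, false, σ.ht⟩
      else if m ≤ 2 * D.qz + D.rz - 1 then ⟨σ.pos - 2 * D.qz, false, true, σ.ht + 1⟩
      else ⟨σ.pos, false, true, σ.ht + 1⟩

/-- Reference starting state: the intersection point with top-edge coordinate `0`
on the line `y = 0`. -/
def start0 : CState := ⟨0, false, true, 0⟩

/-- `β` is a single closed curve: its traversal passes through all `p`
intersection points with `α`. -/
def Connected : Prop :=
  ∀ k : ℕ, k < D.p → ∃ n : ℕ,
    ((D.step)^[n] start0).top = true ∧ ((D.step)^[n] start0).pos % D.pz = (k : ℤ)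

/-- `β` crosses the intersection point with top-edge coordinate `≡ k (mod p)`
upwards, with respect to the reference orientation of `β`. -/
def UpAt (k : ℤ) : Prop :=
  ∃ n : ℕ, ((D.step)^[n] start0).top = true ∧
    ((D.step)^[n] start0).pos % D.pz = k % D.pz ∧ ((D.step)^[n] start0).up = true

/-- The algebraic intersection number `α · β` computed with the reference
orientation of `β` (and `α` oriented from left to right). -/
def algInt : ℤ := ∑ k ∈ Finset.range D.p, (if D.UpAt (k : ℤ) then (1 : ℤ) else -1)

/-- One step forward along `β` for the orientation of `β` normalised so that
`α · β > 0`. -/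
def fstep (σ : CState) : CState := if 0 < D.algInt then D.step σ else D.stepB σ

/-- With the normalised orientation, `β` crosses `α` upwards at the given state. -/
def TrueUp (σ : CState) : Prop := (0 < D.algInt ↔ σ.up = true)

/-- With the normalised orientation, `β` crosses the intersection point with
top-edge coordinate `≡ k (mod p)` upwards. -/
def TrueUpPt (k : ℤ) : Prop := (0 < D.algInt ↔ D.UpAt k)

/-- The canonical state sitting at the intersection point `k` on the line `y = 0`
(of the chosen lift `α̃` of `α`). -/
def spt (k : ℕ) : CState := ⟨(k : ℤ), if D.UpAt (k : ℤ) then true else false, true, 0⟩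

/-- The state is an intersection point of `β̃` with the line `y = 0`
(recorded with its canonical top-edge coordinate). -/
def IsCross0 (σ : CState) : Prop := σ.top = true ∧ σ.ht = 0

/-- The portion of `β̃` after `σ` returns to the line `y = 0`; that is, `σ` is the
starting point of a compact arc cut off by `α̃` rather than of a ray. -/
def Returns0 (σ : CState) : Prop := ∃ n : ℕ, 1 ≤ n ∧ IsCross0 ((D.fstep)^[n] σ)

/-- Number of `fstep`-moves until the next intersection with the line `y = 0`. -/
def ret0Steps (σ : CState) : ℕ := sInf {n : ℕ | 1 ≤ n ∧ IsCross0 ((D.fstep)^[n] σ)}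

/-- The next intersection point of `β̃` with the line `y = 0` after `σ`. -/
def nxt0 (σ : CState) : CState := (D.fstep)^[D.ret0Steps σ] σ

/-- The label (downstairs intersection point) of a state. -/
def lab (σ : CState) : ℤ := σ.pos % D.pz

/-- The compact arc of `β̃` starting at the intersection point `k` of the line
`y = 0` is oriented rightward (for the normalised orientation of `β`). -/
def ArcRight (k : ℕ) : Prop := (k : ℤ) < (D.nxt0 (D.spt k)).pos

/-- Starting points of the compact arcs in the upper half-plane cut off by `α̃`
from the union of the lifts `β̃ₛ`. -/
def UpperStarts : Finset ℕ :=
  (Finset.range D.p).filter fun k => D.Returns0 (D.spt k) ∧ D.TrueUp (D.spt k)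

/-- Starting points of the compact arcs in the lower half-plane. -/
def LowerStarts : Finset ℕ :=
  (Finset.range D.p).filter fun k => D.Returns0 (D.spt k) ∧ ¬ D.TrueUp (D.spt k)

/-- The number of compact arcs in the upper half-plane with orientation `b`
(`true` = rightward, `false` = leftward). -/
def uCnt (b : Bool) : ℕ := (D.UpperStarts.filter fun k => D.ArcRight k ↔ b = true).card

/-- The number of compact arcs in the lower half-plane with orientation `b`. -/
def lCnt (b : Bool) : ℕ := (D.LowerStarts.filter fun k => D.ArcRight k ↔ b = true).card

/-- Definition 3.2: the standard diagram is *virtually almost coherent* if, for an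
admissible choice of inconsistent direction in each half-plane (the inconsistent
direction must be carried by at most as many arcs as the other direction), the
union of the lifts `β̃ₛ` contains exactly two inconsistent arcs. -/
def VirtuallyAlmostCoherent : Prop :=
  ∃ dU dL : Bool,
    D.uCnt dU ≤ D.uCnt (!dU) ∧ D.lCnt dL ≤ D.lCnt (!dL) ∧ D.uCnt dU + D.lCnt dL = 2

/-- `k` is the starting point of one of the two inconsistent arcs, for the choice
`(dU, dL)` of inconsistent directions in the upper and lower half-planes. -/
def InconsCoverArc (dU dL : Bool) (k : ℕ) : Prop :=
  (k ∈ D.UpperStarts ∧ (D.ArcRight k ↔ dU = true)) ∨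
  (k ∈ D.LowerStarts ∧ (D.ArcRight k ↔ dL = true))

/-! ### Rainbow arcs of the diagram downstairs -/

/-- The rainbow arcs of the standard diagram: `(true, i)` with `r ≤ i < r + q` is the
rainbow arc attached to the top edge with feet `i` and `2r + 2q - 1 - i`; `(false, j)`
with `j < q` is the rainbow arc attached to the bottom edge with feet `j` and
`2q - 1 - j`.  The two families are the rainbow arcs around the two basepoints. -/
def rainbowArcs : Finset (Bool × ℕ) :=
  ((Finset.Ico D.r (D.r + D.q)).image fun i => ((true : Bool), i)) ∪
    ((Finset.range D.q).image fun j => ((false : Bool), j))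

/-- The two endpoints of a rainbow arc, as intersection points of `α ∩ β` recorded
by their top-edge coordinates in `ZMod p`. -/
def rEnds (a : Bool × ℕ) : Finset (ZMod D.p) :=
  if a.1 then
    {((a.2 : ℤ) : ZMod D.p), ((2 * D.rz + 2 * D.qz - 1 - (a.2 : ℤ) : ℤ) : ZMod D.p)}
  else
    {(((a.2 : ℤ) - D.sz : ℤ) : ZMod D.p), ((2 * D.qz - 1 - (a.2 : ℤ) - D.sz : ℤ) : ZMod D.p)}

/-- A rainbow arc is oriented rightward (with the normalised orientation of `β`):
a top-edge rainbow arc is traversed starting from the endpoint where `β` crosses `α`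
downwards, a bottom-edge one from the endpoint where `β` crosses `α` upwards. -/
def rOrientRight (a : Bool × ℕ) : Prop :=
  if a.1 then ¬ D.TrueUpPt (a.2 : ℤ) else D.TrueUpPt ((a.2 : ℤ) - D.sz)

/-- The number of rainbow arcs in the family `f` (`true` = attached to the top edge)
with orientation `b` (`true` = rightward). -/
def famCnt (f : Bool) (b : Bool) : ℕ :=
  (D.rainbowArcs.filter fun a => a.1 = f ∧ (D.rOrientRight a ↔ b = true)).card

/-- `a` is an inconsistent rainbow arc for the choice `(dT, dB)` of inconsistent
directions for the two families. -/
def InconsArc (dT dB : Bool) (a : Bool × ℕ) : Prop :=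
  a ∈ D.rainbowArcs ∧ (D.rOrientRight a ↔ (if a.1 then dT else dB) = true)

/-- Two rainbow arcs share a common endpoint. -/
def ShareEnd (a b : Bool × ℕ) : Prop := ((D.rEnds a) ∩ (D.rEnds b)).Nonempty

/-- Two rainbow arcs are connected to each other by two other rainbow arcs. -/
def ConnectedByTwo (a1 a2 : Bool × ℕ) : Prop :=
  ∃ b1 b2 : Bool × ℕ, b1 ∈ D.rainbowArcs ∧ b2 ∈ D.rainbowArcs ∧
    b1 ≠ a1 ∧ b1 ≠ a2 ∧ b2 ≠ a1 ∧ b2 ≠ a2 ∧ b1 ≠ b2 ∧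
    D.ShareEnd a1 b1 ∧ D.ShareEnd b1 b2 ∧ D.ShareEnd b2 a2

/-- Definition 1.2: the standard diagram is *strongly almost coherent* if, for an
admissible choice of inconsistent directions, there are exactly two inconsistent
rainbow arcs, and either they share a common endpoint, or they are connected to each
other by two other rainbow arcs. -/
def StronglyAlmostCoherent : Prop :=
  ∃ dT dB : Bool,
    D.famCnt true dT ≤ D.famCnt true (!dT) ∧ D.famCnt false dB ≤ D.famCnt false (!dB) ∧
    ∃ a1 a2 : Bool × ℕ, a1 ≠ a2 ∧ (∀ a, D.InconsArc dT dB a ↔ (a = a1 ∨ a = a2)) ∧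
      (D.ShareEnd a1 a2 ∨ D.ConnectedByTwo a1 a2)

/-! ### Spin^c classes of intersection points -/

/-- The point `l` is reached from the point `k` by travelling forward along the lift
`β̃` through (the lift at height `0` of) `k`, meeting it on the line `y = 0`. -/
def Reach (k l : ℕ) : Prop :=
  ∃ n : ℕ, IsCross0 ((D.fstep)^[n] (D.spt k)) ∧
    ((D.fstep)^[n] (D.spt k)).pos % D.pz = (l : ℤ)

/-- Two intersection points are in the same class (i.e. they induce the same
spin^c structure): some lift of `β` meeting the line `y = 0` passes through lifts
of both of them on that line. -/
def SameClass (k l : ℕ) : Prop := D.Reach k l ∨ D.Reach l k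

/-! ### The sequence of intersection points along a lift -/

/-- The `m`-th intersection point of `β̃ₛ` with the line `y = 0` after the point `c`. -/
def seqSt (c m : ℕ) : CState := (D.nxt0)^[m] (D.spt c)

/-- Its label downstairs. -/
def labAt (c m : ℕ) : ℤ := D.lab (D.seqSt c m)

/-- Its position coordinate on the line `y = 0`. -/
def posAt (c m : ℕ) : ℤ := (D.seqSt c m).pos

/-- The differential component carried by the compact arc starting at `k` points
from the starting point of the arc towards its end point.  (For an arc in the upper
half-plane the source of the arrow is the right endpoint, for an arc in the lower
half-plane it is the left endpoint.) -/
def srcIsStart (k : ℕ) : Prop :=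
  ¬ (D.TrueUp (D.spt k) ↔ (k : ℤ) < (D.nxt0 (D.spt k)).pos)

/-- The label of the source of the differential component carried by the arc
starting at `k`. -/
def srcLab (k : ℕ) : ℤ :=
  if D.srcIsStart k then (k : ℤ) % D.pz else (D.nxt0 (D.spt k)).pos % D.pz

/-- The label of the target of the differential component carried by the arc
starting at `k`. -/
def tgtLab (k : ℕ) : ℤ :=
  if D.srcIsStart k then (D.nxt0 (D.spt k)).pos % D.pz else (k : ℤ) % D.pz

/-- The number of bigons (compact arcs) inducing a differential component from `x`
to `y`. -/
def arrowCnt (x y : ℕ) : ℕ :=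
  ((Finset.range D.p).filter fun k =>
    D.Returns0 (D.spt k) ∧ D.srcLab k = (x : ℤ) ∧ D.tgtLab k = (y : ℤ)).card


/-! ### Counting basepoints inside the bigon cut off by a compact arc -/

/-- Doubled plane `x`-coordinate of a state in the (sheared) universal cover. -/
def x2 (σ : CState) : ℤ := 2 * σ.pos - 2 * D.sz * (if σ.top then σ.ht - 1 else σ.ht)

/-- The number of crossings of the upward vertical ray emanating from the basepoint
slot in row `ρ` with doubled `x`-coordinate `X0` (a `w`-slot if `isZ = false`, sitting
just above the line `y = ρ`; a `z`-slot if `isZ = true`, sitting just below the line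
`y = ρ + 1`) with the piece of `β̃` between the state `σ` and the next state. -/
def rayCross (σ : CState) (X0 ρ : ℤ) (isZ : Bool) : ℕ :=
  let σ' := D.fstep σ
  let lo := min (D.x2 σ) (D.x2 σ')
  let hi := max (D.x2 σ) (D.x2 σ')
  if σ.ht ≠ σ'.ht then
    -- a strand crossing the row between the lines `y = min ht` and `y = min ht + 1`
    (if (ρ < min σ.ht σ'.ht ∨ (ρ = min σ.ht σ'.ht ∧ isZ = false)) ∧ lo < X0 ∧ X0 < hi
      then 1 else 0)
  else if σ.top = σ'.top then
    if σ.top then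
      -- a rainbow arch hanging below the line `y = σ.ht`
      (if (if isZ then ρ ≤ σ.ht - 2 else ρ ≤ σ.ht - 1) ∧ lo < X0 ∧ X0 < hi then 1 else 0)
    else
      -- a rainbow arch sitting above the line `y = σ.ht`
      (if (if isZ then ρ ≤ σ.ht - 1 else ρ ≤ σ.ht) ∧ lo < X0 ∧ X0 < hi then 1 else 0)
  else 0

/-- Doubled plane `x`-coordinate of the basepoint slot of row `ρ`, horizontal
translate `m`: the `w`-basepoint is between bottom-edge coordinates `q - 1` and `q`,
the `z`-basepoint between top-edge coordinates `r + q - 1` and `r + q`. -/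
def slotX2 (ρ m : ℤ) (isZ : Bool) : ℤ :=
  (if isZ then 2 * (D.rz + D.qz) - 1 else 2 * D.qz - 1) - 2 * ρ * D.sz + 2 * m * D.pz

/-- The states traversed by the compact arc starting at the intersection point `k`. -/
def arcState (k i : ℕ) : CState := (D.fstep)^[i] (D.spt k)

/-- Number of crossings of the upward vertical ray from a slot with the chord of the
bigon (the segment of the line `y = 0` joining the endpoints of the arc). -/
def chordCross (k : ℕ) (X0 ρ : ℤ) : ℕ :=
  if ρ ≤ -1 ∧ min (D.x2 (D.spt k)) (D.x2 (D.nxt0 (D.spt k))) < X0 ∧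
      X0 < max (D.x2 (D.spt k)) (D.x2 (D.nxt0 (D.spt k))) then 1 else 0

/-- A basepoint slot lies inside the (embedded) bigon cobounded by the compact arc
starting at `k` and the line `y = 0`: the upward vertical ray from the slot meets the
boundary of the bigon an odd number of times. -/
def SlotInBigon (k : ℕ) (ρ m : ℤ) (isZ : Bool) : Prop :=
  ¬ (2 ∣ ((D.chordCross k (D.slotX2 ρ m isZ) ρ : ℤ) +
      ∑ i ∈ Finset.range (D.ret0Steps (D.spt k)),
        (D.rayCross (D.arcState k i) (D.slotX2 ρ m isZ) ρ isZ : ℤ)))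

/-- A bound for the rows met by the arc starting at `k`. -/
def hBound (k : ℕ) : ℕ :=
  ((Finset.range (D.ret0Steps (D.spt k) + 1)).sup fun i => (D.arcState k i).ht.natAbs) + 2

/-- A bound for the horizontal translates of slots met by the arc starting at `k`. -/
def mBound (k : ℕ) : ℕ :=
  ((Finset.range (D.ret0Steps (D.spt k) + 1)).sup fun i => (D.arcState k i).pos.natAbs)
    + (D.hBound k + 2) * (D.s + 1) + D.p + D.q + D.r + 4

/-- The number of lifts of the `w`-basepoint (`isZ = false`), respectively of the
`z`-basepoint (`isZ = true`), inside the bigon cobounded by the compact arc starting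
at `k` and the line `y = 0`. -/
def arcBase (k : ℕ) (isZ : Bool) : ℕ :=
  (((Finset.Icc (-(D.hBound k : ℤ)) (D.hBound k)) ×ˢ
      (Finset.Icc (-(D.mBound k : ℤ)) (D.mBound k))).filter
    fun ρm => D.SlotInBigon k ρm.1 ρm.2 isZ).card

/-- The arc starting at `k` stays within the two rows adjacent to the line `y = 0`
(equivalently, it has height `< 1`). -/
def ArcWithinRow (k : ℕ) : Prop :=
  ∀ n : ℕ, n ≤ D.ret0Steps (D.spt k) → (D.arcState k n).ht = 0

/-- The arc starting at `k` is a lift of a single rainbow arc of the diagram. -/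
def ArcIsRainbowLift (k : ℕ) : Prop := D.ret0Steps (D.spt k) = 3

/-! ### Gradings and filtrations of the knot Floer complex -/

/-- The relative Maslov grading changes by `±1` along each arc, dropping (by `1`)
from the source of its differential component to the target. -/
def grStep (k : ℕ) : ℤ := if D.srcIsStart k then -1 else 1

/-- The relative `i`-filtration drops, from the source of the differential component
carried by an arc to the target, by the number of `w`-basepoints in its bigon. -/
def faStep (k : ℕ) : ℤ := (if D.srcIsStart k then -1 else 1) * (D.arcBase k false : ℤ)

/-- The relative `j`-filtration drops by the number of `z`-basepoints in the bigon. -/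
def fbStep (k : ℕ) : ℤ := (if D.srcIsStart k then -1 else 1) * (D.arcBase k true : ℤ)

/-- The sum of the per-arc increments of a relative grading along the first `m` arcs
of the lift `β̃` starting at the point `c`. -/
def pathSum (f : ℕ → ℤ) (c m : ℕ) : ℤ := ∑ i ∈ Finset.range m, f (D.labAt c i).toNat

/-- `a` occurs in the forward sequence of intersection points of `β̃` with the line
`y = 0` starting at `c`. -/
def ReachIn (c a : ℕ) : Prop := ∃ m : ℕ, D.labAt c m = (a : ℤ)

/-- The value at `a` of the relative grading with per-arc increments `f`, normalised
to vanish at the base point `c` of the class. -/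
def relOf (f : ℕ → ℤ) (c a : ℕ) : ℤ :=
  if h : D.ReachIn c a then D.pathSum f c (Nat.find h)
  else if h' : D.ReachIn a c then - D.pathSum f a (Nat.find h') else 0

/-- The Maslov grading of the generator `a` of the class of `c` (normalised at `c`). -/
def grOf (c a : ℕ) : ℤ := D.relOf D.grStep c a

/-- The `i`-filtration of the generator `a` of the class of `c`. -/
def faOf (c a : ℕ) : ℤ := D.relOf D.faStep c a

/-- The `j`-filtration of the generator `a` of the class of `c`. -/
def fbOf (c a : ℕ) : ℤ := D.relOf D.fbStep c a

/-- The number of generators of the class of `c` in Maslov grading `g`. -/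
def grCountClass (c : ℕ) (g : ℤ) : ℕ :=
  ((Finset.range D.p).filter fun a => D.SameClass a c ∧ D.grOf c a = g).card

/-! ### Turning points -/

/-- The differential component of the arc from the `i`-th to the `(i+1)`-st point of
the sequence along `β̃ₛ` starting at `c` points forward. -/
def srcIsStartAt (c i : ℕ) : Prop := D.srcIsStart (D.labAt c i).toNat

/-- The cumulative relative Maslov grading of the `m`-th point of the sequence along
`β̃ₛ` starting at `c`. -/
def grPartial (c m : ℕ) : ℤ :=
  ∑ i ∈ Finset.range m, (if D.srcIsStartAt c i then (-1 : ℤ) else 1)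

/-- The `m`-th point of the sequence along `β̃ₛ` starting at `c` is a *turning point*:
its position on the line `y = 0` is either greater or smaller than the positions of
both its predecessor and its successor. -/
def TurningAt (c m : ℕ) : Prop :=
  1 ≤ m ∧ ((D.posAt c (m - 1) < D.posAt c m ∧ D.posAt c (m + 1) < D.posAt c m) ∨
    (D.posAt c m < D.posAt c (m - 1) ∧ D.posAt c m < D.posAt c (m + 1)))

/-- A *positive* turning point: its predecessor appears in its differential. -/
def PosTurningAt (c m : ℕ) : Prop := D.TurningAt c m ∧ ¬ D.srcIsStartAt c (m - 1)

/-- A *negative* turning point: it appears in the differential of its predecessor. -/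
def NegTurningAt (c m : ℕ) : Prop := D.TurningAt c m ∧ D.srcIsStartAt c (m - 1)

end StdDiagram

/-! ### Bifiltered complexes over 𝔽₂ -/

/-- A based, bifiltered, Maslov-graded complex over `𝔽₂ = ZMod 2`:  `d x y` is the
coefficient of the basis element `y` in the differential of the basis element `x`,
`gr` is the Maslov grading and `(fa, fb)` the `(i, j)`-bifiltration levels of the
basis elements. -/
structure BFC where
  ι : Type
  fin : Fintype ι
  dec : DecidableEq ι
  d : ι → ι → ZMod 2
  gr : ι → ℤ
  fa : ι → ℤ
  fb : ι → ℤ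

attribute [instance] BFC.fin BFC.dec

namespace BFC

/-- The dual of a bifiltered complex. -/
def dual (C : BFC) : BFC :=
  ⟨C.ι, C.fin, C.dec, fun u v => C.d v u, fun u => - C.gr u, fun u => - C.fa u,
    fun u => - C.fb u⟩

/-- The subcomplex (of a direct summand) spanned by the basis elements selected
by `S`. -/
def sub (C : BFC) (S : C.ι → Bool) : BFC where
  ι := {u : C.ι // S u = true}
  fin := Subtype.fintype _
  dec := Classical.decEq _
  d u v := C.d u.1 v.1
  gr u := C.gr u.1
  fa u := C.fa u.1
  fb u := C.fb u.1

/-- The number of basis elements in Maslov grading `g`. -/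
def grCount (C : BFC) (g : ℤ) : ℕ := (Finset.univ.filter fun u : C.ι => C.gr u = g).card

end BFC

/-- Definition 2.1: a positive staircase with `2N + 1` generators
`y₁, x₁, y₂, x₂, …, y_{N+1}` (even positions along the zigzag are the `y`'s, odd
positions the `x`'s), with `∂ xₗ = yₗ + y_{ℓ+1}`, `∂ yₗ = 0`, where consecutive
generators differ in only one of the two filtration coordinates, alternately. -/
def IsPosStaircaseOf (N : ℕ) (C : BFC) : Prop :=
  ∃ (e : Fin (2 * N + 1) ≃ C.ι) (f : Bool),
    (∀ k l : Fin (2 * N + 1), C.d (e k) (e l) =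
      if k.1 % 2 = 1 ∧ (k.1 = l.1 + 1 ∨ l.1 = k.1 + 1) then 1 else 0) ∧
    (∀ k l : Fin (2 * N + 1), l.1 = k.1 + 1 →
      (C.gr (e l) = C.gr (e k) + (if k.1 % 2 = 0 then 1 else -1)) ∧
      (if decide (k.1 % 2 = 0) = f then
        C.fb (e k) = C.fb (e l) ∧
          (if k.1 % 2 = 0 then C.fa (e k) < C.fa (e l) else C.fa (e l) < C.fa (e k))
      else
        C.fa (e k) = C.fa (e l) ∧
          (if k.1 % 2 = 0 then C.fb (e k) < C.fb (e l) else C.fb (e l) < C.fb (e k))))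

/-- A positive staircase (of any length). -/
def IsPosStaircase (C : BFC) : Prop := ∃ N : ℕ, IsPosStaircaseOf N C

/-- A negative staircase is the dual of a positive staircase. -/
def IsNegStaircase (C : BFC) : Prop := IsPosStaircase C.dual

/-- A staircase: a positive or a negative staircase. -/
def IsStaircase (C : BFC) : Prop := IsPosStaircase C ∨ IsNegStaircase C

/-- A staircase of given sign (`true` = positive). -/
def IsSignedStaircase (b : Bool) (C : BFC) : Prop :=
  if b then IsPosStaircase C else IsNegStaircase C

/-- A box of length 1: generators `a, b, c, d` at bifiltration levels
`(0,0), (0,1), (1,0), (1,1)` (up to an overall shift), with `∂d = b + c`,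
`∂b = ∂c = a`, `∂a = 0`. -/
def IsBox (C : BFC) : Prop :=
  ∃ (e : Fin 4 ≃ C.ι) (a0 b0 g0 : ℤ),
    C.fa (e 0) = a0 ∧ C.fb (e 0) = b0 ∧ C.gr (e 0) = g0 ∧
    C.fa (e 1) = a0 ∧ C.fb (e 1) = b0 + 1 ∧ C.gr (e 1) = g0 + 1 ∧
    C.fa (e 2) = a0 + 1 ∧ C.fb (e 2) = b0 ∧ C.gr (e 2) = g0 + 1 ∧
    C.fa (e 3) = a0 + 1 ∧ C.fb (e 3) = b0 + 1 ∧ C.gr (e 3) = g0 + 2 ∧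
    (∀ k l : Fin 4, C.d (e k) (e l) =
      if (k = 3 ∧ (l = 1 ∨ l = 2)) ∨ ((k = 1 ∨ k = 2) ∧ l = 0) then 1 else 0)

/-- `C` is the direct sum of a complex satisfying `P1` and one satisfying `P2`. -/
def IsDirectSumOf (C : BFC) (P1 P2 : BFC → Prop) : Prop :=
  ∃ S : C.ι → Bool, (∀ u v : C.ι, S u ≠ S v → C.d u v = 0) ∧
    P1 (C.sub S) ∧ P2 (C.sub fun u => ! S u)

/-- Definition 2.3 (a): a positive almost staircase of type (a), with generators
`x₁, …, x_{2k}`, `y₁, …, y_{2k+1}`, `y'_{k+1}` and `z`. -/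
def IsPosAlmostStairA (C : BFC) : Prop :=
  ∃ k : ℕ, 1 ≤ k ∧ ∃ (X Y : ℕ → C.ι) (y' z : C.ι) (a0 b0 : ℤ),
    Fintype.card C.ι = 4 * k + 3 ∧
    (∀ u : C.ι, u = y' ∨ u = z ∨ (∃ ℓ, 1 ≤ ℓ ∧ ℓ ≤ 2 * k ∧ u = X ℓ) ∨
      (∃ ℓ, 1 ≤ ℓ ∧ ℓ ≤ 2 * k + 1 ∧ u = Y ℓ)) ∧
    (∀ u v : C.ι, C.d u v ≠ 0 → C.gr u = C.gr v + 1) ∧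
    C.fa (Y (k + 1)) = a0 ∧ C.fb (Y (k + 1)) = b0 + 1 ∧
    C.fa y' = a0 + 1 ∧ C.fb y' = b0 ∧ C.fa z = a0 ∧ C.fb z = b0 ∧
    (∀ ℓ, 1 ≤ ℓ → ℓ ≤ 2 * k → C.fb (X ℓ) = C.fb (Y ℓ) ∧ C.fa (Y ℓ) < C.fa (X ℓ)) ∧
    (∀ ℓ, 1 ≤ ℓ → ℓ ≤ 2 * k → ℓ ≠ k →
      C.fa (X ℓ) = C.fa (Y (ℓ + 1)) ∧ C.fb (Y (ℓ + 1)) < C.fb (X ℓ)) ∧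
    (C.fa (X k) = C.fa y' ∧ C.fb y' < C.fb (X k)) ∧
    (∀ ℓ, 1 ≤ ℓ → ℓ ≤ 2 * k → ℓ ≠ k → ℓ ≠ k + 1 →
      ∀ v, C.d (X ℓ) v = if v = Y ℓ ∨ v = Y (ℓ + 1) then 1 else 0) ∧
    (∀ v, C.d (X k) v = if v = Y k ∨ v = Y (k + 1) ∨ v = y' then 1 else 0) ∧
    (∀ v, C.d (X (k + 1)) v = if v = Y (k + 1) ∨ v = Y (k + 2) ∨ v = y' then 1 else 0) ∧
    (∀ v, C.d (Y (k + 1)) v = if v = z then 1 else 0) ∧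
    (∀ v, C.d y' v = if v = z then 1 else 0) ∧
    (∀ ℓ, 1 ≤ ℓ → ℓ ≤ 2 * k + 1 → ℓ ≠ k + 1 → ∀ v, C.d (Y ℓ) v = 0) ∧
    (∀ v, C.d z v = 0)

/-- Definition 2.3 (b): a positive almost staircase of type (b), with generators
`x₁, …, x_{2k+1}`, `x'_{k+1}`, `y₁, …, y_{2k+2}` and `z`. -/
def IsPosAlmostStairB (C : BFC) : Prop :=
  ∃ k : ℕ, 1 ≤ k ∧ ∃ (X Y : ℕ → C.ι) (x' z : C.ι) (a0 b0 : ℤ),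
    Fintype.card C.ι = 4 * k + 5 ∧
    (∀ u : C.ι, u = x' ∨ u = z ∨ (∃ ℓ, 1 ≤ ℓ ∧ ℓ ≤ 2 * k + 1 ∧ u = X ℓ) ∨
      (∃ ℓ, 1 ≤ ℓ ∧ ℓ ≤ 2 * k + 2 ∧ u = Y ℓ)) ∧
    (∀ u v : C.ι, C.d u v ≠ 0 → C.gr u = C.gr v + 1) ∧
    C.fa (X (k + 1)) = a0 ∧ C.fb (X (k + 1)) = b0 - 1 ∧
    C.fa x' = a0 - 1 ∧ C.fb x' = b0 ∧ C.fa z = a0 ∧ C.fb z = b0 ∧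
    (∀ ℓ, 1 ≤ ℓ → ℓ ≤ 2 * k + 1 → C.fb (X ℓ) = C.fb (Y ℓ) ∧ C.fa (Y ℓ) < C.fa (X ℓ)) ∧
    (∀ ℓ, 1 ≤ ℓ → ℓ ≤ 2 * k + 1 → ℓ ≠ k + 1 →
      C.fa (X ℓ) = C.fa (Y (ℓ + 1)) ∧ C.fb (Y (ℓ + 1)) < C.fb (X ℓ)) ∧
    (C.fa x' = C.fa (Y (k + 2)) ∧ C.fb (Y (k + 2)) < C.fb x') ∧
    (∀ ℓ, 1 ≤ ℓ → ℓ ≤ 2 * k + 1 → ℓ ≠ k + 1 →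
      ∀ v, C.d (X ℓ) v = if v = Y ℓ ∨ v = Y (ℓ + 1) then 1 else 0) ∧
    (∀ v, C.d z v = if v = X (k + 1) ∨ v = x' then 1 else 0) ∧
    (∀ v, C.d (X (k + 1)) v = if v = Y (k + 1) ∨ v = Y (k + 2) then 1 else 0) ∧
    (∀ v, C.d x' v = if v = Y (k + 1) ∨ v = Y (k + 2) then 1 else 0) ∧
    (∀ ℓ, 1 ≤ ℓ → ℓ ≤ 2 * k + 2 → ∀ v, C.d (Y ℓ) v = 0)

/-- A positive almost staircase. -/
def IsPosAlmostStaircase (C : BFC) : Prop := IsPosAlmostStairA C ∨ IsPosAlmostStairB C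

/-- A negative almost staircase is the dual of a positive almost staircase. -/
def IsNegAlmostStaircase (C : BFC) : Prop := IsPosAlmostStaircase C.dual

/-- `C'` is obtained from `C` by a filtered change of basis: each basis element is
replaced by itself plus a sum of basis elements of the same Maslov grading and of
bifiltration level not higher in either coordinate. -/
def FilteredBasisChange (C C' : BFC) : Prop :=
  ∃ e : C'.ι ≃ C.ι,
    (∀ u, C'.gr u = C.gr (e u)) ∧ (∀ u, C'.fa u = C.fa (e u)) ∧
    (∀ u, C'.fb u = C.fb (e u)) ∧
    ∃ P Q : Matrix C.ι C.ι (ZMod 2),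
      P * Q = 1 ∧ Q * P = 1 ∧ (∀ u, P u u = 1) ∧
      (∀ u v, u ≠ v → P u v ≠ 0 → C.gr u = C.gr v ∧ C.fa v ≤ C.fa u ∧ C.fb v ≤ C.fb u) ∧
      (∀ u v, C'.d u v = (P * Matrix.of C.d * Q) (e u) (e v))

/-- `C` satisfies `P` after some filtered change of basis. -/
def AfterFCB (C : BFC) (P : BFC → Prop) : Prop := ∃ C', FilteredBasisChange C C' ∧ P C'

/-- The knot Floer chain complex `CFK(H, s)` of the standard diagram, in the spin^c
class of the intersection point `c`: it is generated by the intersection points of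
the class of `c`; the coefficient `⟨∂x, y⟩` counts (mod 2) the embedded bigons in
the universal cover cobounded by `α̃` and `β̃ₛ` from a lift of `x` to a lift of `y`;
the relative Maslov grading drops by `1` along each differential, and the relative
`(i, j)`-bifiltration drops according to the number of lifts of the basepoints `w`
and `z` covered by each bigon. -/
def CFK (D : StdDiagram) (c : ℕ) : BFC where
  ι := {a : Fin D.p // D.SameClass a c}
  fin := Subtype.fintype _
  dec := Classical.decEq _
  d x y := (D.arrowCnt x.1 y.1 : ZMod 2)
  gr x := D.grOf c x.1
  fa x := D.faOf c x.1
  fb x := D.fbOf c x.1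

/-! ### Planar curves crossing the horizontal lines of the plane -/

/-- A `p`-periodic family of nested arcs on a line: `B` is the set of feet of the arcs
and `i` exchanges the two feet of each arc. -/
structure RainbowFamily (p : ℤ) (B : ℤ → Prop) (i : ℤ → ℤ) : Prop where
  per : ∀ x k, B (x + p * k) ↔ B x
  iper : ∀ x k, i (x + p * k) = i x + p * k
  mem : ∀ x, B x → B (i x)
  inv : ∀ x, B x → i (i x) = x
  ne : ∀ x, B x → i x ≠ x
  width : ∀ x, B x → i x < x + p
  nest : ∀ x z, B x → x ≤ z → z ≤ i x → B z ∧ i z = x + i x - z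
  center : ∀ x y, B x → B y → ∃ k, x + i x = y + i y + 2 * p * k

namespace RainbowFamily

variable {p : ℤ} {B : ℤ → Prop} {i : ℤ → ℤ}

theorem lt_width (h : RainbowFamily p B i) {x : ℤ} (hx : B x) : x < i x + p := by
  have := h.width _ (h.mem _ hx)
  rwa [h.inv _ hx] at this

theorem nest_left (h : RainbowFamily p B i) {x z : ℤ} (hx : B x) (h1 : i x ≤ z) (h2 : z ≤ x) :
    B z ∧ i z = x + i x - z := by
  have := h.nest (i x) z (h.mem _ hx) h1 (by rw [h.inv _ hx]; exact h2)
  rw [h.inv _ hx] at this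
  exact ⟨this.1, by rw [this.2]; ring⟩

/-- Two arcs whose feet lie in an interval of length less than `p` are concentric. -/
theorem concentric (h : RainbowFamily p B i) {x y a b : ℤ} (hx : B x) (hy : B y)
    (hab : b < a + p) (h1 : a ≤ x) (h2 : x ≤ b) (h3 : a ≤ y) (h4 : y ≤ b)
    (h5 : a ≤ i x) (h6 : i x ≤ b) (h7 : a ≤ i y) (h8 : i y ≤ b) :
    x + i x = y + i y := by
  obtain ⟨k, hk⟩ := h.center x y hx hy
  have hp : 0 < p := by omega
  have : k = 0 := by
    have h1 : k < 1 := by by_contra hc; push Not at hc; nlinarith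
    have h2 : -1 < k := by by_contra hc; push Not at hc; nlinarith
    omega
  subst this
  linarith

theorem eq_of_inv_eq (h : RainbowFamily p B i) {x y k : ℤ} (hx : B x) (hy : B y)
    (e : i x = i y + p * k) : x = y + p * k := by
  have := congrArg i e
  rwa [h.inv x hx, h.iper, h.inv y hy] at this

theorem mirror (h : RainbowFamily p B i) :
    RainbowFamily p (fun x => B (-x)) (fun x => -i (-x)) where
  per x k := by rw [← h.per (-x) (-k)]; ring_nf
  iper x k := by
    have := h.iper (-x) (-k)
    rw [show -(x + p * k) = -x + p * -k by ring, this]; ring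
  mem x hx := by simpa using h.mem _ hx
  inv x hx := by simp [h.inv _ hx]
  ne x hx e := h.ne _ hx (by omega)
  width x hx := by have := h.lt_width hx; omega
  nest x z hx h1 h2 := by
    have := h.nest_left (x := -x) (z := -z) hx (by omega) (by omega)
    exact ⟨this.1, by rw [this.2]; ring⟩
  center x y hx hy := by
    obtain ⟨k, hk⟩ := h.center _ _ hx hy
    exact ⟨-k, by linarith⟩

end RainbowFamily

/-- A periodic family of curves in the plane in standard form.  Each horizontal line carries the
points `ℤ`; `B` and `T` are the feet of the arcs attached from above and from below to a line,
`iB` and `iT` exchange the feet of these arcs, and the remaining points of a line are joined to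
the next line by strands, along `asc` upwards and along `desc` downwards.
`Up x` says that the curve is directed upwards at `x`. -/
structure CurveModel where
  p : ℤ
  B : ℤ → Prop
  iB : ℤ → ℤ
  T : ℤ → Prop
  iT : ℤ → ℤ
  asc : ℤ → ℤ
  desc : ℤ → ℤ
  Up : ℤ → Prop
  hB : RainbowFamily p B iB
  hT : RainbowFamily p T iT
  asc_mem : ∀ x, ¬ B x → ¬ T (asc x)
  desc_mem : ∀ x, ¬ T x → ¬ B (desc x)
  desc_asc : ∀ x, ¬ B x → desc (asc x) = x
  asc_desc : ∀ x, ¬ T x → asc (desc x) = x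
  asc_lt : ∀ x y, ¬ B x → ¬ B y → x < y → asc x < asc y
  asc_per : ∀ x k, asc (x + p * k) = asc x + p * k
  desc_per : ∀ x k, desc (x + p * k) = desc x + p * k
  up_per : ∀ x k, Up (x + p * k) ↔ Up x
  up_iB : ∀ x, B x → (Up (iB x) ↔ ¬ Up x)
  up_iT : ∀ x, T x → (Up (iT x) ↔ ¬ Up x)
  up_asc : ∀ x, ¬ B x → (Up (asc x) ↔ Up x)
  no_loop : ∀ x, B x → T (iB x) → iT (iB x) ≠ x

namespace CurveModel

variable (M : CurveModel)

theorem desc_lt (x y : ℤ) (hx : ¬ M.T x) (hy : ¬ M.T y) (h : x < y) : M.desc x < M.desc y := by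
  rcases lt_trichotomy (M.desc x) (M.desc y) with h1 | h1 | h1
  · exact h1
  · have := congrArg M.asc h1
    rw [M.asc_desc x hx, M.asc_desc y hy] at this
    omega
  · have := M.asc_lt _ _ (M.desc_mem y hy) (M.desc_mem x hx) h1
    rw [M.asc_desc x hx, M.asc_desc y hy] at this
    omega

theorem up_desc (x : ℤ) (hx : ¬ M.T x) : M.Up (M.desc x) ↔ M.Up x := by
  rw [← M.up_asc _ (M.desc_mem x hx), M.asc_desc x hx]

/-- The reflection of the curves in a vertical line. -/
def mirror : CurveModel where
  p := M.p
  B x := M.B (-x)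
  iB x := -M.iB (-x)
  T x := M.T (-x)
  iT x := -M.iT (-x)
  asc x := -M.asc (-x)
  desc x := -M.desc (-x)
  Up x := M.Up (-x)
  hB := M.hB.mirror
  hT := M.hT.mirror
  asc_mem x hx := by simpa using M.asc_mem _ hx
  desc_mem x hx := by simpa using M.desc_mem _ hx
  desc_asc x hx := by simp [M.desc_asc _ hx]
  asc_desc x hx := by simp [M.asc_desc _ hx]
  asc_lt x y hx hy h := by have := M.asc_lt _ _ hy hx (by omega : -y < -x); omega
  asc_per x k := by
    have := M.asc_per (-x) (-k)
    rw [show -(x + M.p * k) = -x + M.p * -k by ring, this]; ring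
  desc_per x k := by
    have := M.desc_per (-x) (-k)
    rw [show -(x + M.p * k) = -x + M.p * -k by ring, this]; ring
  up_per x k := by rw [← M.up_per (-x) (-k)]; ring_nf
  up_iB x hx := by simpa using M.up_iB _ hx
  up_iT x hx := by simpa using M.up_iT _ hx
  up_asc x hx := by simpa using M.up_asc _ hx
  no_loop x hx hx' h := M.no_loop (-x) hx (by simpa using hx') (by simp at h; omega)

/-- The same curves with all directions reversed. -/
def reverse : CurveModel :=
  { M with
    Up := fun x => ¬ M.Up x
    up_per := fun x k => not_congr (M.up_per x k)
    up_iB := fun x hx => not_congr (M.up_iB x hx)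
    up_iT := fun x hx => not_congr (M.up_iT x hx)
    up_asc := fun x hx => not_congr (M.up_asc x hx) }

/-- The reflection of the curves in a horizontal line. -/
def flip : CurveModel where
  p := M.p
  B := M.T
  iB := M.iT
  T := M.B
  iT := M.iB
  asc := M.desc
  desc := M.asc
  Up x := ¬ M.Up x
  hB := M.hT
  hT := M.hB
  asc_mem := M.desc_mem
  desc_mem := M.asc_mem
  desc_asc := M.asc_desc
  asc_desc := M.desc_asc
  asc_lt := M.desc_lt
  asc_per := M.desc_per
  desc_per := M.asc_per
  up_per x k := not_congr (M.up_per x k)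
  up_iB x hx := not_congr (M.up_iT x hx)
  up_iT x hx := not_congr (M.up_iB x hx)
  up_asc x hx := not_congr (M.up_desc x hx)
  no_loop x hx hx' h := M.no_loop (M.iT x) hx' (by rwa [h]) (by rw [h])

/-- `M.UArc x y`: the curve through the point `x` of a line runs above that line from `x` until
it returns to it at `y`. -/
inductive UArc : ℤ → ℤ → Prop
  | rainbow (x : ℤ) (hx : M.B x) : UArc x (M.iB x)
  | big (k : ℕ) (u v : ℕ → ℤ) (arc : ∀ i, i ≤ k → UArc (u i) (v i))
      (link : ∀ i, i < k → M.T (v i) ∧ u (i + 1) = M.iT (v i))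
      (start : ¬ M.T (u 0)) (finish : ¬ M.T (v k)) : UArc (M.desc (u 0)) (M.desc (v k))

variable {M}

namespace UArc

theorem symm {x y : ℤ} (h : M.UArc x y) : M.UArc y x := by
  induction h with
  | rainbow x hx =>
    have := UArc.rainbow (M := M) _ (M.hB.mem x hx)
    rwa [M.hB.inv x hx] at this
  | big k u v arc link start finish ih =>
    have := UArc.big (M := M) k (fun i => v (k - i)) (fun i => u (k - i))
      (fun i hi => ih (k - i) (by omega))
      (fun i hi => by
        obtain ⟨h1, h2⟩ := link (k - (i + 1)) (by omega)
        have e : k - (i + 1) + 1 = k - i := by omega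
        rw [e] at h2
        refine ⟨?_, ?_⟩
        · simp only [h2]; exact M.hT.mem _ h1
        · simp only [h2]; exact (M.hT.inv _ h1).symm)
      (by simpa using finish) (by simpa using start)
    simpa using this

theorem shift {x y : ℤ} (h : M.UArc x y) (n : ℤ) : M.UArc (x + M.p * n) (y + M.p * n) := by
  induction h with
  | rainbow x hx =>
    have := UArc.rainbow (M := M) (x + M.p * n) ((M.hB.per x n).2 hx)
    rwa [M.hB.iper] at this
  | big k u v arc link start finish ih =>
    have := UArc.big (M := M) k (fun i => u i + M.p * n) (fun i => v i + M.p * n) ih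
      (fun i hi => ⟨(M.hT.per _ _).2 (link i hi).1, by
        simp only [(link i hi).2, M.hT.iper]⟩)
      (fun h => start ((M.hT.per _ _).1 h)) (fun h => finish ((M.hT.per _ _).1 h))
    simpa only [M.desc_per] using this

theorem eq_iB {x y : ℤ} (h : M.UArc x y) (hx : M.B x) : y = M.iB x := by
  cases h with
  | rainbow => rfl
  | big k u v arc link start finish => exact absurd hx (M.desc_mem _ start)

theorem mem_iff {x y : ℤ} (h : M.UArc x y) : M.B x ↔ M.B y := by
  constructor
  · intro hx; rw [h.eq_iB hx]; exact M.hB.mem _ hx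
  · intro hy; rw [h.symm.eq_iB hy]; exact M.hB.mem _ hy

theorem right_unique {x y : ℤ} (h : M.UArc x y) :
    ∀ {x' y' : ℤ}, M.UArc x' y' → x' = x → y' = y := by
  induction h with
  | rainbow x hx => intro x' y' h' e; subst e; exact h'.eq_iB hx
  | big k u v arc link start finish ih =>
    intro x' y' h' e
    cases h' with
    | rainbow _ hx => rw [e] at hx; exact absurd hx (M.desc_mem _ start)
    | big k' u' v' arc' link' start' finish' =>
      have e0 : u' 0 = u 0 := by
        have := congrArg M.asc e
        rwa [M.asc_desc _ start, M.asc_desc _ start'] at this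
      have eu : ∀ j, j ≤ k → j ≤ k' → u' j = u j := by
        intro j
        induction j with
        | zero => intro _ _; exact e0
        | succ j ihj =>
          intro h1 h2
          rw [(link j (by omega)).2, (link' j (by omega)).2,
            ih j (by omega) (arc' j (by omega)) (ihj (by omega) (by omega))]
      have ev : ∀ j, j ≤ k → j ≤ k' → v' j = v j := fun j h1 h2 =>
        ih j h1 (arc' j h2) (eu j h1 h2)
      have ek : k' = k := by
        rcases lt_trichotomy k k' with h | h | h
        · exact absurd (ev k le_rfl h.le ▸ (link' k h).1) finish
        · exact h.symm
        · exact absurd ((ev k' h.le le_rfl).symm ▸ (link k' h).1) finish'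
      subst ek
      rw [ev k' le_rfl le_rfl]

theorem up_iff {x y : ℤ} (h : M.UArc x y) : M.Up y ↔ ¬ M.Up x := by
  induction h with
  | rainbow x hx => exact M.up_iB x hx
  | big k u v arc link start finish ih =>
    rw [M.up_desc _ start, M.up_desc _ finish]
    have : ∀ j, j ≤ k → (M.Up (u j) ↔ M.Up (u 0)) := by
      intro j
      induction j with
      | zero => simp
      | succ j ihj =>
        intro hj
        rw [(link j (by omega)).2, M.up_iT _ (link j (by omega)).1, ih j (by omega),
          not_not]
        exact ihj (by omega)
    rw [ih k le_rfl, this k le_rfl]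

theorem ne {x y : ℤ} (h : M.UArc x y) : x ≠ y := by
  rintro rfl
  have := h.up_iff
  tauto

theorem mirror {x y : ℤ} (h : M.UArc x y) : M.mirror.UArc (-x) (-y) := by
  induction h with
  | rainbow x hx =>
    have := UArc.rainbow (M := M.mirror) (-x) (by simpa [CurveModel.mirror] using hx)
    simpa [CurveModel.mirror] using this
  | big k u v arc link start finish ih =>
    have := UArc.big (M := M.mirror) k (fun i => -u i) (fun i => -v i) ih
      (fun i hi => by simpa [CurveModel.mirror] using link i hi)
      (by simpa [CurveModel.mirror] using start) (by simpa [CurveModel.mirror] using finish)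
    simpa [CurveModel.mirror] using this

theorem reverse {x y : ℤ} (h : M.UArc x y) : M.reverse.UArc x y := by
  induction h with
  | rainbow x hx => exact UArc.rainbow (M := M.reverse) x hx
  | big k u v arc link start finish ih => exact UArc.big (M := M.reverse) k u v ih link start finish

end UArc

variable (M)

/-- An arc above a line is traversed from its foot `x`, to the left. -/
def LeftB (x : ℤ) : Prop := M.B x ∧ M.Up x ∧ M.iB x < x

/-- An arc below a line is traversed from its foot `x`, to the left. -/
def LeftT (x : ℤ) : Prop := M.T x ∧ ¬ M.Up x ∧ M.iT x < x

/-- The sequences `u` and `v` are the crossings of a curve with a line between a strand by which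
it arrives from below and the strand by which it next leaves downwards. -/
structure Chain (k : ℕ) (u v : ℕ → ℤ) : Prop where
  arc : ∀ i, i ≤ k → M.UArc (u i) (v i)
  link : ∀ i, i < k → M.T (v i) ∧ u (i + 1) = M.iT (v i)
  start : ¬ M.T (u 0)
  finish : ¬ M.T (v k)
  up_start : M.Up (u 0)

variable {M}

theorem LeftT.shift {x : ℤ} (h : M.LeftT x) (n : ℤ) : M.LeftT (x + M.p * n) :=
  ⟨(M.hT.per _ _).2 h.1, fun h' => h.2.1 ((M.up_per _ _).1 h'), by
    have := h.2.2
    rw [M.hT.iper]; omega⟩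

namespace Chain

variable {k : ℕ} {u v : ℕ → ℤ}

theorem up (c : M.Chain k u v) : ∀ j, j ≤ k → M.Up (u j) := by
  intro j
  induction j with
  | zero => intro _; exact c.up_start
  | succ j ih =>
    intro hj
    rw [(c.link j (by omega)).2, M.up_iT _ (c.link j (by omega)).1,
      (c.arc j (by omega)).up_iff, not_not]
    exact ih (by omega)

theorem not_up (c : M.Chain k u v) (j : ℕ) (hj : j ≤ k) : ¬ M.Up (v j) := by
  rw [(c.arc j hj).up_iff, not_not]
  exact c.up j hj

theorem iT_succ (c : M.Chain k u v) (j : ℕ) (hj : j < k) :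
    M.T (u (j + 1)) ∧ M.iT (u (j + 1)) = v j := by
  obtain ⟨h1, h2⟩ := c.link j hj
  rw [h2]
  exact ⟨M.hT.mem _ h1, M.hT.inv _ h1⟩

theorem not_congruent (c : M.Chain k u v) (n : ℤ) :
    ∀ i j, i < j → j ≤ k → u j ≠ u i + M.p * n := by
  intro i
  induction i with
  | zero =>
    intro j hij hj e
    obtain ⟨j, rfl⟩ : ∃ j', j = j' + 1 := ⟨j - 1, by omega⟩
    have := (c.iT_succ j (by omega)).1
    rw [e, M.hT.per] at this
    exact c.start this
  | succ i ih =>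
    intro j hij hj e
    obtain ⟨j, rfl⟩ : ∃ j', j = j' + 1 := ⟨j - 1, by omega⟩
    have e' : v j = v i + M.p * n := by
      rw [← (c.iT_succ j (by omega)).2, e, M.hT.iper, (c.iT_succ i (by omega)).2]
    exact ih j (by omega) (by omega)
      (((c.arc i (by omega)).symm.shift n).right_unique (c.arc j (by omega)).symm e')

theorem le_of_right (c : M.Chain k u v) (i : ℕ) : ∀ j, i ≤ j → j ≤ k →
    (∀ m, i ≤ m → m < j → u m < v m ∧ ¬ M.LeftT (v m)) → u i ≤ u j := by
  intro j hij
  induction j, hij using Nat.le_induction with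
  | base => intros; exact le_rfl
  | succ j hij ih =>
    intro hj h
    have h1 := ih (by omega) (fun m hm hm' => h m hm (by omega))
    obtain ⟨h2, h3⟩ := h j hij (by omega)
    obtain ⟨h4, h5⟩ := c.link j (by omega)
    have h6 : ¬ M.iT (v j) < v j := fun h => h3 ⟨h4, c.not_up j (by omega), h⟩
    omega

theorem lt_of_right (c : M.Chain k u v) (i : ℕ) (hi : i ≤ k) (hk : u k < v k)
    (h : ∀ m, i ≤ m → m < k → u m < v m ∧ ¬ M.LeftT (v m)) : u i < v k :=
  (c.le_of_right i k hi le_rfl h).trans_lt hk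

theorem right_of_ne (c : M.Chain k u v) (harc : ∀ i, i ≤ k → u i < v i ∨ M.LeftB (u i))
    (UB : ∀ x y, M.LeftB x → M.LeftB y → ∃ n, y = x + M.p * n) {i m : ℕ} (hi : i ≤ k)
    (h : M.LeftB (u i)) (hm : m ≤ k) (hne : m ≠ i) : u m < v m := by
  rcases harc m hm with h1 | h1
  · exact h1
  · exfalso
    rcases lt_or_gt_of_ne hne with h2 | h2
    · obtain ⟨n, hn⟩ := UB _ _ h1 h
      exact c.not_congruent n m i h2 hi hn
    · obtain ⟨n, hn⟩ := UB _ _ h h1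
      exact c.not_congruent n i m h2 hm hn

theorem eq_of_leftT (c : M.Chain k u v)
    (UT : ∀ x y, M.LeftT x → M.LeftT y → ∃ n, y = x + M.p * n) {i m : ℕ} (hi : i < k)
    (h : M.LeftT (v i)) (hm : m < k) (h' : M.LeftT (v m)) : m = i := by
  have key : ∀ a b, a < b → b < k → M.LeftT (v a) → M.LeftT (v b) → False := by
    intro a b hab hb h1 h2
    obtain ⟨n, hn⟩ := UT _ _ h1 h2
    refine c.not_congruent n (a + 1) (b + 1) (by omega) (by omega) ?_
    rw [(c.link b hb).2, (c.link a (by omega)).2, hn, M.hT.iper]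
  rcases lt_trichotomy m i with h1 | h1 | h1
  · exact (key m i h1 hi h' h).elim
  · exact h1
  · exact (key i m h1 hm h h').elim

end Chain

/-- A curve whose arcs run to the right wherever it oscillates about a line has all its arcs above
a line directed to the right, apart from single arcs. -/
theorem UArc.right_or_leftB
    (H : ∀ k u v, M.Chain k u v → (∀ i, i ≤ k → u i < v i ∨ M.LeftB (u i)) → u 0 < v k)
    {x y : ℤ} (h : M.UArc x y) : M.Up x → x < y ∨ M.LeftB x := by
  induction h with
  | rainbow x hx =>
    intro hu
    rcases lt_trichotomy x (M.iB x) with h | h | h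
    · exact Or.inl h
    · exact absurd h.symm (M.hB.ne x hx)
    · exact Or.inr ⟨hx, hu, h⟩
  | big k u v arc link start finish ih =>
    intro hu
    rw [M.up_desc _ start] at hu
    have c : M.Chain k u v := ⟨arc, link, start, finish, hu⟩
    exact Or.inl (M.desc_lt _ _ start finish (H k u v c fun i hi => ih i hi (c.up i hi)))

theorem UArc.right_of_coherent (hB : ∀ x, ¬ M.LeftB x) (hT : ∀ x, ¬ M.LeftT x)
    {x y : ℤ} (h : M.UArc x y) (hx : M.Up x) : x < y := by
  refine (h.right_or_leftB ?_ hx).resolve_right (hB x)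
  intro k u v c harc
  have : ∀ i, i ≤ k → u i < v i := fun i hi => (harc i hi).resolve_right (hB _)
  exact c.lt_of_right 0 (by omega) (this k le_rfl) fun m _ hm => ⟨this m (by omega), hT _⟩

/-- A chain in which a left arc from above directly follows a left arc from below. -/
theorem Chain.lt_of_leftT_leftB {k : ℕ} {u v : ℕ → ℤ} (c : M.Chain k u v)
    (harc : ∀ i, i ≤ k → u i < v i ∨ M.LeftB (u i))
    (UB : ∀ x y, M.LeftB x → M.LeftB y → ∃ n, y = x + M.p * n)
    (UT : ∀ x y, M.LeftT x → M.LeftT y → ∃ n, y = x + M.p * n)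
    (H : ∀ x, M.LeftB x → M.T x ∧ M.LeftT (M.iT x))
    (H' : ∀ g, M.LeftT g → M.LeftB (M.iT g)) : u 0 < v k := by
  by_cases hex : ∃ i, i ≤ k ∧ M.LeftB (u i)
  · obtain ⟨i, hi, ha⟩ := hex
    obtain ⟨hTi, hg⟩ := H _ ha
    obtain ⟨j, rfl⟩ : ∃ j, i = j + 1 := by
      refine ⟨i - 1, ?_⟩
      rcases i with _ | i
      · exact absurd hTi c.start
      · rfl
    have hR : ∀ m, m ≤ k → m ≠ j + 1 → u m < v m := fun m hm hne =>
      c.right_of_ne harc UB hi ha hm hne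
    rw [(c.iT_succ j (by omega)).2] at hg
    have hRT : ∀ m, m < k → m ≠ j → ¬ M.LeftT (v m) := fun m hm hne h =>
      hne (c.eq_of_leftT UT (by omega) hg hm h)
    have ev : v (j + 1) = M.iB (u (j + 1)) := (c.arc _ hi).eq_iB ha.1
    have egT := (c.link j (by omega))
    -- the end of the left arc lies to the right of the start of the chain
    have hu0 : u 0 < v (j + 1) := by
      have h0j := c.le_of_right 0 j (by omega) (by omega) fun m _ hm =>
        ⟨hR m (by omega) (by omega), hRT m (by omega) (by omega)⟩
      have hj := hR j (by omega) (by omega)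
      have hjarc := c.arc j (by omega)
      have hga := hg.2.2
      have hab := ha.2.2
      by_contra hlt
      push Not at hlt
      rcases le_or_gt (u j) (u (j + 1)) with h1 | h1
      · obtain ⟨hb, e⟩ := M.hB.nest_left ha.1 (z := u j) (by omega) h1
        have := hjarc.eq_iB hb
        omega
      · obtain ⟨hb, e⟩ := M.hT.nest_left hg.1 (z := u j) (by omega) (by omega)
        obtain ⟨l, rfl⟩ : ∃ l, j = l + 1 := by
          refine ⟨j - 1, ?_⟩
          rcases j with _ | j
          · exact absurd hb c.start
          · rfl
        have el := (c.iT_succ l (by omega)).2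
        have hlR := hR l (by omega) (by omega)
        have hlRT := hRT l (by omega) (by omega)
        have elT := c.link l (by omega)
        have hlt' : v l < u (l + 1) := by
          have := M.hT.ne _ elT.1
          have : ¬ M.iT (v l) < v l := fun h => hlRT ⟨elT.1, c.not_up l (by omega), h⟩
          omega
        have h0l := c.le_of_right 0 l (by omega) (by omega) fun m _ hm =>
          ⟨hR m (by omega) (by omega), hRT m (by omega) (by omega)⟩
        rcases le_or_gt (u l) (u (l + 1 + 1)) with h2 | h2
        · obtain ⟨hb, e'⟩ := M.hB.nest_left ha.1 (z := u l) (by omega) h2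
          have := (c.arc l (by omega)).eq_iB hb
          omega
        · obtain ⟨hb', e'⟩ := M.hT.nest_left hg.1 (z := u l) (by omega) (by omega)
          obtain ⟨n, rfl⟩ : ∃ n, l = n + 1 := by
            refine ⟨l - 1, ?_⟩
            rcases l with _ | l
            · exact absurd hb' c.start
            · rfl
          have en := (c.iT_succ n (by omega)).2
          refine hRT n (by omega) (by omega) ⟨(c.link n (by omega)).1, c.not_up n (by omega), ?_⟩
          rw [← (c.link n (by omega)).2]
          omega
    rcases Nat.lt_or_ge (j + 1) k with h | h
    · have h1 := c.lt_of_right (j + 2) (by omega) (hR k le_rfl (by omega)) fun m h1 h2 =>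
        ⟨hR m (by omega) (by omega), hRT m (by omega) (by omega)⟩
      have h2 := hRT (j + 1) h (by omega)
      have h3 := c.link (j + 1) h
      have h4 : ¬ M.iT (v (j + 1)) < v (j + 1) := fun h' =>
        h2 ⟨h3.1, c.not_up _ (by omega), h'⟩
      rw [← h3.2] at h4
      have : u (j + 1 + 1) = u (j + 2) := rfl
      omega
    · have : k = j + 1 := by omega
      rw [this]; exact hu0
  · push Not at hex
    have hR : ∀ i, i ≤ k → u i < v i := fun i hi => (harc i hi).resolve_right (hex i hi)
    refine c.lt_of_right 0 (by omega) (hR k le_rfl) fun m _ hm => ⟨hR m (by omega), fun h => ?_⟩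
    have := H' _ h
    rw [← (c.link m hm).2] at this
    exact hex _ (by omega) this

/-- A chain in which the left arc from above is followed by a left arc from below after
two intermediate right arcs. -/
theorem Chain.lt_of_leftB_right_right_leftT {k : ℕ} {u v : ℕ → ℤ} (c : M.Chain k u v)
    (harc : ∀ i, i ≤ k → u i < v i ∨ M.LeftB (u i))
    (UB : ∀ x y, M.LeftB x → M.LeftB y → ∃ n, y = x + M.p * n)
    (UT : ∀ x y, M.LeftT x → M.LeftT y → ∃ n, y = x + M.p * n)
    (H : ∀ x, M.LeftB x → M.T (M.iB x) ∧ ¬ M.LeftT (M.iB x) ∧ M.B (M.iT (M.iB x)) ∧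
      M.LeftT (M.iB (M.iT (M.iB x))))
    (H' : ∀ g, M.LeftT g → M.B g ∧ M.T (M.iB g) ∧ M.B (M.iT (M.iB g)) ∧
      M.LeftB (M.iB (M.iT (M.iB g)))) : u 0 < v k := by
  by_cases hex : ∃ i, i ≤ k ∧ M.LeftB (u i)
  · obtain ⟨i, hi, ha⟩ := hex
    obtain ⟨hTy, hTy', hBc, hg⟩ := H _ ha
    have hR : ∀ m, m ≤ k → m ≠ i → u m < v m := fun m hm hne =>
      c.right_of_ne harc UB hi ha hm hne
    have ev : v i = M.iB (u i) := (c.arc _ hi).eq_iB ha.1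
    rw [← ev] at hTy hTy' hBc hg
    have hik : i < k := lt_of_le_of_ne hi fun h => c.finish (h ▸ hTy)
    have e1 := (c.link i hik).2
    rw [← e1] at hBc hg
    have ev1 : v (i + 1) = M.iB (u (i + 1)) := (c.arc _ (by omega)).eq_iB hBc
    rw [← ev1] at hg
    have hik1 : i + 1 < k := lt_of_le_of_ne hik fun h => c.finish (h ▸ hg.1)
    have hRT : ∀ m, m < k → m ≠ i + 1 → ¬ M.LeftT (v m) := fun m hm hne h =>
      hne (c.eq_of_leftT UT (by omega) hg hm h)
    have hRT' : ∀ m, m < k → m ≠ i + 1 → v m < u (m + 1) := fun m hm hne => by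
      have h1 := c.link m hm
      have h2 := M.hT.ne _ h1.1
      have h3 : ¬ M.iT (v m) < v m := fun h => hRT m hm hne ⟨h1.1, c.not_up m (by omega), h⟩
      omega
    have e2 : u (i + 2) = M.iT (v (i + 1)) := (c.link (i + 1) hik1).2
    have hyx : v i < u i := by rw [ev]; exact ha.2.2
    have hw : u i < v i + M.p := by rw [ev]; exact M.hB.lt_width ha.1
    have hyc := hRT' i hik (by omega)
    have hcd := hR (i + 1) (by omega) (by omega)
    have hed : u (i + 2) < v (i + 1) := by rw [e2]; exact hg.2.2
    -- the arcs `x → y → c` spiral inwards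
    have hcx : u (i + 1) < u i := by
      by_contra hcx
      push Not at hcx
      have hne : u (i + 1) ≠ u i := fun h => by
        have := c.not_congruent 0 i (i + 1) (by omega) hik
        rw [mul_zero, add_zero] at this
        exact this h
      obtain ⟨hTx, ex⟩ := M.hT.nest (v i) (u i) hTy (by omega) (by omega)
      obtain ⟨j, rfl⟩ : ∃ j, i = j + 1 := by
        refine ⟨i - 1, ?_⟩
        rcases i with _ | i
        · exact absurd hTx c.start
        · rfl
      have ej := (c.iT_succ j (by omega)).2
      have hj := hRT' j (by omega) (by omega)
      obtain ⟨hBt, et⟩ := M.hB.nest_left ha.1 (z := v j) (by omega) (by omega)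
      have eu := (c.arc j (by omega)).symm.eq_iB hBt
      have hjR := hR j (by omega) (by omega)
      obtain ⟨hTt, ett⟩ := M.hT.nest _ (u j) hTy (by omega) (by omega)
      obtain ⟨l, rfl⟩ : ∃ l, j = l + 1 := by
        refine ⟨j - 1, ?_⟩
        rcases j with _ | j
        · exact absurd hTt c.start
        · rfl
      have el := (c.iT_succ l (by omega)).2
      have hl := hRT' l (by omega) (by omega)
      omega
    obtain ⟨-, ed⟩ := M.hB.nest_left ha.1 (z := u (i + 1)) (by omega) (by omega)
    have hTc : M.T (u (i + 1)) := (c.iT_succ i hik).1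
    have hic : M.iT (u (i + 1)) = v i := (c.iT_succ i hik).2
    have hey : u (i + 2) < v i := by
      by_contra hey
      push Not at hey
      have := M.hT.concentric (a := v i) (b := u i) hTy hg.1 hw (by omega) (by omega) (by omega)
        (by omega) (by omega) (by omega) (by omega) (by omega)
      omega
    have hik2 : i + 2 ≤ k := hik1
    have hf := hR (i + 2) (by omega) (by omega)
    have earc := c.arc (i + 2) hik2
    have hfx : u i < v (i + 2) := by
      by_contra hfx
      push Not at hfx
      have hfy : v (i + 2) < v i := by
        by_contra hfy
        push Not at hfy
        obtain ⟨hb, e⟩ := M.hB.nest_left ha.1 (z := v (i + 2)) (by omega) (by omega)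
        have := earc.symm.eq_iB hb
        omega
      obtain ⟨hTf, ef⟩ := M.hT.nest_left hg.1 (z := v (i + 2)) (by omega) (by omega)
      obtain ⟨-, ey⟩ := M.hT.nest_left hg.1 (z := v i) (by omega) (by omega)
      have hik3 : i + 2 < k := lt_of_le_of_ne hik2 fun h => c.finish (h ▸ hTf)
      have e3 : u (i + 3) = M.iT (v (i + 2)) := (c.link (i + 2) hik3).2
      obtain ⟨hb, e⟩ := M.hB.nest_left ha.1 (z := u (i + 3)) (by omega) (by omega)
      have e4 := (c.arc (i + 3) (by omega)).eq_iB hb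
      have h4 := hR (i + 3) (by omega) (by omega)
      obtain ⟨hTh, eh⟩ := M.hT.nest_left hg.1 (z := v (i + 3)) (by omega) (by omega)
      have hik4 : i + 3 < k := lt_of_le_of_ne (by omega) fun h => c.finish (h ▸ hTh)
      have h5 := hRT' (i + 3) hik4 (by omega)
      have e5 := (c.link (i + 3) hik4).2
      omega
    have h0 := c.le_of_right 0 i (by omega) (by omega) fun m _ hm =>
      ⟨hR m (by omega) (by omega), hRT m (by omega) (by omega)⟩
    rcases Nat.lt_or_ge (i + 2) k with h | h
    · have h1 := c.lt_of_right (i + 3) (by omega) (hR k le_rfl (by omega)) fun m h1 h2 =>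
        ⟨hR m (by omega) (by omega), hRT m (by omega) (by omega)⟩
      have h2 : v (i + 2) < u (i + 3) := hRT' (i + 2) h (by omega)
      omega
    · have : k = i + 2 := by omega
      rw [this]; omega
  · push Not at hex
    have hR : ∀ i, i ≤ k → u i < v i := fun i hi => (harc i hi).resolve_right (hex i hi)
    refine c.lt_of_right 0 (by omega) (hR k le_rfl) fun m _ hm => ⟨hR m (by omega), fun h => ?_⟩
    obtain ⟨hBg, hTb, hBc, hL⟩ := H' _ h
    have e1 := (c.arc m (by omega)).symm.eq_iB hBg
    rw [← e1] at hTb hBc hL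
    obtain ⟨l, rfl⟩ : ∃ l, m = l + 1 := by
      refine ⟨m - 1, ?_⟩
      rcases m with _ | m
      · exact absurd hTb c.start
      · rfl
    rw [(c.iT_succ l (by omega)).2] at hBc hL
    rw [← (c.arc l (by omega)).symm.eq_iB hBc] at hL
    exact hex _ (by omega) hL

/-- The reflection of the curves in a vertical line, with all directions reversed. -/
def turn (M : CurveModel) : CurveModel := M.mirror.reverse

theorem turn_turn : M.turn.turn = M := by
  cases M
  simp [turn, mirror, reverse]

theorem UArc.turn {x y : ℤ} (h : M.UArc x y) : M.turn.UArc (-y) (-x) :=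
  h.symm.mirror.reverse

theorem leftB_of_turn {x : ℤ} (h : M.turn.LeftB x) : M.LeftB (M.iB (-x)) := by
  obtain ⟨h1, h2, h3⟩ := h
  have h1' : M.B (-x) := h1
  have h2' : ¬ M.Up (-x) := h2
  have h3' : -M.iB (-x) < x := h3
  exact ⟨M.hB.mem _ h1', (M.up_iB _ h1').2 h2', by rw [M.hB.inv _ h1']; omega⟩

theorem LeftB.turn {x : ℤ} (h : M.LeftB x) : M.turn.LeftB (-M.iB x) := by
  obtain ⟨h1, h2, h3⟩ := h
  refine ⟨?_, ?_, ?_⟩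
  · change M.B (- -M.iB x)
    rw [neg_neg]; exact M.hB.mem _ h1
  · change ¬ M.Up (- -M.iB x)
    rw [neg_neg, M.up_iB _ h1, not_not]; exact h2
  · change -M.iB (- -M.iB x) < _
    rw [neg_neg, M.hB.inv _ h1]; omega

theorem LeftT.turn {x : ℤ} (h : M.LeftT x) : M.turn.LeftT (-M.iT x) := by
  obtain ⟨h1, h2, h3⟩ := h
  refine ⟨?_, ?_, ?_⟩
  · change M.T (- -M.iT x)
    rw [neg_neg]; exact M.hT.mem _ h1
  · change ¬ ¬ M.Up (- -M.iT x)
    rw [neg_neg, M.up_iT _ h1, not_not]; exact h2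
  · change -M.iT (- -M.iT x) < _
    rw [neg_neg, M.hT.inv _ h1]; omega

theorem leftT_of_turn {x : ℤ} (h : M.turn.LeftT x) : M.LeftT (M.iT (-x)) := by
  have := h.turn
  rw [turn_turn] at this
  convert this using 1
  simp [CurveModel.turn, CurveModel.mirror, CurveModel.reverse]

theorem leftB_shift {x : ℤ} (h : M.LeftB x) (n : ℤ) : M.LeftB (x + M.p * n) :=
  ⟨(M.hB.per _ _).2 h.1, (M.up_per _ _).2 h.2.1, by
    have := h.2.2
    rw [M.hB.iper]; omega⟩

/-- At most one arc above a line, up to translation, satisfies `L`. -/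
def Unique (p : ℤ) (L : ℤ → Prop) : Prop := ∀ x y, L x → L y → ∃ n, y = x + p * n

theorem Unique.turnB (h : Unique M.p M.LeftB) : Unique M.turn.p M.turn.LeftB := by
  intro x y hx hy
  obtain ⟨n, hn⟩ := h _ _ (leftB_of_turn hx) (leftB_of_turn hy)
  have := M.hB.eq_of_inv_eq (x := -y) (y := -x) hy.1 hx.1 hn
  refine ⟨-n, ?_⟩
  change y = x + M.p * -n
  linarith

theorem Unique.turnT (h : Unique M.p M.LeftT) : Unique M.turn.p M.turn.LeftT := by
  intro x y hx hy
  obtain ⟨n, hn⟩ := h _ _ (leftT_of_turn hx) (leftT_of_turn hy)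
  have := M.hT.eq_of_inv_eq (x := -y) (y := -x) hy.1 hx.1 hn
  refine ⟨-n, ?_⟩
  change y = x + M.p * -n
  linarith

variable (M) in
/-- An arc above a line satisfying `L` and an arc below it satisfying `L'` have a common foot,
or are connected by two other arcs. -/
def Linked (L L' : ℤ → Prop) : Prop :=
  ∃ x, L x ∧ ((M.T x ∧ L' (M.iT x)) ∨ L' (M.iB x) ∨
    (M.T (M.iB x) ∧ M.B (M.iT (M.iB x)) ∧ L' (M.iB (M.iT (M.iB x)))) ∨
    (M.T x ∧ M.B (M.iT x) ∧ M.T (M.iB (M.iT x)) ∧ L' (M.iT (M.iB (M.iT x)))))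

theorem Linked.turn (h : M.Linked M.LeftB M.LeftT) : M.turn.Linked M.turn.LeftB M.turn.LeftT := by
  obtain ⟨x, hx, h⟩ := h
  refine ⟨_, hx.turn, ?_⟩
  have eB : ∀ z, M.turn.iB (-z) = -M.iB z := fun z => by
    change -M.iB (- -z) = _
    rw [neg_neg]
  have eT : ∀ z, M.turn.iT (-z) = -M.iT z := fun z => by
    change -M.iT (- -z) = _
    rw [neg_neg]
  have mB : ∀ z, M.turn.B (-z) ↔ M.B z := fun z => by
    change M.B (- -z) ↔ _
    rw [neg_neg]
  have mT : ∀ z, M.turn.T (-z) ↔ M.T z := fun z => by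
    change M.T (- -z) ↔ _
    rw [neg_neg]
  simp only [eB, eT, mB, mT, M.hB.inv x hx.1]
  rcases h with ⟨h1, h2⟩ | h | ⟨h1, h2, h3⟩ | ⟨h1, h2, h3, h4⟩
  · have := h2.turn
    rw [M.hT.inv _ h1] at this
    exact Or.inr (Or.inl this)
  · exact Or.inl ⟨h.1, h.turn⟩
  · exact Or.inr (Or.inr (Or.inr ⟨h1, h2, h3.1, h3.turn⟩))
  · have := h4.turn
    rw [M.hT.inv _ h3] at this
    exact Or.inr (Or.inr (Or.inl ⟨h1, h2, this⟩))

theorem linked_of_turn (h : M.turn.Linked M.turn.LeftB M.turn.LeftT) :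
    M.Linked M.LeftB M.LeftT := by
  have := h.turn
  rwa [turn_turn] at this

theorem flip_leftT (x : ℤ) : M.flip.LeftT x ↔ M.LeftB x := by
  simp [LeftT, LeftB, flip]

theorem Linked.flip (h : M.Linked M.LeftB M.LeftT) : M.flip.Linked M.flip.LeftB M.flip.LeftT := by
  obtain ⟨x, hx, h⟩ := h
  rcases h with ⟨h1, h2⟩ | h | ⟨h1, h2, h3⟩ | ⟨h1, h2, h3, h4⟩
  · refine ⟨_, h2, Or.inr (Or.inl ?_)⟩
    rw [flip_leftT]
    change M.LeftB (M.iT (M.iT x))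
    rwa [M.hT.inv _ h1]
  · refine ⟨_, h, Or.inl ⟨M.hB.mem _ hx.1, ?_⟩⟩
    rw [flip_leftT]
    change M.LeftB (M.iB (M.iB x))
    rwa [M.hB.inv _ hx.1]
  · refine ⟨_, h3, Or.inr (Or.inr (Or.inr ?_))⟩
    rw [flip_leftT]
    change M.B (M.iB _) ∧ M.T (M.iB (M.iB (M.iT (M.iB x)))) ∧
      M.B (M.iT (M.iB (M.iB (M.iT (M.iB x))))) ∧
      M.LeftB (M.iB (M.iT (M.iB (M.iB (M.iT (M.iB x))))))
    rw [M.hB.inv _ h2, M.hT.inv _ h1, M.hB.inv _ hx.1]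
    exact ⟨M.hB.mem _ h2, M.hT.mem _ h1, M.hB.mem _ hx.1, hx⟩
  · refine ⟨_, h4, Or.inr (Or.inr (Or.inl ?_))⟩
    rw [flip_leftT]
    change M.B (M.iT (M.iT (M.iB (M.iT x)))) ∧ M.T (M.iB (M.iT (M.iT (M.iB (M.iT x))))) ∧
      M.LeftB (M.iT (M.iB (M.iT (M.iT (M.iB (M.iT x))))))
    rw [M.hT.inv _ h3, M.hB.inv _ h2, M.hT.inv _ h1]
    exact ⟨M.hB.mem _ h2, M.hT.mem _ h1, hx⟩

theorem right_or_leftB_of_share (UB : Unique M.p M.LeftB) (UT : Unique M.p M.LeftT) {x₀ : ℤ}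
    (h₀ : M.LeftB x₀) (hT : M.T x₀) (hL : M.LeftT (M.iT x₀)) {x y : ℤ} (h : M.UArc x y)
    (hx : M.Up x) : x < y ∨ M.LeftB x := by
  refine h.right_or_leftB (fun k u v c harc => c.lt_of_leftT_leftB harc UB UT ?_ ?_) hx
  · intro z hz
    obtain ⟨n, rfl⟩ := UB _ _ h₀ hz
    rw [M.hT.iper]
    exact ⟨(M.hT.per _ _).2 hT, hL.shift n⟩
  · intro g hg
    obtain ⟨n, rfl⟩ := UT _ _ hL hg
    rw [M.hT.iper, M.hT.inv _ hT]
    exact leftB_shift h₀ n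

theorem right_or_leftB_of_connected (UB : Unique M.p M.LeftB) (UT : Unique M.p M.LeftT) {x₀ : ℤ}
    (h₀ : M.LeftB x₀) (h1 : M.T (M.iB x₀)) (h2 : M.B (M.iT (M.iB x₀)))
    (h3 : M.LeftT (M.iB (M.iT (M.iB x₀)))) (h4 : ¬ M.LeftT (M.iB x₀))
    {x y : ℤ} (h : M.UArc x y) (hx : M.Up x) : x < y ∨ M.LeftB x := by
  refine h.right_or_leftB (fun k u v c harc =>
    c.lt_of_leftB_right_right_leftT harc UB UT ?_ ?_) hx
  · intro z hz
    obtain ⟨n, rfl⟩ := UB _ _ h₀ hz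
    rw [M.hB.iper, M.hT.iper, M.hB.iper]
    refine ⟨(M.hT.per _ _).2 h1, fun h => h4 ?_, (M.hB.per _ _).2 h2, h3.shift n⟩
    have := h.shift (-n)
    rwa [mul_neg, add_neg_cancel_right] at this
  · intro g hg
    obtain ⟨n, rfl⟩ := UT _ _ h3 hg
    rw [M.hB.iper, M.hB.inv _ h2, M.hT.iper, M.hT.inv _ h1, M.hB.iper, M.hB.inv _ h₀.1]
    exact ⟨(M.hB.per _ _).2 (M.hB.mem _ h2), (M.hT.per _ _).2 (M.hT.mem _ h1),
      (M.hB.per _ _).2 (M.hB.mem _ h₀.1), leftB_shift h₀ n⟩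

theorem right_or_leftB_of_turn
    (H : ∀ x y, M.turn.UArc x y → M.turn.Up x → x < y ∨ M.turn.LeftB x) {x y : ℤ}
    (h : M.UArc x y) (hx : M.Up x) : x < y ∨ M.LeftB x := by
  have hup : M.turn.Up (-y) := by
    change ¬ M.Up (- -y)
    rw [neg_neg, h.up_iff, not_not]; exact hx
  rcases H _ _ h.turn hup with h1 | h1
  · left; omega
  · right
    have h2 : M.B y := by
      have : M.B (- -y) := h1.1
      rwa [neg_neg] at this
    have h3 := leftB_of_turn h1
    rw [neg_neg, ← h.symm.eq_iB h2] at h3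
    exact h3

/-- If the only left arc above a line and the only left arc below it are linked, then all other
arcs of the curve above a line are directed to the right. -/
theorem right_or_leftB_of_linked (UB : Unique M.p M.LeftB) (UT : Unique M.p M.LeftT)
    (hl : M.Linked M.LeftB M.LeftT) {x y : ℤ} (h : M.UArc x y) (hx : M.Up x) :
    x < y ∨ M.LeftB x := by
  have eB : ∀ z, M.turn.iB (-z) = -M.iB z := fun z => by
    change -M.iB (- -z) = _
    rw [neg_neg]
  have eT : ∀ z, M.turn.iT (-z) = -M.iT z := fun z => by
    change -M.iT (- -z) = _
    rw [neg_neg]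
  have mB : ∀ z, M.turn.B (-z) ↔ M.B z := fun z => by
    change M.B (- -z) ↔ _
    rw [neg_neg]
  have mT : ∀ z, M.turn.T (-z) ↔ M.T z := fun z => by
    change M.T (- -z) ↔ _
    rw [neg_neg]
  obtain ⟨x₀, h₀, ⟨h1, h2⟩ | h2 | ⟨h1, h2, h3⟩ | ⟨h1, h2, h3, h4⟩⟩ := hl
  · exact right_or_leftB_of_share UB UT h₀ h1 h2 h hx
  · refine right_or_leftB_of_turn (fun x y => right_or_leftB_of_share UB.turnB UT.turnT h₀.turn
      ((mT _).2 h2.1) ?_) h hx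
    rw [eT]; exact h2.turn
  · by_cases h4 : M.LeftT (M.iB x₀)
    · refine right_or_leftB_of_turn (fun x y => right_or_leftB_of_share UB.turnB UT.turnT h₀.turn
        ((mT _).2 h4.1) ?_) h hx
      rw [eT]; exact h4.turn
    · exact right_or_leftB_of_connected UB UT h₀ h1 h2 h3 h4 h hx
  · by_cases h5 : M.LeftT (M.iT x₀)
    · exact right_or_leftB_of_share UB UT h₀ h1 h5 h hx
    · have e : M.turn.iB (-M.iB x₀) = -x₀ := by rw [eB, M.hB.inv _ h₀.1]
      have h6 := h4.turn
      rw [M.hT.inv _ h3] at h6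
      refine right_or_leftB_of_turn (fun x y => right_or_leftB_of_connected UB.turnB UT.turnT
        h₀.turn ?_ ?_ ?_ ?_) h hx
      · rw [e, mT]; exact h1
      · rw [e, eT, mB]; exact h2
      · rw [e, eT, eB]; exact h6
      · rw [e]
        intro h7
        have := leftT_of_turn h7
        rw [neg_neg] at this
        exact h5 this

/-- A left arc above a line whose second foot is a foot of an arc below it is linked to a left arc
below the line, unless these arcs and a further arc above the line form a tight spiral. -/
theorem linked_or_spiral (UB : Unique M.p M.LeftB) {x : ℤ} (hx : M.LeftB x)
    (hy : M.T (M.iB x)) : M.Linked M.LeftB M.LeftT ∨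
      (¬ M.T x ∧ M.iB x < M.iT (M.iB x) ∧ M.B (M.iT (M.iB x)) ∧
        M.iT (M.iB x) < M.iB (M.iT (M.iB x)) ∧ M.iB (M.iT (M.iB x)) < x ∧
        M.iB (M.iT (M.iB x)) = x + M.iB x - M.iT (M.iB x) ∧
        ¬ M.T (M.iB (M.iT (M.iB x)))) := by
  obtain ⟨hBx, hux, hlt⟩ := hx
  have hx : M.LeftB x := ⟨hBx, hux, hlt⟩
  have hw := M.hB.lt_width hBx
  have huy : ¬ M.Up (M.iB x) := by rw [M.up_iB _ hBx]; exact not_not.2 hux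
  have huc := (M.up_iT _ hy).2 huy
  have hne := M.no_loop x hBx hy
  have hneT := M.hT.ne _ hy
  have hyinv := M.hB.inv x hBx
  have hyinvT := M.hT.inv _ hy
  generalize hey : M.iB x = y at *
  generalize hec : M.iT y = c at *
  -- an arc below the line which starts at `x` to the right is directed to the left
  have cfg1 : M.T x → x < M.iT x → M.Linked M.LeftB M.LeftT := fun h1 h2 =>
    ⟨x, hx, Or.inl ⟨h1, M.hT.mem _ h1, by rw [M.up_iT _ h1]; exact not_not.2 hux, by
      rwa [M.hT.inv _ h1]⟩⟩
  have window : ∀ z, y < z → z ≤ x → M.LeftB z → z = x := by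
    intro z h1 h2 hz
    obtain ⟨n, hn⟩ := UB _ _ hx hz
    have hp : 0 < M.p := by omega
    have : n = 0 := by
      have h1 : n < 1 := by by_contra hc; push Not at hc; nlinarith
      have h2 : -1 < n := by by_contra hc; push Not at hc; nlinarith
      omega
    subst this; omega
  rcases lt_or_gt_of_ne hneT with hcy | hcy
  · left
    exact ⟨x, hx, Or.inr (Or.inl (by rw [hey]; exact ⟨hy, huy, by rwa [hec]⟩))⟩
  rcases lt_or_gt_of_ne hne with hcx | hcx
  · obtain ⟨hBc, hd⟩ := M.hB.nest_left hBx (z := c) (by omega) hcx.le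
    rw [hey] at hd
    have hcd : c < M.iB c := by
      have h1 := M.hB.ne _ hBc
      by_contra h2
      exact hne (window c hcy hcx.le ⟨hBc, huc, by omega⟩)
    have hud : ¬ M.Up (M.iB c) := by rw [M.up_iB _ hBc]; exact not_not.2 huc
    have hxt : M.T x → y ≤ M.iT x → M.iT x ≤ x → False := fun h1 h2 h3 => by
      have := M.hT.concentric (a := y) (b := x) hy h1 (by omega) (by omega) (by omega) (by omega)
        (by omega) (by omega) (by omega) (by omega) (by omega)
      omega
    by_cases hTd : M.T (M.iB c)
    · left
      have hned := M.hT.ne _ hTd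
      rcases lt_or_gt_of_ne hned with h1 | h1
      · exact ⟨x, hx, Or.inr (Or.inr (Or.inl (by
          rw [hey, hec]; exact ⟨hy, hBc, hTd, hud, h1⟩)))⟩
      · have h2 : x < M.iT (M.iB c) := by
          by_contra h2
          have := M.hT.concentric (a := y) (b := x) hy hTd (by omega) (by omega) (by omega)
            (by omega) (by omega) (by omega) (by omega) (by omega) (by omega)
          omega
        obtain ⟨hTx, et⟩ := M.hT.nest _ x hTd (by omega) h2.le
        refine cfg1 hTx ?_
        have := M.hT.ne _ hTx
        by_contra h3
        exact hxt hTx (by omega) (by omega)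
    · by_cases hTx : M.T x
      · left
        refine cfg1 hTx ?_
        have := M.hT.ne _ hTx
        by_contra h3
        by_cases h4 : y ≤ M.iT x
        · exact hxt hTx h4 (by omega)
        · exact hTd (M.hT.nest_left hTx (z := M.iB c) (by omega) (by omega)).1
      · right
        exact ⟨hTx, hcy, hBc, hcd, by omega, hd, hTd⟩
  · left
    obtain ⟨hTx, et⟩ := M.hT.nest y x hy (by omega) (by omega)
    rcases lt_or_gt_of_ne (M.hT.ne _ hTx) with h1 | h1
    · obtain ⟨hBt, e1⟩ := M.hB.nest_left hBx (z := M.iT x) (by omega) h1.le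
      have hut : ¬ M.Up (M.iT x) := by rw [M.up_iT _ hTx]; exact not_not.2 hux
      have hutt := (M.up_iB _ hBt).2 hut
      have htt : M.iB (M.iT x) < M.iT x := by
        have h2 := M.hB.ne _ hBt
        by_contra h3
        have := window (M.iB (M.iT x)) (by omega) (by omega)
          ⟨M.hB.mem _ hBt, hutt, by rw [M.hB.inv _ hBt]; omega⟩
        omega
      obtain ⟨hTtt, e2⟩ := M.hT.nest y (M.iB (M.iT x)) hy (by omega) (by omega)
      refine ⟨x, hx, Or.inr (Or.inr (Or.inr ⟨hTx, hBt, hTtt, M.hT.mem _ hTtt, ?_, ?_⟩))⟩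
      · rw [M.up_iT _ hTtt]; exact not_not.2 hutt
      · rw [M.hT.inv _ hTtt]; omega
    · exact cfg1 hTx h1

/-- If a curve has a single left arc above a line and all its other arcs above the line are
directed to the right, then this arc is linked to a left arc below the line. -/
theorem linked_of_right (UB : Unique M.p M.LeftB)
    (R : ∀ x y, M.UArc x y → M.Up x → ¬ M.B x → x < y) {x : ℤ} (hx : M.LeftB x) :
    M.Linked M.LeftB M.LeftT := by
  have key : ∀ N : CurveModel, Unique N.p N.LeftB →
      (∀ x y, N.UArc x y → N.Up x → ¬ N.B x → x < y) → ∀ x, N.LeftB x → N.T (N.iB x) →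
      N.Linked N.LeftB N.LeftT := by
    intro N UB R x hx hy
    rcases linked_or_spiral UB hx hy with h | ⟨h1, h2, h3, h4, h5, -, h6⟩
    · exact h
    exfalso
    have harc := UArc.big (M := N) 1 (fun i => if i = 0 then x else N.iT (N.iB x))
      (fun i => if i = 0 then N.iB x else N.iB (N.iT (N.iB x)))
      (fun i _ => by
        by_cases hi : i = 0
        · simpa [hi] using UArc.rainbow x hx.1
        · simpa [hi] using UArc.rainbow _ h3)
      (fun i hi => by
        obtain rfl : i = 0 := by omega
        simpa using hy) (by simpa using h1) (by simpa using h6)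
    simp only [if_true, one_ne_zero, if_false] at harc
    have := R _ _ harc ((N.up_desc _ h1).2 hx.2.1) (N.desc_mem _ h1)
    have := N.desc_lt _ _ h6 h1 h5
    omega
  by_cases hy : M.T (M.iB x)
  · exact key M UB R x hx hy
  by_cases hTx : M.T x
  · refine linked_of_turn (key M.turn UB.turnB ?_ _ hx.turn ?_)
    · intro a b hab ha hB
      have h := hab.turn
      rw [turn_turn] at h
      have h1 : ¬ M.Up (-a) := ha
      have h2 : ¬ M.B (-a) := hB
      have := R _ _ h (by rw [h.up_iff] at h1; exact not_not.1 h1) (by rwa [h.mem_iff])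
      omega
    · change M.T (- -M.iB (- -M.iB x))
      rwa [neg_neg, neg_neg, M.hB.inv _ hx.1]
  · exfalso
    have harc := UArc.big (M := M) 0 (fun _ => x) (fun _ => M.iB x)
      (fun _ _ => UArc.rainbow x hx.1) (fun i hi => by omega) hTx hy
    have := R _ _ harc ((M.up_desc _ hTx).2 hx.2.1) (M.desc_mem _ hTx)
    have := M.desc_lt _ _ hy hTx hx.2.2
    omega

variable (M) in
/-- An arc above a line is traversed from its foot `x`, to the right. -/
def RightB (x : ℤ) : Prop := M.B x ∧ M.Up x ∧ x < M.iB x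

/-- If there are just one left arc and one right arc above a line, there is a left arc below it,
and the left arc above the line shares a foot with some arc below it,
then the left arc above the line is linked to a left arc below it. -/
theorem linked_of_mixed (UB : Unique M.p M.LeftB) (UR : Unique M.p M.RightB)
    (hT : ∃ g, M.LeftT g) {x : ℤ} (hx : M.LeftB x) (h : M.T x ∨ M.T (M.iB x)) :
    M.Linked M.LeftB M.LeftT := by
  have key : ∀ N : CurveModel, Unique N.p N.LeftB → Unique N.p N.RightB → (∃ g, N.LeftT g) →
      ∀ x, N.LeftB x → N.T (N.iB x) → N.Linked N.LeftB N.LeftT := by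
    intro N UB UR hT x hx hy
    rcases linked_or_spiral UB hx hy with h | ⟨h1, h2, h3, h4, h5, e, h6⟩
    · exact h
    exfalso
    obtain ⟨hBx, hux, hlt⟩ := hx
    have hx : N.LeftB x := ⟨hBx, hux, hlt⟩
    have hw := N.hB.lt_width hBx
    have huy : ¬ N.Up (N.iB x) := by rw [N.up_iB _ hBx]; exact not_not.2 hux
    have huc := (N.up_iT _ hy).2 huy
    have hp : 0 < N.p := by omega
    have window : ∀ a n, N.iB x < a → a ≤ x → N.iB x < a + N.p * n → a + N.p * n ≤ x →
        n = 0 := by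
      intro a n h1 h2 h3 h4
      have h1 : n < 1 := by by_contra hc; push Not at hc; nlinarith
      have h2 : -1 < n := by by_contra hc; push Not at hc; nlinarith
      omega
    generalize hey : N.iB x = y at *
    generalize hec : N.iT y = c at *
    have only : ∀ z, y < z → z ≤ x + y - z → z = c := by
      intro z h7 h8
      obtain ⟨hBz, ez⟩ := N.hB.nest_left hBx (z := z) (by omega) (by omega)
      have := N.hB.ne _ hBz
      rw [hey] at ez
      by_cases huz : N.Up z
      · obtain ⟨n, hn⟩ := UR _ _ ⟨h3, huc, h4⟩ ⟨hBz, huz, by omega⟩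
        have := window c n (by omega) (by omega) (by omega) (by omega)
        subst this; omega
      · obtain ⟨n, hn⟩ := UB _ _ hx ⟨N.hB.mem _ hBz, (N.up_iB _ hBz).2 huz, by
          rw [N.hB.inv _ hBz]; omega⟩
        have := window x n (by omega) (by omega) (by omega) (by omega)
        subst this; omega
    have hc1 := only (y + 1) (by omega) (by omega)
    have hd1 : N.iB c = c + 1 := by
      by_contra hne
      have := only (c + 1) (by omega) (by omega)
      omega
    obtain ⟨g, hg1, hg2, hg3⟩ := hT
    obtain ⟨k, hk⟩ := N.hT.center _ _ hy hg1
    obtain ⟨g', m, hg1, hm, hup, hmg, hsum⟩ : ∃ g' m, N.T g' ∧ N.iT g' = m ∧ N.Up m ∧ m < g' ∧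
        g' + m = y + c := by
      refine ⟨g + N.p * k, _, (N.hT.per _ _).2 hg1, N.hT.iper g k, ?_, by omega, ?_⟩
      · rw [N.up_per]; exact (N.up_iT _ hg1).2 hg2
      · rw [hec] at hk; linarith
    rcases lt_trichotomy m y with h | h | h
    · exact h6 (N.hT.nest_left hg1 (z := N.iB c) (by omega) (by omega)).1
    · rw [h] at hup; exact huy hup
    · omega
  rcases h with h | h
  · refine linked_of_turn (key M.turn UB.turnB ?_ ?_ _ hx.turn ?_)
    · intro a b ⟨ha1, ha2, ha3⟩ ⟨hb1, hb2, hb3⟩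
      have ha1' : M.B (-a) := ha1
      have hb1' : M.B (-b) := hb1
      have ha3' : a < -M.iB (-a) := ha3
      have hb3' : b < -M.iB (-b) := hb3
      obtain ⟨n, hn⟩ := UR _ _
        ⟨M.hB.mem _ ha1', (M.up_iB _ ha1').2 ha2, by rw [M.hB.inv _ ha1']; omega⟩
        ⟨M.hB.mem _ hb1', (M.up_iB _ hb1').2 hb2, by rw [M.hB.inv _ hb1']; omega⟩
      have := M.hB.eq_of_inv_eq hb1' ha1' hn
      refine ⟨-n, ?_⟩
      change b = a + M.p * -n
      linarith
    · obtain ⟨g, hg⟩ := hT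
      exact ⟨_, hg.turn⟩
    · change M.T (- -M.iB (- -M.iB x))
      rwa [neg_neg, neg_neg, M.hB.inv _ hx.1]
  · exact key M UB UR hT x hx h

/-! ### Following the curves -/

/-- A discrete flow `f` which follows the curves of the model: `u x h` and `d x h` are the
states of the flow in which the curve crosses the line of height `h` at `x` upwards and downwards,
and `lvl` is the height of the line which is crossed in a state, if any. -/
structure Flow (M : CurveModel) where
  S : Type
  f : S → S
  lvl : S → Option ℤ
  u : ℤ → ℤ → S
  d : ℤ → ℤ → S
  lvl_u : ∀ x h, lvl (u x h) = some h
  lvl_d : ∀ x h, lvl (d x h) = some h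
  arch : ∀ x h, M.B x → ∃ m, 1 ≤ m ∧ f^[m] (u x h) = d (M.iB x) h ∧
    ∀ i, 0 < i → i < m → lvl (f^[i] (u x h)) = none
  rise : ∀ x h, ¬ M.B x → ∃ m, 1 ≤ m ∧ f^[m] (u x h) = u (M.asc x) (h + 1) ∧
    ∀ i, 0 < i → i < m → lvl (f^[i] (u x h)) = none
  bowl : ∀ x h, M.T x → ∃ m, 1 ≤ m ∧ f^[m] (d x h) = u (M.iT x) h ∧
    ∀ i, 0 < i → i < m → lvl (f^[i] (d x h)) = none
  fall : ∀ x h, ¬ M.T x → ∃ m, 1 ≤ m ∧ f^[m] (d x h) = d (M.desc x) (h - 1) ∧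
    ∀ i, 0 < i → i < m → lvl (f^[i] (d x h)) = none

namespace Flow

/-- The flow seen upside down. -/
def flip (F : M.Flow) : M.flip.Flow where
  S := F.S
  f := F.f
  lvl σ := (F.lvl σ).map fun h => -h
  u x h := F.d x (-h)
  d x h := F.u x (-h)
  lvl_u x h := by simp [F.lvl_d]
  lvl_d x h := by simp [F.lvl_u]
  arch x h hx := by simpa [CurveModel.flip] using F.bowl x (-h) hx
  rise x h hx := by
    have := F.fall x (-h) hx
    rw [show -(h + 1) = -h - 1 by ring]
    simpa [CurveModel.flip] using this
  bowl x h hx := by simpa [CurveModel.flip] using F.arch x (-h) hx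
  fall x h hx := by
    have := F.rise x (-h) hx
    rw [show -(h - 1) = -h + 1 by ring]
    simpa [CurveModel.flip] using this

variable (F : M.Flow)

/-- The state `σ` does not lie on a line of height at most `h`. -/
def High (h : ℤ) (σ : F.S) : Prop := ∀ h', F.lvl σ = some h' → h < h'

/-- The flow takes `σ` to `τ` in `m` steps, in between staying above the line of height `h`. -/
def Leads (h : ℤ) (σ : F.S) (m : ℕ) (τ : F.S) : Prop :=
  1 ≤ m ∧ F.f^[m] σ = τ ∧ ∀ i, 0 < i → i < m → F.High h (F.f^[i] σ)

variable {F}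

theorem leads_of_none {σ τ : F.S} (h : ℤ) (H : ∃ m, 1 ≤ m ∧ F.f^[m] σ = τ ∧
    ∀ i, 0 < i → i < m → F.lvl (F.f^[i] σ) = none) : ∃ m, F.Leads h σ m τ := by
  obtain ⟨m, h1, h2, h3⟩ := H
  exact ⟨m, h1, h2, fun i hi hm h' e => by simp [h3 i hi hm] at e⟩

theorem Leads.trans {h : ℤ} {σ τ ρ : F.S} {m n : ℕ} (h1 : F.Leads h σ m τ) (h2 : F.High h τ)
    (h3 : F.Leads h τ n ρ) : F.Leads h σ (m + n) ρ := by
  obtain ⟨a1, a2, a3⟩ := h1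
  obtain ⟨b1, b2, b3⟩ := h3
  refine ⟨by omega, ?_, fun i hi hm => ?_⟩
  · rw [add_comm, Function.iterate_add_apply, a2, b2]
  · rcases lt_trichotomy i m with h | h | h
    · exact a3 i hi h
    · rw [h, a2]; exact h2
    · obtain ⟨j, rfl⟩ := Nat.exists_eq_add_of_lt h
      rw [show m + j + 1 = (j + 1) + m by omega, Function.iterate_add_apply, a2]
      exact b3 _ (by omega) (by omega)

theorem Leads.mono {h h' : ℤ} {σ τ : F.S} {m : ℕ} (H : F.Leads h σ m τ) (hh : h' ≤ h) :
    F.Leads h' σ m τ :=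
  ⟨H.1, H.2.1, fun i h1 h2 k e => hh.trans_lt (H.2.2 i h1 h2 k e)⟩

theorem high_u (x : ℤ) {h h' : ℤ} (H : h < h') : F.High h (F.u x h') := by
  intro k e
  rw [F.lvl_u] at e
  injection e with e
  omega

theorem high_d (x : ℤ) {h h' : ℤ} (H : h < h') : F.High h (F.d x h') := by
  intro k e
  rw [F.lvl_d] at e
  injection e with e
  omega

/-- The flow follows the arcs of the curves above a line. -/
theorem exists_leads {x y : ℤ} (hxy : M.UArc x y) :
    ∀ h, ∃ m, F.Leads h (F.u x h) m (F.d y h) := by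
  induction hxy with
  | rainbow x hx => exact fun h => leads_of_none h (F.arch x h hx)
  | big k u v arc link start finish ih =>
    intro h
    have key : ∀ j, j ≤ k → ∃ m, F.Leads h (F.u (M.desc (u 0)) h) m (F.u (u j) (h + 1)) := by
      intro j
      induction j with
      | zero =>
        intro _
        have := F.rise (M.desc (u 0)) h (M.desc_mem _ start)
        rw [M.asc_desc _ start] at this
        exact leads_of_none h this
      | succ j ihj =>
        intro hj
        obtain ⟨m1, h1⟩ := ihj (by omega)
        obtain ⟨m2, h2⟩ := ih j (by omega) (h + 1)
        obtain ⟨h3, h4⟩ := link j (by omega)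
        obtain ⟨m3, h5⟩ := leads_of_none h (F.bowl (v j) (h + 1) h3)
        rw [← h4] at h5
        exact ⟨_, (h1.trans (high_u _ (by omega)) (h2.mono (by omega))).trans
          (high_d _ (by omega)) h5⟩
    obtain ⟨m1, h1⟩ := key k le_rfl
    obtain ⟨m2, h2⟩ := ih k le_rfl (h + 1)
    obtain ⟨m3, h3⟩ := leads_of_none h (F.fall (v k) (h + 1) finish)
    rw [add_sub_cancel_right] at h3
    exact ⟨_, (h1.trans (high_u _ (by omega)) (h2.mono (by omega))).trans
      (high_d _ (by omega)) h3⟩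

variable (M) in
/-- The curve through the point `a` of a line returns to it at `z`, where it passes upwards. -/
inductive Walk (a : ℤ) : ℤ → Prop
  | refl : Walk a a
  | tail (z w : ℤ) : Walk a z → M.UArc z w → M.T w → Walk a (M.iT w)

theorem Walk.exists_seq {a z : ℤ} (hw : Walk M a z) : ∃ (k : ℕ) (u v : ℕ → ℤ), u 0 = a ∧ u k = z ∧
    ∀ i, i < k → M.UArc (u i) (v i) ∧ M.T (v i) ∧ u (i + 1) = M.iT (v i) := by
  induction hw with
  | refl => exact ⟨0, fun _ => a, fun _ => a, rfl, rfl, fun i hi => by omega⟩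
  | tail z w _ hzw hT ih =>
    obtain ⟨k, u, v, h1, h2, h3⟩ := ih
    refine ⟨k + 1, fun i => if i ≤ k then u i else M.iT w, fun i => if i < k then v i else w,
      by simp [h1], by simp, fun i hi => ?_⟩
    rcases Nat.lt_or_ge i k with h | h
    · have := h3 i h
      simpa [h, h.le, show i + 1 ≤ k from h] using this
    · obtain rfl : i = k := by omega
      simpa [h2] using ⟨hzw, hT⟩

theorem Walk.uarc {a z w : ℤ} (hw : Walk M a z) (ha : ¬ M.T a) (hzw : M.UArc z w) (hT : ¬ M.T w) :
    M.UArc (M.desc a) (M.desc w) := by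
  obtain ⟨k, u, v, h1, h2, h3⟩ := hw.exists_seq
  have := UArc.big (M := M) k u (fun i => if i < k then v i else w)
    (fun i hi => by
      rcases Nat.lt_or_ge i k with h | h
      · simpa [h] using (h3 i h).1
      · obtain rfl : i = k := by omega
        simpa [h2] using hzw)
    (fun i hi => by simpa [hi] using (h3 i hi).2) (by rwa [h1]) (by simpa using hT)
  simpa [h1] using this

theorem exists_uarc_or_high (n : ℕ) : ∀ x h,
    (∃ y m, m ≤ n ∧ M.UArc x y ∧ F.Leads h (F.u x h) m (F.d y h)) ∨
      ∀ i, 0 < i → i ≤ n → F.High h (F.f^[i] (F.u x h)) := by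
  induction n using Nat.strong_induction_on with
  | _ n ih =>
    intro x h
    by_cases hx : M.B x
    · obtain ⟨m, hm⟩ := leads_of_none h (F.arch x h hx)
      rcases Nat.lt_or_ge n m with hn | hn
      · exact Or.inr fun i h1 h2 => hm.2.2 i h1 (by omega)
      · exact Or.inl ⟨_, m, hn, UArc.rainbow x hx, hm⟩
    obtain ⟨m₀, hm₀⟩ := leads_of_none h (F.rise x h hx)
    -- either the flow stays above the line or the chain of arcs on the next line continues
    have high : ∀ t τ, F.Leads h (F.u x h) t τ → n < t →
        ∀ i, 0 < i → i ≤ n → F.High h (F.f^[i] (F.u x h)) :=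
      fun t τ ht hn i h1 h2 => ht.2.2 i h1 (by omega)
    have key : ∀ l t z, n ≤ t + l → Walk M (M.asc x) z →
        F.Leads h (F.u x h) t (F.u z (h + 1)) →
        (∃ y m, m ≤ n ∧ M.UArc x y ∧ F.Leads h (F.u x h) m (F.d y h)) ∨
          ∀ i, 0 < i → i ≤ n → F.High h (F.f^[i] (F.u x h)) := by
      intro l
      induction l using Nat.strong_induction_on with
      | _ l ihl =>
        intro t z htl hw ht
        rcases Nat.lt_or_ge n t with hn | hn
        · exact Or.inr (high t _ ht hn)
        rcases ih (n - t) (by have := ht.1; omega) z (h + 1) with ⟨w, m, hm, hzw, hl⟩ | hh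
        · have h1 := ht.trans (high_u z (by omega)) (hl.mono (by omega))
          by_cases hT : M.T w
          · obtain ⟨m', hm'⟩ := leads_of_none h (F.bowl w (h + 1) hT)
            have h2 := h1.trans (high_d _ (by omega)) hm'
            rcases Nat.lt_or_ge n (t + m + m') with h3 | h3
            · exact Or.inr (high _ _ h2 h3)
            · have := hm'.1
              exact ihl (n - (t + m + m')) (by omega) _ _ (by omega) (Walk.tail z w hw hzw hT) h2
          · obtain ⟨m', hm'⟩ := leads_of_none h (F.fall w (h + 1) hT)
            rw [add_sub_cancel_right] at hm'
            have h2 := h1.trans (high_d _ (by omega)) hm'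
            rcases Nat.lt_or_ge n (t + m + m') with h3 | h3
            · exact Or.inr (high _ _ h2 h3)
            · have := hw.uarc (M.asc_mem x hx) hzw hT
              rw [M.desc_asc x hx] at this
              exact Or.inl ⟨_, _, h3, this, h2⟩
        · right
          intro i h1 h2
          rcases lt_trichotomy i t with h3 | h3 | h3
          · exact ht.2.2 i h1 h3
          · rw [h3, ht.2.1]; exact high_u _ (by omega)
          · obtain ⟨j, rfl⟩ := Nat.exists_eq_add_of_lt h3
            rw [show t + j + 1 = (j + 1) + t by omega, Function.iterate_add_apply, ht.2.1]
            intro k e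
            have := hh (j + 1) (by omega) (by omega) k e
            omega
    exact key n m₀ _ (by omega) Walk.refl hm₀

/-- If the flow returns to a line from above, then it has followed an arc above the line. -/
theorem exists_uarc {x h : ℤ} {n : ℕ} (hn : 1 ≤ n) (hl : F.lvl (F.f^[n] (F.u x h)) = some h) :
    ∃ y, M.UArc x y := by
  rcases exists_uarc_or_high n x h with ⟨y, _, _, h1, _⟩ | h1
  · exact ⟨y, h1⟩
  · exact absurd (h1 n hn le_rfl h hl) (lt_irrefl _)

end Flow

/-! ### Arcs of either direction -/

variable (M)

/-- An arc above a line is traversed from its foot `x`, to the right if `b` and to the left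
otherwise. -/
def DirB (b : Bool) (x : ℤ) : Prop := M.B x ∧ M.Up x ∧ (x < M.iB x ↔ b = true)

/-- An arc below a line is traversed from its foot `x`, to the right if `b` and to the left
otherwise. -/
def DirT (b : Bool) (x : ℤ) : Prop := M.T x ∧ ¬ M.Up x ∧ (x < M.iT x ↔ b = true)

variable {M}

theorem flip_dirT (b : Bool) : M.flip.DirT b = M.DirB b := by
  funext x
  simp [DirT, DirB, flip]

theorem dirB_false : M.DirB false = M.LeftB := by
  funext x
  have := M.hB.ne x
  simp only [DirB, LeftB, eq_iff_iff, Bool.false_eq_true, iff_false, not_lt]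
  refine and_congr_right fun h => and_congr_right fun _ => ?_
  have := this h
  omega

theorem dirT_false : M.DirT false = M.LeftT := by
  funext x
  have := M.hT.ne x
  simp only [DirT, LeftT, eq_iff_iff, Bool.false_eq_true, iff_false, not_lt]
  refine and_congr_right fun h => and_congr_right fun _ => ?_
  have := this h
  omega

theorem dirB_true : M.DirB true = M.RightB := by
  funext x
  simp [DirB, RightB]

theorem mirror_dirB (b : Bool) : M.mirror.DirB b = fun x => M.DirB (!b) (-x) := by
  funext x
  have := M.hB.ne (-x)
  simp only [DirB, mirror, eq_iff_iff]
  refine and_congr_right fun h => and_congr_right fun _ => ?_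
  have := this h
  cases b <;> simp <;> omega

theorem mirror_dirT (b : Bool) : M.mirror.DirT b = fun x => M.DirT (!b) (-x) := by
  funext x
  have := M.hT.ne (-x)
  simp only [DirT, mirror, eq_iff_iff]
  refine and_congr_right fun h => and_congr_right fun _ => ?_
  have := this h
  cases b <;> simp <;> omega

theorem dirB_add (b : Bool) (x k : ℤ) : M.DirB b (x + M.p * k) ↔ M.DirB b x := by
  rw [DirB, DirB, M.hB.per, M.up_per, M.hB.iper]
  simp

theorem dirT_add (b : Bool) (x k : ℤ) : M.DirT b (x + M.p * k) ↔ M.DirT b x := by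
  rw [DirT, DirT, M.hT.per, M.up_per, M.hT.iper]
  simp

theorem Unique.neg {p : ℤ} {L : ℤ → Prop} (h : Unique p L) : Unique p fun x => L (-x) := by
  intro x y hx hy
  obtain ⟨n, hn⟩ := h _ _ hx hy
  exact ⟨-n, by linarith⟩

theorem linked_of_mirror {L L' : ℤ → Prop}
    (h : M.mirror.Linked (fun x => L (-x)) fun x => L' (-x)) : M.Linked L L' := by
  obtain ⟨x, hx, h⟩ := h
  exact ⟨-x, hx, by simpa [mirror] using h⟩

theorem Linked.mirror {L L' : ℤ → Prop} (h : M.Linked L L') :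
    M.mirror.Linked (fun x => L (-x)) fun x => L' (-x) := by
  obtain ⟨x, hx, h⟩ := h
  exact ⟨-x, by simpa using hx, by simpa [CurveModel.mirror] using h⟩

theorem Linked.flip_dir {b : Bool} (h : M.Linked (M.DirB b) (M.DirT b)) :
    M.flip.Linked (M.flip.DirB b) (M.flip.DirT b) := by
  cases b
  · rw [dirB_false, dirT_false] at h ⊢
    exact h.flip
  · have h1 := h.mirror
    have h2 : M.mirror.Linked M.mirror.LeftB M.mirror.LeftT := by
      rw [← dirB_false, ← dirT_false, mirror_dirB, mirror_dirT]
      exact h1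
    have h3 := h2.flip
    refine linked_of_mirror ?_
    have e1 := mirror_dirB (M := M.flip) false
    have e2 := mirror_dirT (M := M.flip) false
    rw [Bool.not_false] at e1 e2
    rw [← e1, ← e2, dirB_false, dirT_false]
    exact h3

theorem UArc.not_dir_of_coherent {b : Bool} (hB : ∀ x, ¬ M.DirB b x) (hT : ∀ x, ¬ M.DirT b x)
    {x y : ℤ} (h : M.UArc x y) (hx : M.Up x) : ¬ (x < y ↔ b = true) := by
  cases b
  · rw [dirB_false] at hB
    rw [dirT_false] at hT
    simpa using h.right_of_coherent hB hT hx
  · have := h.mirror.right_of_coherent (by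
      rw [← dirB_false, mirror_dirB]; exact fun x => hB _) (by
      rw [← dirT_false, mirror_dirT]; exact fun x => hT _) (by simpa [CurveModel.mirror] using hx)
    simp; omega

theorem dirB_of_linked {b : Bool} (UB : Unique M.p (M.DirB b)) (UT : Unique M.p (M.DirT b))
    (hl : M.Linked (M.DirB b) (M.DirT b)) {x y : ℤ} (h : M.UArc x y) (hx : M.Up x)
    (hb : x < y ↔ b = true) : M.DirB b x := by
  cases b
  · rw [dirB_false] at UB hl ⊢
    rw [dirT_false] at UT hl
    exact (right_or_leftB_of_linked UB UT hl h hx).resolve_left (by simpa using hb)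
  · have e1 := mirror_dirB (M := M) false
    have e2 := mirror_dirT (M := M) false
    rw [Bool.not_false] at e1 e2
    have UB' := UB.neg
    have UT' := UT.neg
    have hl' := hl.mirror
    rw [← e1] at UB' hl'
    rw [← e2] at UT' hl'
    rw [dirB_false] at UB' hl'
    rw [dirT_false] at UT' hl'
    have h3 := (right_or_leftB_of_linked UB' UT' hl' h.mirror
      (by simpa [CurveModel.mirror] using hx)).resolve_left (by simp at hb; omega)
    rw [← dirB_false, e1] at h3
    simpa using h3

theorem mirror_mirror : M.mirror.mirror = M := by
  cases M
  simp [mirror]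

theorem linked_of_dir {b : Bool} (UB : Unique M.p (M.DirB b))
    (R : ∀ x y, M.UArc x y → M.Up x → (x < y ↔ b = true) → M.B x) {x : ℤ} (hx : M.DirB b x) :
    M.Linked (M.DirB b) (M.DirT b) := by
  cases b
  · rw [dirB_false] at UB hx ⊢
    rw [dirT_false]
    refine linked_of_right UB (fun x y h h1 h2 => ?_) hx
    by_contra hlt
    exact h2 (R x y h h1 (by simpa using hlt))
  · have e1 := mirror_dirB (M := M) false
    have e2 := mirror_dirT (M := M) false
    rw [Bool.not_false] at e1 e2
    have UB' := UB.neg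
    have hx' : M.mirror.LeftB (-x) := by
      rw [← dirB_false, e1]
      simpa using hx
    rw [← e1, dirB_false] at UB'
    refine linked_of_mirror ?_
    rw [← e1, ← e2, dirB_false, dirT_false]
    refine linked_of_right UB' (fun x y h h1 h2 => ?_) hx'
    by_contra hlt
    have h4 := h.mirror
    have h5 := h.ne
    rw [mirror_mirror] at h4
    exact h2 (R _ _ h4 h1 (by simp; omega))

theorem linked_of_dir_mixed {b : Bool} (UB : Unique M.p (M.DirB b)) (UR : Unique M.p (M.DirB !b))
    (hT : ∃ g, M.DirT b g) {x : ℤ} (hx : M.DirB b x) (h : M.T x ∨ M.T (M.iB x)) :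
    M.Linked (M.DirB b) (M.DirT b) := by
  cases b
  · rw [Bool.not_false, dirB_true] at UR
    rw [dirB_false] at UB hx ⊢
    rw [dirT_false] at hT ⊢
    exact linked_of_mixed UB UR hT hx h
  · have e1 := mirror_dirB (M := M) false
    have e2 := mirror_dirT (M := M) false
    have e3 := mirror_dirB (M := M) true
    rw [Bool.not_false] at e1 e2
    rw [dirB_true] at e3
    have UB' := UB.neg
    have UR' := UR.neg
    have hx' : M.mirror.LeftB (-x) := by
      rw [← dirB_false, e1]
      simpa using hx
    have hT' : ∃ g, M.mirror.LeftT g := by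
      obtain ⟨g, hg⟩ := hT
      rw [← dirT_false, e2]
      exact ⟨-g, by simpa using hg⟩
    rw [← e1, dirB_false] at UB'
    rw [Bool.not_true] at UR' e3
    rw [← e3] at UR'
    refine linked_of_mirror ?_
    rw [← e1, ← e2, dirB_false, dirT_false]
    exact linked_of_mixed UB' UR' hT' hx' (by simpa [CurveModel.mirror] using h)

/-! ### Counting arcs up to translation -/

/-- The number of residue classes modulo `p` on which the periodic predicate `L` holds. -/
def cnt (p : ℤ) (L : ℤ → Prop) : ℕ := ((Finset.range p.toNat).filter fun k : ℕ => L k).card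

theorem cnt_mono {p : ℤ} {L L' : ℤ → Prop} (h : ∀ x, L x → L' x) : cnt p L ≤ cnt p L' :=
  Finset.card_le_card (Finset.monotone_filter_right _ fun _ _ => h _)

theorem exists_nat_rep {p : ℤ} (hp : 0 < p) {L : ℤ → Prop} (hL : ∀ x k, L (x + p * k) ↔ L x)
    {x : ℤ} (hx : L x) : ∃ (k : ℕ) (n : ℤ), k < p.toNat ∧ L k ∧ x = k + p * n := by
  have h1 := Int.emod_nonneg x hp.ne'
  have h2 := Int.emod_lt_of_pos x hp
  have h3 := Int.emod_add_mul_ediv x p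
  refine ⟨(x % p).toNat, x / p, by omega, ?_, by omega⟩
  rw [← hL _ (x / p), Int.toNat_of_nonneg h1, h3]
  exact hx

theorem cnt_pos_iff {p : ℤ} (hp : 0 < p) {L : ℤ → Prop} (hL : ∀ x k, L (x + p * k) ↔ L x) :
    0 < cnt p L ↔ ∃ x, L x := by
  rw [cnt, Finset.card_pos]
  constructor
  · rintro ⟨k, hk⟩
    exact ⟨k, (Finset.mem_filter.1 hk).2⟩
  · rintro ⟨x, hx⟩
    obtain ⟨k, n, h1, h2, -⟩ := exists_nat_rep hp hL hx
    exact ⟨k, Finset.mem_filter.2 ⟨Finset.mem_range.2 h1, h2⟩⟩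

theorem unique_of_cnt {p : ℤ} (hp : 0 < p) {L : ℤ → Prop} (hL : ∀ x k, L (x + p * k) ↔ L x)
    (h : cnt p L ≤ 1) : Unique p L := by
  intro x y hx hy
  obtain ⟨k, n, h1, h2, rfl⟩ := exists_nat_rep hp hL hx
  obtain ⟨l, m, h3, h4, rfl⟩ := exists_nat_rep hp hL hy
  have : k = l := Finset.card_le_one.1 h k (Finset.mem_filter.2 ⟨Finset.mem_range.2 h1, h2⟩) l
    (Finset.mem_filter.2 ⟨Finset.mem_range.2 h3, h4⟩)
  subst this
  exact ⟨m - n, by ring⟩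

variable (M)

/-- The curve through `x` runs above the line from `x` to some other point of the line, to the
right if `b` and to the left otherwise. -/
def ArcDir (b : Bool) (x : ℤ) : Prop := M.Up x ∧ ∃ y, M.UArc x y ∧ (x < y ↔ b = true)

variable {M}

theorem arcDir_add (b : Bool) (x k : ℤ) : M.ArcDir b (x + M.p * k) ↔ M.ArcDir b x := by
  have key : ∀ x k, M.ArcDir b x → M.ArcDir b (x + M.p * k) := by
    rintro x k ⟨h1, y, h2, h3⟩
    exact ⟨(M.up_per _ _).2 h1, _, h2.shift k, by simpa using h3⟩
  refine ⟨fun h => ?_, key x k⟩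
  have := key _ (-k) h
  rwa [show x + M.p * k + M.p * -k = x by ring] at this

theorem DirB.arcDir {b : Bool} {x : ℤ} (h : M.DirB b x) : M.ArcDir b x :=
  ⟨h.2.1, _, UArc.rainbow x h.1, h.2.2⟩

theorem cnt_arcDir_pos (hp : 0 < M.p) {b : Bool} (h : 0 < cnt M.p (M.ArcDir b)) :
    0 < cnt M.p (M.DirB b) ∨ 0 < cnt M.p (M.DirT b) := by
  rw [cnt_pos_iff hp (dirB_add b), cnt_pos_iff hp (dirT_add b)]
  obtain ⟨x, hx, y, hxy, hb⟩ := (cnt_pos_iff hp (arcDir_add b)).1 h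
  by_contra hc
  push Not at hc
  exact hxy.not_dir_of_coherent hc.1 hc.2 hx hb

/-- The coherence condition on the arcs: in each family a single arc is directed as prescribed
by `d`, some arcs have the other direction, and the two exceptional arcs are linked. -/
def AlmostCoherent (M : CurveModel) (d : Bool) : Prop :=
  cnt M.p (M.DirB d) = 1 ∧ cnt M.p (M.DirT d) = 1 ∧ 0 < cnt M.p (M.DirB !d) ∧
    M.Linked (M.DirB d) (M.DirT d)

theorem cnt_arcDir_le {d : Bool} (hp : 0 < M.p) (hB : cnt M.p (M.DirB d) ≤ 1)
    (hT : cnt M.p (M.DirT d) ≤ 1) (hl : M.Linked (M.DirB d) (M.DirT d)) :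
    cnt M.p (M.ArcDir d) ≤ 1 :=
  (cnt_mono fun _ ⟨hx, _, hxy, hb⟩ => dirB_of_linked (unique_of_cnt hp (dirB_add d) hB)
    (unique_of_cnt hp (dirT_add d) hT) hl hxy hx hb).trans hB

theorem exists_cnt_arcDir_iff (hp : 0 < M.p) (f : ∀ b, cnt M.p (M.DirB b) = cnt M.p (M.DirT b)) :
    (∃ dU dL : Bool, cnt M.p (M.ArcDir dU) ≤ cnt M.p (M.ArcDir !dU) ∧
      cnt M.p (M.flip.ArcDir dL) ≤ cnt M.p (M.flip.ArcDir !dL) ∧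
      cnt M.p (M.ArcDir dU) + cnt M.p (M.flip.ArcDir dL) = 2) ↔ ∃ d, M.AlmostCoherent d := by
  have u1 : ∀ b, cnt M.p (M.DirB b) ≤ cnt M.p (M.ArcDir b) := fun b =>
    cnt_mono fun x hx => hx.arcDir
  have l1 : ∀ b, cnt M.p (M.DirT b) ≤ cnt M.p (M.flip.ArcDir b) := fun b =>
    cnt_mono fun x (hx : M.flip.DirB b x) => hx.arcDir
  have u2 : ∀ b, 0 < cnt M.p (M.ArcDir b) → 0 < cnt M.p (M.DirB b) := fun b h => by
    have := cnt_arcDir_pos hp h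
    have := f b
    omega
  have l2 : ∀ b, 0 < cnt M.p (M.flip.ArcDir b) → 0 < cnt M.p (M.DirB b) := fun b h => by
    have h' : 0 < cnt M.p (M.DirT b) ∨ 0 < cnt M.p (M.flip.DirT b) :=
      cnt_arcDir_pos (M := M.flip) hp h
    rw [flip_dirT] at h'
    have := f b
    omega
  constructor
  · rintro ⟨dU, dL, h1, h2, h3⟩
    have h4 : cnt M.p (M.ArcDir dU) = 1 ∧ 0 < cnt M.p (M.DirB !dU) := by
      have a1 := u1 true
      have a2 := u1 false
      have a3 := l1 true
      have a4 := l1 false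
      have b1 := u2 true
      have b2 := u2 false
      have b3 := l2 true
      have b4 := l2 false
      have c1 := f true
      have c2 := f false
      cases dU <;> cases dL <;> simp only [Bool.not_true, Bool.not_false] at * <;> omega
    have h5 : cnt M.p (M.DirB dU) = 1 := by
      have := u1 dU
      have := u2 dU
      omega
    refine ⟨dU, h5, (f dU).symm.trans h5, h4.2, ?_⟩
    obtain ⟨g, hg⟩ := (cnt_pos_iff hp (dirB_add dU)).1 (by omega : 0 < cnt M.p (M.DirB dU))
    refine linked_of_dir (unique_of_cnt hp (dirB_add dU) h5.le) (fun x y h hx hb => ?_) hg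
    obtain ⟨n, rfl⟩ := unique_of_cnt hp (arcDir_add dU) h4.1.le _ _ hg.arcDir ⟨hx, y, h, hb⟩
    exact (M.hB.per _ _).2 hg.1
  · rintro ⟨d, h1, h2, h3, h4⟩
    have h5 := cnt_arcDir_le hp h1.le h2.le h4
    have h6 : cnt M.p (M.flip.ArcDir d) ≤ 1 :=
      cnt_arcDir_le (M := M.flip) hp h2.le (by rw [flip_dirT]; exact h1.le) h4.flip_dir
    have a1 := u1 d
    have a2 := u1 !d
    have a3 := l1 d
    have a4 := l1 !d
    have a5 := f !d
    exact ⟨d, d, by omega, by omega, by omega⟩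

end CurveModel

namespace StdDiagram

section

/-! ### The curves of a standard diagram -/

theorem _root_.Int.emod_eq_of_eq_mul_add {p x a m : ℤ} (h : x = p * a + m) (h0 : 0 ≤ m)
    (h1 : m < p) : x % p = m := by
  rw [h, add_comm, Int.add_mul_emod_self_left, Int.emod_eq_of_lt h0 h1]

theorem _root_.Int.exists_eq_mul_add {p : ℤ} (hp : 0 < p) (x : ℤ) :
    ∃ a m, x = p * a + m ∧ 0 ≤ m ∧ m < p ∧ x % p = m :=
  ⟨x / p, x % p, (Int.mul_ediv_add_emod x p).symm, Int.emod_nonneg _ hp.ne',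
    Int.emod_lt_of_pos _ hp, rfl⟩

theorem _root_.Int.eq_zero_of_mul_lt {p a : ℤ} (h1 : p * a < p) (h2 : -p < p * a) : a = 0 := by
  have hp : 0 < p := by omega
  have h3 : a < 1 := by by_contra hc; push Not at hc; nlinarith
  have h4 : -1 < a := by by_contra hc; push Not at hc; nlinarith
  omega

/-- The family of `w / 2` nested arcs whose feet are the residue classes
`-c, -c + 1, …, -c + w - 1` modulo `p`. -/
theorem rainbowFamily {p w : ℤ} (hp : 0 < p) (hw : w ≤ p) (hw2 : Even w) (c : ℤ) :
    RainbowFamily p (fun x => (x + c) % p < w) (fun x => x + (w - 1 - 2 * ((x + c) % p))) := by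
  have shift : ∀ x k, (x + p * k + c) % p = (x + c) % p := fun x k => by
    rw [show x + p * k + c = x + c + p * k by ring, Int.add_mul_emod_self_left]
  have key : ∀ x d, 0 ≤ (x + c) % p + d → (x + c) % p + d < p →
      (x + d + c) % p = (x + c) % p + d := fun x d h0 h1 =>
    Int.emod_eq_of_eq_mul_add (a := (x + c) / p)
      (by have := Int.mul_ediv_add_emod (x + c) p; omega) h0 h1
  have pos : ∀ x, 0 ≤ (x + c) % p := fun x => Int.emod_nonneg _ hp.ne'
  have mem : ∀ x, (x + c) % p < w →
      (x + (w - 1 - 2 * ((x + c) % p)) + c) % p = w - 1 - (x + c) % p := fun x hx => by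
    have := pos x
    rw [key _ _ (by omega) (by omega)]; ring
  constructor
  · intro x k
    rw [shift]
  · intro x k
    simp only [shift]; ring
  · intro x hx
    have := pos x
    simp only [mem x hx]; omega
  · intro x hx
    simp only [mem x hx]; ring
  · intro x hx
    obtain ⟨t, rfl⟩ := hw2
    omega
  · intro x hx
    have := pos x
    omega
  · intro x z hx h1 h2
    have := pos x
    have h3 := key x (z - x) (by omega) (by omega)
    rw [add_sub_cancel] at h3
    simp only [h3]
    omega
  · intro x y hx hy
    refine ⟨(x + c) / p - (y + c) / p, ?_⟩
    have h1 := Int.mul_ediv_add_emod (x + c) p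
    have h2 := Int.mul_ediv_add_emod (y + c) p
    linarith

variable (D : StdDiagram)

/-- The points, in top-edge coordinates, at which bottom rainbow arcs are attached. -/
def footB (x : ℤ) : Prop := (x + D.sz) % D.pz < 2 * D.qz

/-- The other end of a bottom rainbow arc. -/
def archB (x : ℤ) : ℤ := x + (2 * D.qz - 1 - 2 * ((x + D.sz) % D.pz))

/-- The points, in top-edge coordinates, at which top rainbow arcs are attached. -/
def footT (x : ℤ) : Prop := (x + -D.rz) % D.pz < 2 * D.qz

/-- The other end of a top rainbow arc. -/
def archT (x : ℤ) : ℤ := x + (2 * D.qz - 1 - 2 * ((x + -D.rz) % D.pz))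

/-- The upper end of the strand which starts at a point of the bottom edge. -/
def ascend (x : ℤ) : ℤ :=
  x + D.sz - if (x + D.sz) % D.pz < D.rz + 2 * D.qz then 2 * D.qz else 0

/-- The lower end of the strand which starts at a point of the top edge. -/
def descend (x : ℤ) : ℤ := x - D.sz + if x % D.pz < D.rz then 2 * D.qz else 0

theorem bounds : 0 < D.pz ∧ 0 ≤ D.qz ∧ 0 ≤ D.rz ∧ 2 * D.qz + D.rz ≤ D.pz := by
  have h1 := D.hp
  have h2 := D.h2qr
  simp only [pz, qz, rz]
  omega

variable {D}

theorem footT_iff {x : ℤ} :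
    D.footT x ↔ D.rz ≤ x % D.pz ∧ x % D.pz < D.rz + 2 * D.qz := by
  obtain ⟨hp, hq, hr, h⟩ := D.bounds
  obtain ⟨a, m, hx, h0, h1, h2⟩ := Int.exists_eq_mul_add hp x
  rw [footT, h2]
  rcases lt_or_ge m D.rz with h3 | h3
  · rw [Int.emod_eq_of_eq_mul_add (a := a - 1) (m := m - D.rz + D.pz) (by rw [hx]; ring)
      (by omega) (by omega)]
    omega
  · rw [Int.emod_eq_of_eq_mul_add (a := a) (m := m - D.rz) (by rw [hx]; ring)
      (by omega) (by omega)]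
    omega

theorem archT_eq {x : ℤ} (hx : D.footT x) :
    D.archT x = 2 * D.rz + 2 * D.qz - 1 - 2 * (x % D.pz) + x := by
  obtain ⟨hp, hq, hr, h⟩ := D.bounds
  rw [footT_iff] at hx
  obtain ⟨a, m, hx', h0, h1, h2⟩ := Int.exists_eq_mul_add hp x
  rw [archT, Int.emod_eq_of_eq_mul_add (a := a) (m := x % D.pz - D.rz) (by rw [h2, hx']; ring)
      (by omega) (by omega)]
  ring

theorem ascend_spec {x : ℤ} (hx : ¬ D.footB x) :
    ¬ D.footT (D.ascend x) ∧ D.descend (D.ascend x) = x := by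
  obtain ⟨hp, hq, hr, h⟩ := D.bounds
  rw [footB] at hx
  rw [footT_iff, descend, ascend]
  obtain ⟨a, m, hx', h0, h1, h2⟩ := Int.exists_eq_mul_add hp (x + D.sz)
  rw [h2] at hx ⊢
  by_cases h3 : m < D.rz + 2 * D.qz
  · rw [if_pos h3, Int.emod_eq_of_eq_mul_add (a := a) (m := m - 2 * D.qz) (by omega)
      (by omega) (by omega), if_pos (by omega)]
    omega
  · rw [if_neg h3, sub_zero, h2, if_neg (by omega)]
    omega

theorem descend_spec {x : ℤ} (hx : ¬ D.footT x) :
    ¬ D.footB (D.descend x) ∧ D.ascend (D.descend x) = x := by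
  obtain ⟨hp, hq, hr, h⟩ := D.bounds
  rw [footT_iff] at hx
  rw [footB, ascend, descend]
  obtain ⟨a, m, hx', h0, h1, h2⟩ := Int.exists_eq_mul_add hp x
  rw [h2] at hx ⊢
  by_cases h3 : m < D.rz
  · have e : (x - D.sz + 2 * D.qz + D.sz) % D.pz = m + 2 * D.qz :=
      Int.emod_eq_of_eq_mul_add (a := a) (by omega) (by omega) (by omega)
    rw [if_pos h3, e]
    constructor
    · omega
    · rw [if_pos (by omega)]; omega
  · have e : (x - D.sz + 0 + D.sz) % D.pz = m := by
      rw [← h2, show x - D.sz + 0 + D.sz = x by ring]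
    rw [if_neg h3, e]
    constructor
    · omega
    · rw [if_neg (by omega)]; omega

theorem ascend_lt {x y : ℤ} (hy : ¬ D.footB y) (hxy : x < y) :
    D.ascend x < D.ascend y := by
  obtain ⟨hp, hq, hr, h⟩ := D.bounds
  rw [footB] at hy
  rw [ascend, ascend]
  obtain ⟨a, m, hx', h0, h1, h2⟩ := Int.exists_eq_mul_add hp (x + D.sz)
  obtain ⟨b, n, hy', k0, k1, k2⟩ := Int.exists_eq_mul_add hp (y + D.sz)
  rw [h2, k2]
  rw [k2] at hy
  rcases lt_trichotomy a b with hab | rfl | hab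
  · have : D.pz * a + D.pz ≤ D.pz * b := by nlinarith
    split_ifs <;> omega
  · split_ifs <;> omega
  · have : D.pz * b + D.pz ≤ D.pz * a := by nlinarith
    omega

theorem ascend_per (x k : ℤ) : D.ascend (x + D.pz * k) = D.ascend x + D.pz * k := by
  rw [ascend, ascend, show x + D.pz * k + D.sz = x + D.sz + D.pz * k by ring,
    Int.add_mul_emod_self_left]
  ring

theorem descend_per (x k : ℤ) : D.descend (x + D.pz * k) = D.descend x + D.pz * k := by
  rw [descend, descend, Int.add_mul_emod_self_left]
  ring

variable (D)

theorem rainbowB : RainbowFamily D.pz D.footB D.archB :=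
  rainbowFamily D.bounds.1 (by have := D.bounds; omega) ⟨D.qz, by ring⟩ _

theorem rainbowT : RainbowFamily D.pz D.footT D.archT :=
  rainbowFamily D.bounds.1 (by have := D.bounds; omega) ⟨D.qz, by ring⟩ _

variable {D}

/-! ### Steps of the traversal -/

theorem step_arch {x : ℤ} (h : ℤ) (hx : D.footB x) :
    D.step^[3] ⟨x, true, true, h⟩ = ⟨D.archB x, false, true, h⟩ ∧
      (D.step^[1] ⟨x, true, true, h⟩).top = false ∧
      (D.step^[2] ⟨x, true, true, h⟩).top = false := by
  obtain ⟨hp, hq, hr, hpqr⟩ := D.bounds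
  rw [footB] at hx
  have : (x + D.sz) % D.pz ≤ 2 * D.qz - 1 := by omega
  simp [step, this, archB]
  ring

theorem stepB_arch {x : ℤ} (h : ℤ) (hx : D.footB x) :
    D.stepB^[3] ⟨x, false, true, h⟩ = ⟨D.archB x, true, true, h⟩ ∧
      (D.stepB^[1] ⟨x, false, true, h⟩).top = false ∧
      (D.stepB^[2] ⟨x, false, true, h⟩).top = false := by
  obtain ⟨hp, hq, hr, hpqr⟩ := D.bounds
  rw [footB] at hx
  have : (x + D.sz) % D.pz ≤ 2 * D.qz - 1 := by omega
  simp [stepB, this, archB]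
  ring

theorem step_rise {x : ℤ} (h : ℤ) (hx : ¬ D.footB x) :
    D.step^[2] ⟨x, true, true, h⟩ = ⟨D.ascend x, true, true, h + 1⟩ ∧
      (D.step^[1] ⟨x, true, true, h⟩).top = false := by
  obtain ⟨hp, hq, hr, hpqr⟩ := D.bounds
  rw [footB] at hx
  have h1 : ¬ (x + D.sz) % D.pz ≤ 2 * D.qz - 1 := by omega
  simp only [Function.iterate_succ, Function.iterate_zero, Function.comp, id, step, ascend]
  by_cases h3 : (x + D.sz) % D.pz < D.rz + 2 * D.qz <;> simp [h1, h3]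

theorem stepB_rise {x : ℤ} (h : ℤ) (hx : ¬ D.footB x) :
    D.stepB^[2] ⟨x, false, true, h⟩ = ⟨D.ascend x, false, true, h + 1⟩ ∧
      (D.stepB^[1] ⟨x, false, true, h⟩).top = false := by
  obtain ⟨hp, hq, hr, hpqr⟩ := D.bounds
  rw [footB] at hx
  have h1 : ¬ (x + D.sz) % D.pz ≤ 2 * D.qz - 1 := by omega
  simp only [Function.iterate_succ, Function.iterate_zero, Function.comp, id, stepB, ascend,
    add_comm (2 * D.qz)]
  by_cases h3 : (x + D.sz) % D.pz < D.rz + 2 * D.qz <;> simp [h1, h3]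

theorem step_bowl {x : ℤ} (h : ℤ) (hx : D.footT x) :
    D.step^[1] ⟨x, false, true, h⟩ = ⟨D.archT x, true, true, h⟩ := by
  have e := archT_eq hx
  rw [footT_iff] at hx
  have h1 : ¬ x % D.pz ≤ D.rz - 1 := by omega
  have h2 : x % D.pz ≤ D.rz + 2 * D.qz - 1 := by omega
  simp [step, h1, h2, e]

theorem stepB_bowl {x : ℤ} (h : ℤ) (hx : D.footT x) :
    D.stepB^[1] ⟨x, true, true, h⟩ = ⟨D.archT x, false, true, h⟩ := by
  have e := archT_eq hx
  rw [footT_iff] at hx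
  have h2 : x % D.pz ≤ D.rz + 2 * D.qz - 1 := by omega
  simp [stepB, h2, hx.1, e]

theorem step_fall {x : ℤ} (h : ℤ) (hx : ¬ D.footT x) :
    D.step^[2] ⟨x, false, true, h⟩ = ⟨D.descend x, false, true, h - 1⟩ ∧
      (D.step^[1] ⟨x, false, true, h⟩).top = false := by
  rw [footT_iff] at hx
  simp only [Function.iterate_succ, Function.iterate_zero, Function.comp, id, step, descend]
  by_cases h1 : x % D.pz < D.rz
  · have h2 : x % D.pz ≤ D.rz - 1 := by omega
    simp [h1, h2]; ring
  · have h2 : ¬ x % D.pz ≤ D.rz - 1 := by omega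
    have h3 : ¬ x % D.pz ≤ D.rz + 2 * D.qz - 1 := by omega
    simp [h1, h2, h3]

theorem stepB_fall {x : ℤ} (h : ℤ) (hx : ¬ D.footT x) :
    D.stepB^[2] ⟨x, true, true, h⟩ = ⟨D.descend x, true, true, h - 1⟩ ∧
      (D.stepB^[1] ⟨x, true, true, h⟩).top = false := by
  rw [footT_iff] at hx
  simp only [Function.iterate_succ, Function.iterate_zero, Function.comp, id, stepB, descend]
  by_cases h1 : x % D.pz < D.rz
  · have h2 : x % D.pz ≤ D.rz - 1 := by omega
    have h3 : ¬ (D.rz ≤ x % D.pz ∧ x % D.pz ≤ D.rz + 2 * D.qz - 1) := by omega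
    simp only [h1, h2, h3]
    simp; ring
  · have h2 : ¬ x % D.pz ≤ D.rz - 1 := by omega
    have h3 : ¬ (D.rz ≤ x % D.pz ∧ x % D.pz ≤ D.rz + 2 * D.qz - 1) := by omega
    simp only [h1, h2, h3]
    simp

end

section

/-! ### The orientation of `β` -/

/-- Change of direction at a point of `β`. -/
def about : Equiv.Perm (ℤ × Bool) where
  toFun σ := (σ.1, !σ.2)
  invFun σ := (σ.1, !σ.2)
  left_inv σ := by simp
  right_inv σ := by simp

/-- Translation of the points of `β` by a multiple of `p`. -/
def translate (D : StdDiagram) (k : ℤ) : Equiv.Perm (ℤ × Bool) where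
  toFun σ := (σ.1 + D.pz * k, σ.2)
  invFun σ := (σ.1 - D.pz * k, σ.2)
  left_inv σ := by simp
  right_inv σ := by simp

/-- The next intersection point of `β` with `α` in a given direction. -/
def nextPt (D : StdDiagram) (σ : ℤ × Bool) : ℤ × Bool :=
  if σ.2 then if D.footB σ.1 then (D.archB σ.1, false) else (D.ascend σ.1, true)
  else if D.footT σ.1 then (D.archT σ.1, true) else (D.descend σ.1, false)

variable {D : StdDiagram}

theorem nextPt_arch {x : ℤ} (h : D.footB x) : D.nextPt (x, true) = (D.archB x, false) := by
  simp [nextPt, h]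

theorem nextPt_rise {x : ℤ} (h : ¬ D.footB x) : D.nextPt (x, true) = (D.ascend x, true) := by
  simp [nextPt, h]

theorem nextPt_bowl {x : ℤ} (h : D.footT x) : D.nextPt (x, false) = (D.archT x, true) := by
  simp [nextPt, h]

theorem nextPt_fall {x : ℤ} (h : ¬ D.footT x) : D.nextPt (x, false) = (D.descend x, false) := by
  simp [nextPt, h]

theorem nextPt_about (σ : ℤ × Bool) : D.nextPt (about (D.nextPt σ)) = about σ := by
  obtain ⟨x, u⟩ := σ
  cases u
  · by_cases h : D.footT x
    · rw [nextPt_bowl h, about, Equiv.coe_fn_mk]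
      simp [nextPt_bowl (D.rainbowT.mem x h), D.rainbowT.inv x h]
    · rw [nextPt_fall h, about, Equiv.coe_fn_mk]
      simp [nextPt_rise (descend_spec h).1, (descend_spec h).2]
  · by_cases h : D.footB x
    · rw [nextPt_arch h, about, Equiv.coe_fn_mk]
      simp [nextPt_arch (D.rainbowB.mem x h), D.rainbowB.inv x h]
    · rw [nextPt_rise h, about, Equiv.coe_fn_mk]
      simp [nextPt_fall (ascend_spec h).1, (ascend_spec h).2]

theorem about_about (σ : ℤ × Bool) : about (about σ) = σ := by simp [about]

variable (D) in
/-- The passage to the next intersection point as a permutation. -/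
def advance : Equiv.Perm (ℤ × Bool) where
  toFun := D.nextPt
  invFun σ := about (D.nextPt (about σ))
  left_inv σ := by simp only [nextPt_about, about_about]
  right_inv σ := by simp only [nextPt_about, about_about]

theorem about_zpow (n : ℤ) (σ : ℤ × Bool) :
    about ((D.advance ^ n) σ) = (D.advance ^ (-n)) (about σ) := by
  have h : SemiconjBy about D.advance D.advance⁻¹ := by
    ext1 τ
    change about (D.nextPt τ) = about (D.nextPt (about (about τ)))
    rw [about_about]
  have := congrArg (fun g : Equiv.Perm (ℤ × Bool) => g σ) (h.zpow_right n).eq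
  rwa [inv_zpow, ← zpow_neg] at this

theorem translate_zpow (n k : ℤ) (σ : ℤ × Bool) :
    D.translate k ((D.advance ^ n) σ) = (D.advance ^ n) (D.translate k σ) := by
  have h : Commute (D.translate k) D.advance := by
    ext1 ⟨x, u⟩
    change D.translate k (D.nextPt _) = D.nextPt (D.translate k _)
    simp only [translate, Equiv.coe_fn_mk, nextPt, D.rainbowB.per, D.rainbowB.iper, D.rainbowT.per,
      D.rainbowT.iper, ascend_per, descend_per]
    split_ifs <;> rfl
  exact congrArg (fun g : Equiv.Perm (ℤ × Bool) => g σ) (h.zpow_right n).eq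

theorem zpow_add_apply (m n : ℤ) (σ : ℤ × Bool) :
    (D.advance ^ (m + n)) σ = (D.advance ^ m) ((D.advance ^ n) σ) := by
  rw [zpow_add]; rfl

theorem advance_ne (σ : ℤ × Bool) (k : ℤ) : D.advance σ ≠ about (D.translate k σ) := by
  obtain ⟨x, u⟩ := σ
  change D.nextPt _ ≠ (x + D.pz * k, !u)
  intro h
  cases u
  · by_cases hx : D.footT x
    · rw [nextPt_bowl hx] at h
      have h1 := congrArg Prod.fst h
      have h2 := D.rainbowT.width x hx
      have h3 := D.rainbowT.lt_width hx
      simp only at h1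
      obtain rfl := Int.eq_zero_of_mul_lt (p := D.pz) (a := k) (by omega) (by omega)
      exact D.rainbowT.ne x hx (by simpa using h1)
    · simp [nextPt_fall hx] at h
  · by_cases hx : D.footB x
    · rw [nextPt_arch hx] at h
      have h1 := congrArg Prod.fst h
      have h2 := D.rainbowB.width x hx
      have h3 := D.rainbowB.lt_width hx
      simp only at h1
      obtain rfl := Int.eq_zero_of_mul_lt (p := D.pz) (a := k) (by omega) (by omega)
      exact D.rainbowB.ne x hx (by simpa using h1)
    · simp [nextPt_rise hx] at h

/-- `β` does not traverse itself in the opposite direction. -/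
theorem zpow_ne (n k : ℤ) (σ : ℤ × Bool) : (D.advance ^ n) σ ≠ about (D.translate k σ) := by
  intro h
  have key : ∀ m, (D.advance ^ (n - m)) σ = about (D.translate k ((D.advance ^ m) σ)) := by
    intro m
    rw [translate_zpow, about_zpow, ← h, ← zpow_add_apply]
    congr 2
    ring
  obtain ⟨m, hm | hm⟩ := Int.even_or_odd' n
  · have := key m
    rw [show n - m = m by omega] at this
    simpa [about, translate] using congrArg Prod.snd this
  · have := key m
    rw [show n - m = 1 + m by omega, zpow_add_apply, zpow_one] at this
    exact advance_ne _ _ this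

variable (D) in
/-- The curve `β` with its reference orientation passes the point `σ.1` upwards, respectively
downwards, as specified by `σ.2`. -/
def Passes (σ : ℤ × Bool) : Prop := ∃ n k : ℤ, (D.advance ^ n) (0, false) = D.translate k σ

theorem translate_add (k l : ℤ) (σ : ℤ × Bool) :
    D.translate k (D.translate l σ) = D.translate (k + l) σ := by
  simp [translate]; ring

theorem passes_translate (k : ℤ) (σ : ℤ × Bool) : D.Passes (D.translate k σ) ↔ D.Passes σ := by
  constructor
  · rintro ⟨n, l, h⟩
    exact ⟨n, l + k, by rw [h, translate_add]⟩
  · rintro ⟨n, l, h⟩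
    exact ⟨n, l - k, by rw [h, translate_add, sub_add_cancel]⟩

theorem passes_zpow (n : ℤ) (σ : ℤ × Bool) : D.Passes ((D.advance ^ n) σ) ↔ D.Passes σ := by
  constructor
  · rintro ⟨m, l, h⟩
    refine ⟨-n + m, l, ?_⟩
    rw [zpow_add_apply, h, ← translate_zpow, ← zpow_add_apply, neg_add_cancel]
    rfl
  · rintro ⟨m, l, h⟩
    refine ⟨n + m, l, ?_⟩
    rw [zpow_add_apply, h, ← translate_zpow]

theorem passes_nextPt (σ : ℤ × Bool) : D.Passes (D.nextPt σ) ↔ D.Passes σ := by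
  have := passes_zpow (D := D) 1 σ
  rwa [zpow_one] at this

theorem passes_start : D.Passes (0, false) := ⟨0, 0, by simp [translate]⟩

theorem not_passes_about {σ : ℤ × Bool} (h : D.Passes σ) : ¬ D.Passes (about σ) := by
  rintro ⟨m, l, hm⟩
  obtain ⟨n, k, hn⟩ := h
  refine zpow_ne (D := D) (m - n) (l - k) (D.translate k σ) ?_
  rw [← hn, ← zpow_add_apply, sub_add_cancel, hm, hn, translate_add, sub_add_cancel]
  simp [about, translate]

theorem exists_zpow_of_top (n : ℕ) : ∀ σ : CState, σ.top = true → (D.step^[n] σ).top = true →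
    ∃ m : ℤ, (D.advance ^ m) (σ.pos, σ.up) = ((D.step^[n] σ).pos, (D.step^[n] σ).up) := by
  induction n using Nat.strong_induction_on with
  | _ n ih =>
    have go : ∀ (σ τ : CState) (c : ℕ), 1 ≤ c → D.step^[c] σ = τ → τ.top = true →
        D.nextPt (σ.pos, σ.up) = (τ.pos, τ.up) →
        (∀ i, 0 < i → i < c → (D.step^[i] σ).top = false) → (D.step^[n] σ).top = true →
        ∃ m : ℤ, (D.advance ^ m) (σ.pos, σ.up) = ((D.step^[n] σ).pos, (D.step^[n] σ).up) := by
      intro σ τ c hc hστ hτ hN hi hn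
      rcases Nat.eq_zero_or_pos n with rfl | h0
      · exact ⟨0, rfl⟩
      rcases Nat.lt_or_ge n c with h | h
      · rw [hi n h0 h] at hn; cases hn
      obtain ⟨d, rfl⟩ := Nat.exists_eq_add_of_le' h
      rw [Function.iterate_add_apply, hστ] at hn ⊢
      obtain ⟨m, hm⟩ := ih d (by omega) τ hτ hn
      refine ⟨m + 1, ?_⟩
      rw [zpow_add_apply, zpow_one, ← hm, ← hN]
      rfl
    rintro ⟨x, u, t, h⟩ ht hn
    obtain rfl : t = true := ht
    cases u
    · by_cases hx : D.footT x
      · exact go _ _ 1 le_rfl (step_bowl h hx) rfl (nextPt_bowl hx) (fun i h1 h2 => by omega) hn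
      · refine go _ _ 2 (by omega) (step_fall h hx).1 rfl (nextPt_fall hx) (fun i h1 h2 => ?_) hn
        obtain rfl : i = 1 := by omega
        exact (step_fall h hx).2
    · by_cases hx : D.footB x
      · refine go _ _ 3 (by omega) (step_arch h hx).1 rfl (nextPt_arch hx) (fun i h1 h2 => ?_) hn
        obtain rfl | rfl : i = 1 ∨ i = 2 := by omega
        · exact (step_arch h hx).2.1
        · exact (step_arch h hx).2.2
      · refine go _ _ 2 (by omega) (step_rise h hx).1 rfl (nextPt_rise hx) (fun i h1 h2 => ?_) hn
        obtain rfl : i = 1 := by omega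
        exact (step_rise h hx).2

theorem passes_of_emod_eq {x y : ℤ} {u : Bool} (h : x % D.pz = y % D.pz) (hx : D.Passes (x, u)) :
    D.Passes (y, u) := by
  have : (y, u) = D.translate (y / D.pz - x / D.pz) (x, u) := by
    have h1 := Int.mul_ediv_add_emod x D.pz
    have h2 := Int.mul_ediv_add_emod y D.pz
    simp only [translate, Equiv.coe_fn_mk, Prod.mk.injEq, and_true]
    rw [mul_sub]
    omega
  rwa [this, passes_translate]

theorem passes_of_step {n : ℕ} {x : ℤ} (h : (D.step^[n] start0).top = true)
    (hx : (D.step^[n] start0).pos % D.pz = x % D.pz) : D.Passes (x, (D.step^[n] start0).up) := by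
  obtain ⟨m, hm⟩ := exists_zpow_of_top (D := D) n start0 rfl h
  refine passes_of_emod_eq hx ?_
  rw [← hm, passes_zpow]
  exact passes_start

variable (hconn : D.Connected)
include hconn

theorem exists_step (x : ℤ) : ∃ n, (D.step^[n] start0).top = true ∧
    (D.step^[n] start0).pos % D.pz = x % D.pz := by
  have h1 := Int.emod_nonneg x D.bounds.1.ne'
  have h2 := Int.emod_lt_of_pos x D.bounds.1
  obtain ⟨n, hn⟩ := hconn (x % D.pz).toNat (by rw [pz] at *; omega)
  rw [Int.toNat_of_nonneg h1] at hn
  exact ⟨n, hn⟩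

theorem passes_or (x : ℤ) : D.Passes (x, true) ∨ D.Passes (x, false) := by
  obtain ⟨n, h1, h2⟩ := exists_step hconn x
  have := passes_of_step h1 h2
  cases h : (D.step^[n] start0).up <;> simp_all

theorem upAt_iff (x : ℤ) : D.UpAt x ↔ D.Passes (x, true) := by
  constructor
  · rintro ⟨n, h1, h2, h3⟩
    rw [← h3]
    exact passes_of_step h1 h2
  · intro h
    obtain ⟨n, h1, h2⟩ := exists_step hconn x
    refine ⟨n, h1, h2, ?_⟩
    have h3 := passes_of_step h1 h2
    by_contra hc
    rw [Bool.not_eq_true] at hc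
    rw [hc] at h3
    exact not_passes_about h h3

theorem not_upAt_iff (x : ℤ) : ¬ D.UpAt x ↔ D.Passes (x, false) := by
  rw [upAt_iff hconn]
  constructor
  · intro h
    exact (passes_or hconn x).resolve_left h
  · intro h h'
    exact not_passes_about h h'

theorem upAt_per (x k : ℤ) : D.UpAt (x + D.pz * k) ↔ D.UpAt x := by
  rw [upAt_iff hconn, upAt_iff hconn]
  exact passes_translate k (x, true)

theorem upAt_archB {x : ℤ} (hx : D.footB x) : D.UpAt (D.archB x) ↔ ¬ D.UpAt x := by
  rw [← not_iff_not, not_upAt_iff hconn, not_not, upAt_iff hconn, ← nextPt_arch hx, passes_nextPt]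

theorem upAt_archT {x : ℤ} (hx : D.footT x) : D.UpAt (D.archT x) ↔ ¬ D.UpAt x := by
  rw [not_upAt_iff hconn, upAt_iff hconn, ← nextPt_bowl hx, passes_nextPt]

theorem upAt_ascend {x : ℤ} (hx : ¬ D.footB x) : D.UpAt (D.ascend x) ↔ D.UpAt x := by
  rw [upAt_iff hconn, upAt_iff hconn, ← nextPt_rise hx, passes_nextPt]

theorem algInt_eq_zero (g : ℤ → ℤ) (hg : ∀ x k, ∃ l, g (x + D.pz * k) = g x + D.pz * l)
    (hgg : ∀ x, g (g x) = x) (hup : ∀ x, D.UpAt (g x) ↔ ¬ D.UpAt x) : D.algInt = 0 := by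
  have hp := D.bounds.1
  have per : ∀ x, D.UpAt (x % D.pz) ↔ D.UpAt x := fun x => by
    rw [← upAt_per hconn x (-(x / D.pz))]
    have := Int.mul_ediv_add_emod x D.pz
    rw [show x + D.pz * -(x / D.pz) = x % D.pz by linarith]
  have cast : ∀ x : ℤ, ((x % D.pz).toNat : ℤ) = x % D.pz := fun x =>
    Int.toNat_of_nonneg (Int.emod_nonneg x hp.ne')
  have hup' : ∀ k : ℕ, D.UpAt ((g k % D.pz).toNat : ℤ) ↔ ¬ D.UpAt k := fun k => by
    rw [cast, per, hup]
  refine Finset.sum_involution (fun k _ => (g k % D.pz).toNat) ?_ ?_ ?_ ?_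
  · intro k _
    rw [if_congr (hup' k) rfl rfl]
    by_cases h : D.UpAt k <;> simp [h]
  · intro k _ _ h
    have := hup' k
    rw [h] at this
    tauto
  · intro k _
    have := Int.emod_lt_of_pos (g k) hp
    rw [Finset.mem_range]
    have := cast (g k)
    rw [pz] at *
    omega
  · intro k hk
    have h1 : ((g ((g k % D.pz).toNat : ℤ)) % D.pz) = k := by
      rw [cast]
      obtain ⟨l, hl⟩ := hg (g k) (-(g k / D.pz))
      have := Int.mul_ediv_add_emod (g k) D.pz
      rw [show g k + D.pz * -(g k / D.pz) = g k % D.pz by linarith, hgg] at hl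
      rw [hl, Int.add_mul_emod_self_left]
      rw [Finset.mem_range] at hk
      exact Int.emod_eq_of_lt (by omega) (by rw [pz]; omega)
    rw [h1]
    simp

variable (hA : D.algInt ≠ 0)
include hA

theorem exists_not_footB : ∃ x, ¬ D.footB x := by
  by_contra! h
  exact hA (algInt_eq_zero hconn D.archB (fun x k => ⟨k, D.rainbowB.iper x k⟩)
    (fun x => D.rainbowB.inv x (h x)) (fun x => upAt_archB hconn (h x)))

theorem archT_archB_ne {x : ℤ} (hx : D.footB x) (hT : D.footT (D.archB x)) :
    D.archT (D.archB x) ≠ x := by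
  intro h
  have hT' : D.footT x := by rw [← h]; exact D.rainbowT.mem _ hT
  have h' : D.archT x = D.archB x := by rw [← h, D.rainbowT.inv _ hT, h]
  obtain ⟨y, hy⟩ := exists_not_footB hconn hA
  let P : ℤ × Bool → Prop := fun σ => ∃ k, σ.1 = x + D.pz * k ∨ σ.1 = D.archB x + D.pz * k
  have hN : ∀ σ, P σ → P (D.nextPt σ) := by
    rintro ⟨z, u⟩ ⟨k, rfl | rfl⟩ <;> cases u
    · rw [nextPt_bowl ((D.rainbowT.per _ _).2 hT')]
      exact ⟨k, Or.inr (by rw [D.rainbowT.iper, h'])⟩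
    · rw [nextPt_arch ((D.rainbowB.per _ _).2 hx)]
      exact ⟨k, Or.inr (by rw [D.rainbowB.iper])⟩
    · rw [nextPt_bowl ((D.rainbowT.per _ _).2 hT)]
      exact ⟨k, Or.inl (by rw [D.rainbowT.iper, h])⟩
    · rw [nextPt_arch ((D.rainbowB.per _ _).2 (D.rainbowB.mem _ hx))]
      exact ⟨k, Or.inl (by rw [D.rainbowB.iper, D.rainbowB.inv _ hx])⟩
  have hpow : ∀ (n : ℤ) σ, P σ → P ((D.advance ^ n) σ) := by
    have hnat : ∀ (n : ℕ) σ, P σ → P ((D.advance ^ (n : ℤ)) σ) := by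
      intro n
      induction n with
      | zero => exact fun σ h => h
      | succ n ih =>
        intro σ hσ
        rw [Nat.cast_succ, zpow_add_apply, zpow_one]
        exact ih _ (hN σ hσ)
    intro n σ hσ
    obtain ⟨m, rfl | rfl⟩ := n.eq_nat_or_neg
    · exact hnat m σ hσ
    · have := about_zpow (D := D) m (about σ)
      rw [about_about] at this
      rw [← this]
      exact hnat m (about σ) hσ
  have hall : ∀ z, P (z, true) := by
    have h1 : ∀ z, ∃ σ : ℤ × Bool, σ.1 = z ∧ D.Passes σ := fun z => by
      rcases passes_or hconn z with h | h
      · exact ⟨_, rfl, h⟩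
      · exact ⟨_, rfl, h⟩
    obtain ⟨σ, hσ, n, k, hn⟩ := h1 x
    intro z
    obtain ⟨τ, hτ, m, l, hm⟩ := h1 z
    have h2 : P (D.translate k σ) := ⟨k, Or.inl (by rw [← hσ]; rfl)⟩
    rw [← hn] at h2
    have h3 := hpow (m + -n) _ h2
    rw [← zpow_add_apply, neg_add_cancel_right, hm] at h3
    obtain ⟨j, hj⟩ := h3
    have h4 : (D.translate l τ).1 = z + D.pz * l := by rw [← hτ]; rfl
    rw [h4] at hj
    refine ⟨j - l, ?_⟩
    simp only [mul_sub]
    omega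
  obtain ⟨k, hk | hk⟩ := hall y
  · refine hy ?_
    simp only at hk
    rw [hk, D.rainbowB.per]
    exact hx
  · refine hy ?_
    simp only at hk
    rw [hk, D.rainbowB.per]
    exact D.rainbowB.mem x hx

end

section

theorem _root_.OneOneKnot.CurveModel.Flow.first_return {M : CurveModel} {F : M.Flow} {x y : ℤ}
    (hxy : M.UArc x y) (h : ℤ) :
    F.f^[sInf {n : ℕ | 1 ≤ n ∧ F.lvl (F.f^[n] (F.u x h)) = some h}] (F.u x h) = F.d y h := by
  obtain ⟨m, h1, h2, h3⟩ := CurveModel.Flow.exists_leads (F := F) hxy h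
  have hm : m ∈ {n : ℕ | 1 ≤ n ∧ F.lvl (F.f^[n] (F.u x h)) = some h} :=
    ⟨h1, by rw [h2, F.lvl_d]⟩
  have hs := Nat.sInf_mem ⟨m, hm⟩
  have hle := Nat.sInf_le hm
  rcases hle.lt_or_eq with hlt | heq
  · exact absurd (h3 _ hs.1 hlt h hs.2) (lt_irrefl _)
  · rw [heq, h2]

/-! ### The symmetry exchanging the basepoints -/

theorem _root_.Int.sub_emod_lt_iff {p w : ℤ} (hp : 0 < p) (h0 : 0 ≤ w) (hw : w ≤ p) (z : ℤ) :
    ((w - 1 - z) % p < w ↔ z % p < w) ∧ (z % p < w → (w - 1 - z) % p = w - 1 - z % p) := by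
  obtain ⟨a, m, hz, hm, h1, h2⟩ := Int.exists_eq_mul_add hp z
  rw [h2]
  rcases lt_or_ge m w with h | h
  · rw [Int.emod_eq_of_eq_mul_add (a := -a) (m := w - 1 - m) (by rw [hz]; ring)
      (by omega) (by omega)]
    omega
  · rw [Int.emod_eq_of_eq_mul_add (a := -a - 1) (m := w - 1 - m + p) (by rw [hz]; ring)
      (by omega) (by omega)]
    omega

section

variable (D : StdDiagram)

/-- The rotation of the diagram which exchanges the two basepoints. -/
def rot (x : ℤ) : ℤ := D.rz + 2 * D.qz - 1 - D.sz - x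

variable {D}

theorem rot_rot (x : ℤ) : D.rot (D.rot x) = x := by rw [rot, rot]; ring

theorem footT_rot (x : ℤ) : D.footT (D.rot x) ↔ D.footB x := by
  have := (Int.sub_emod_lt_iff D.bounds.1 (w := 2 * D.qz) (by have := D.bounds; omega)
    (by have := D.bounds; omega) (x + D.sz)).1
  rw [footT, footB, rot, ← this]
  ring_nf

theorem archT_rot {x : ℤ} (hx : D.footB x) : D.archT (D.rot x) = D.rot (D.archB x) := by
  have := (Int.sub_emod_lt_iff D.bounds.1 (w := 2 * D.qz) (by have := D.bounds; omega)
    (by have := D.bounds; omega) (x + D.sz)).2 hx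
  rw [archT, archB, rot, rot, show D.rz + 2 * D.qz - 1 - D.sz - x + -D.rz =
    2 * D.qz - 1 - (x + D.sz) by ring, this]
  ring

theorem descend_rot {x : ℤ} (hx : ¬ D.footB x) : D.descend (D.rot x) = D.rot (D.ascend x) := by
  obtain ⟨hp, hq, hr, h⟩ := D.bounds
  rw [footB] at hx
  rw [descend, ascend, rot, rot]
  obtain ⟨a, m, hx', h0, h1, h2⟩ := Int.exists_eq_mul_add hp (x + D.sz)
  rw [h2] at hx ⊢
  by_cases h3 : m < D.rz + 2 * D.qz
  · rw [if_pos h3, Int.emod_eq_of_eq_mul_add (a := -a) (m := D.rz + 2 * D.qz - 1 - m)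
      (by rw [mul_neg]; omega) (by omega) (by omega), if_pos (by omega)]
    ring
  · rw [if_neg h3, Int.emod_eq_of_eq_mul_add (a := -a - 1) (m := D.rz + 2 * D.qz - 1 - m + D.pz)
      (by rw [mul_sub, mul_neg, mul_one]; omega) (by omega) (by omega), if_neg (by omega)]
    ring

theorem nextPt_rot (σ : ℤ × Bool) :
    D.nextPt (D.rot σ.1, !σ.2) = (D.rot (D.nextPt σ).1, !(D.nextPt σ).2) := by
  have key : ∀ x, D.nextPt (D.rot x, false) =
      (D.rot (D.nextPt (x, true)).1, !(D.nextPt (x, true)).2) := by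
    intro x
    by_cases hx : D.footB x
    · rw [nextPt_bowl ((footT_rot x).2 hx), nextPt_arch hx, archT_rot hx]; rfl
    · rw [nextPt_fall (fun h => hx ((footT_rot x).1 h)), nextPt_rise hx, descend_rot hx]; rfl
  obtain ⟨x, u⟩ := σ
  cases u
  · have := key (D.rot x)
    rw [rot_rot] at this
    simp [this, rot_rot]
  · exact key x

theorem zpow_rot (n : ℤ) (σ : ℤ × Bool) : (D.advance ^ n) (D.rot σ.1, !σ.2) =
    (D.rot ((D.advance ^ n) σ).1, !((D.advance ^ n) σ).2) := by
  let κ : Equiv.Perm (ℤ × Bool) :=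
    ⟨fun τ => (D.rot τ.1, !τ.2), fun τ => (D.rot τ.1, !τ.2),
      fun τ => by simp [rot_rot], fun τ => by simp [rot_rot]⟩
  have h : Commute D.advance κ := by
    ext1 τ
    exact nextPt_rot τ
  exact congrArg (fun g : Equiv.Perm (ℤ × Bool) => g σ) (h.zpow_left n).eq

theorem passes_rot {σ : ℤ × Bool} (h : D.Passes σ) :
    D.Passes (D.rot σ.1, !σ.2) ↔ D.Passes (D.rot 0, true) := by
  obtain ⟨n, k, hn⟩ := h
  have h1 := zpow_rot (D := D) n (0, false)
  rw [hn] at h1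
  rw [← passes_zpow n (D.rot 0, true)]
  change _ ↔ D.Passes ((D.advance ^ n) (D.rot 0, !false))
  rw [h1, ← passes_translate (-k)]
  have : D.translate (-k) (D.rot σ.1, !σ.2) =
      (D.rot (D.translate k σ).1, !(D.translate k σ).2) := by
    simp [translate, rot]; ring
  rw [this]

theorem upAt_rot (hconn : D.Connected) (hA : D.algInt ≠ 0) (x : ℤ) :
    D.UpAt (D.rot x) ↔ D.UpAt x := by
  by_cases h : D.Passes (D.rot 0, true)
  · refine absurd (algInt_eq_zero hconn D.rot (fun x k => ⟨-k, ?_⟩) rot_rot fun x => ?_) hA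
    · rw [rot, rot]; ring
    · by_cases hx : D.UpAt x
      · have := (passes_rot ((upAt_iff hconn x).1 hx)).2 h
        simp only [Bool.not_true] at this
        rw [← not_upAt_iff hconn] at this
        tauto
      · have := (passes_rot ((not_upAt_iff hconn x).1 hx)).2 h
        simp only [Bool.not_false] at this
        rw [← upAt_iff hconn] at this
        tauto
  · by_cases hx : D.UpAt x
    · have := mt (passes_rot ((upAt_iff hconn x).1 hx)).1 h
      simp only [Bool.not_true] at this
      rw [← not_upAt_iff hconn] at this
      tauto
    · have := mt (passes_rot ((not_upAt_iff hconn x).1 hx)).1 h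
      simp only [Bool.not_false] at this
      rw [← upAt_iff hconn] at this
      tauto

end

/-! ### The model of a diagram -/

/-- The lifts of the curve `β` of a diagram to the plane. -/
def model (D : StdDiagram) (hconn : D.Connected) (hA : D.algInt ≠ 0) : CurveModel where
  p := D.pz
  B := D.footB
  iB := D.archB
  T := D.footT
  iT := D.archT
  asc := D.ascend
  desc := D.descend
  Up := D.TrueUpPt
  hB := D.rainbowB
  hT := D.rainbowT
  asc_mem _ hx := (ascend_spec hx).1
  desc_mem _ hx := (descend_spec hx).1
  desc_asc _ hx := (ascend_spec hx).2
  asc_desc _ hx := (descend_spec hx).2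
  asc_lt _ _ _ hy h := ascend_lt hy h
  asc_per := ascend_per
  desc_per := descend_per
  up_per x k := by rw [TrueUpPt, TrueUpPt, upAt_per hconn]
  up_iB x hx := by rw [TrueUpPt, TrueUpPt, upAt_archB hconn hx]; tauto
  up_iT x hx := by rw [TrueUpPt, TrueUpPt, upAt_archT hconn hx]; tauto
  up_asc x hx := by rw [TrueUpPt, TrueUpPt, upAt_ascend hconn hx]
  no_loop _ hx hT := archT_archB_ne hconn hA hx hT

variable {D : StdDiagram} (hconn : D.Connected) (hA : D.algInt ≠ 0)

/-- The traversal of the lifts of `β`. -/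
def flow : (D.model hconn hA).Flow where
  S := CState
  f := D.fstep
  lvl σ := if σ.top = true then some σ.ht else none
  u x h := ⟨x, decide (0 < D.algInt), true, h⟩
  d x h := ⟨x, !decide (0 < D.algInt), true, h⟩
  lvl_u x h := by simp
  lvl_d x h := by simp
  arch x h hx := by
    refine ⟨3, by omega, ?_⟩
    by_cases hpos : 0 < D.algInt
    · rw [show D.fstep = D.step from funext fun σ => if_pos hpos, decide_eq_true hpos]
      obtain ⟨h1, h2, h3⟩ := step_arch h hx
      refine ⟨h1, fun i hi hm => ?_⟩
      obtain rfl | rfl : i = 1 ∨ i = 2 := by omega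
      · simpa using h2
      · simpa using h3
    · rw [show D.fstep = D.stepB from funext fun σ => if_neg hpos, decide_eq_false hpos]
      obtain ⟨h1, h2, h3⟩ := stepB_arch h hx
      refine ⟨h1, fun i hi hm => ?_⟩
      obtain rfl | rfl : i = 1 ∨ i = 2 := by omega
      · simpa using h2
      · simpa using h3
  rise x h hx := by
    refine ⟨2, by omega, ?_⟩
    by_cases hpos : 0 < D.algInt
    · rw [show D.fstep = D.step from funext fun σ => if_pos hpos, decide_eq_true hpos]
      obtain ⟨h1, h2⟩ := step_rise h hx
      refine ⟨h1, fun i hi hm => ?_⟩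
      obtain rfl : i = 1 := by omega
      simpa using h2
    · rw [show D.fstep = D.stepB from funext fun σ => if_neg hpos, decide_eq_false hpos]
      obtain ⟨h1, h2⟩ := stepB_rise h hx
      refine ⟨h1, fun i hi hm => ?_⟩
      obtain rfl : i = 1 := by omega
      simpa using h2
  bowl x h hx := by
    refine ⟨1, by omega, ?_⟩
    by_cases hpos : 0 < D.algInt
    · rw [show D.fstep = D.step from funext fun σ => if_pos hpos, decide_eq_true hpos]
      exact ⟨step_bowl h hx, fun i hi hm => by omega⟩
    · rw [show D.fstep = D.stepB from funext fun σ => if_neg hpos, decide_eq_false hpos]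
      exact ⟨stepB_bowl h hx, fun i hi hm => by omega⟩
  fall x h hx := by
    refine ⟨2, by omega, ?_⟩
    by_cases hpos : 0 < D.algInt
    · rw [show D.fstep = D.step from funext fun σ => if_pos hpos, decide_eq_true hpos]
      obtain ⟨h1, h2⟩ := step_fall h hx
      refine ⟨h1, fun i hi hm => ?_⟩
      obtain rfl : i = 1 := by omega
      simpa using h2
    · rw [show D.fstep = D.stepB from funext fun σ => if_neg hpos, decide_eq_false hpos]
      obtain ⟨h1, h2⟩ := stepB_fall h hx
      refine ⟨h1, fun i hi hm => ?_⟩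
      obtain rfl : i = 1 := by omega
      simpa using h2

theorem trueUp_spt (k : ℕ) : D.TrueUp (D.spt k) ↔ D.TrueUpPt k := by
  rw [TrueUp, TrueUpPt, spt]
  by_cases h : D.UpAt k <;> simp [h]

theorem spt_of_up {k : ℕ} (h : D.TrueUpPt k) : D.spt k = (flow hconn hA).u k 0 := by
  rw [TrueUpPt] at h
  simp only [spt, flow, h]
  by_cases h' : D.UpAt k <;> simp [h']

theorem spt_of_not_up {k : ℕ} (h : ¬ D.TrueUpPt k) : D.spt k = (flow hconn hA).d k 0 := by
  rw [TrueUpPt] at h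
  simp only [spt, flow]
  by_cases h' : D.UpAt k
  · have : ¬ 0 < D.algInt := by tauto
    simp [h', this]
  · have : 0 < D.algInt := by tauto
    simp [h', this]

theorem isCross0_iff (σ : CState) : IsCross0 σ ↔ (flow hconn hA).lvl σ = some 0 := by
  change IsCross0 σ ↔ (if σ.top = true then some σ.ht else none) = some 0
  rw [IsCross0]
  cases σ.top <;> simp

theorem isCross0_iff' (σ : CState) : IsCross0 σ ↔ (flow hconn hA).flip.lvl σ = some 0 := by
  rw [isCross0_iff hconn hA]
  change _ ↔ ((flow hconn hA).lvl σ).map (fun h => -h) = some 0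
  simp

theorem nxt0_upper {k : ℕ} {y : ℤ} (h : D.TrueUpPt k) (hy : (D.model hconn hA).UArc k y) :
    D.Returns0 (D.spt k) ∧ (D.nxt0 (D.spt k)).pos = y := by
  have h2 := CurveModel.Flow.first_return (F := flow hconn hA) hy 0
  obtain ⟨m, hm⟩ := CurveModel.Flow.exists_leads (F := flow hconn hA) hy 0
  constructor
  · refine ⟨m, hm.1, ?_⟩
    rw [spt_of_up hconn hA h, isCross0_iff hconn hA]
    exact (congrArg _ hm.2.1).trans ((flow hconn hA).lvl_d y 0)
  · rw [nxt0, ret0Steps, spt_of_up hconn hA h]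
    simp only [isCross0_iff hconn hA]
    exact congrArg CState.pos h2

theorem returns0_upper {k : ℕ} (h : D.TrueUpPt k) (hr : D.Returns0 (D.spt k)) :
    ∃ y, (D.model hconn hA).UArc k y := by
  obtain ⟨n, h1, h2⟩ := hr
  rw [spt_of_up hconn hA h, isCross0_iff hconn hA] at h2
  exact CurveModel.Flow.exists_uarc h1 h2

theorem nxt0_lower {k : ℕ} {y : ℤ} (h : ¬ D.TrueUpPt k)
    (hy : (D.model hconn hA).flip.UArc k y) :
    D.Returns0 (D.spt k) ∧ (D.nxt0 (D.spt k)).pos = y := by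
  have h2 := CurveModel.Flow.first_return (F := (flow hconn hA).flip) hy 0
  obtain ⟨m, hm⟩ := CurveModel.Flow.exists_leads (F := (flow hconn hA).flip) hy 0
  have e : D.spt k = (flow hconn hA).flip.u k 0 := spt_of_not_up hconn hA h
  constructor
  · refine ⟨m, hm.1, ?_⟩
    rw [e, isCross0_iff' hconn hA]
    exact (congrArg _ hm.2.1).trans ((flow hconn hA).flip.lvl_d y 0)
  · rw [nxt0, ret0Steps, e]
    simp only [isCross0_iff' hconn hA]
    exact congrArg CState.pos h2

theorem returns0_lower {k : ℕ} (h : ¬ D.TrueUpPt k) (hr : D.Returns0 (D.spt k)) :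
    ∃ y, (D.model hconn hA).flip.UArc k y := by
  obtain ⟨n, h1, h2⟩ := hr
  have e : D.spt k = (flow hconn hA).flip.u k 0 := spt_of_not_up hconn hA h
  rw [e, isCross0_iff' hconn hA] at h2
  exact CurveModel.Flow.exists_uarc h1 h2

end

/-! ### Rainbow arcs and their ends -/

section

variable (D : StdDiagram)

/-- The position of a family of rainbow arcs on the top edge. -/
def off (f : Bool) : ℤ := if f then -D.rz else D.sz

/-- The distance of a rainbow arc from the outermost arc of its family. -/
def depth (a : Bool × ℕ) : ℤ := if a.1 then a.2 - D.rz else a.2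

/-- `x` is a lift of an endpoint of the rainbow arc `a`. -/
def End (a : Bool × ℕ) (x : ℤ) : Prop :=
  (x + D.off a.1) % D.pz = D.depth a ∨ (x + D.off a.1) % D.pz = 2 * D.qz - 1 - D.depth a

variable {D}

theorem mem_rainbowArcs {a : Bool × ℕ} :
    a ∈ D.rainbowArcs ↔ 0 ≤ D.depth a ∧ D.depth a < D.qz := by
  obtain ⟨f, i⟩ := a
  cases f
  · simp [rainbowArcs, depth, qz]
  · simp [rainbowArcs, depth, qz, rz]
    omega

theorem intCast_eq_iff {x y : ℤ} (c : ℤ) (h0 : 0 ≤ y + c) (h1 : y + c < D.pz) :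
    (x : ZMod D.p) = y ↔ (x + c) % D.pz = y + c := by
  rw [ZMod.intCast_eq_intCast_iff, ← Int.emod_eq_of_lt h0 h1]
  exact ⟨fun h => Int.ModEq.add_right c h, fun h => Int.ModEq.add_right_cancel' c h⟩

theorem intCast_mem_rEnds {a : Bool × ℕ} (ha : a ∈ D.rainbowArcs) (x : ℤ) :
    (x : ZMod D.p) ∈ D.rEnds a ↔ D.End a x := by
  obtain ⟨hp, hq, hr, hb⟩ := D.bounds
  rw [mem_rainbowArcs] at ha
  obtain ⟨f, i⟩ := a
  cases f
  · simp only [depth, Bool.false_eq_true, if_false] at ha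
    simp only [rEnds, End, off, depth, Bool.false_eq_true, if_false, Finset.mem_insert,
      Finset.mem_singleton]
    rw [intCast_eq_iff D.sz (by omega) (by omega), intCast_eq_iff D.sz (by omega) (by omega)]
    simp
  · simp only [depth, if_true] at ha
    simp only [rEnds, End, off, depth, if_true, Finset.mem_insert, Finset.mem_singleton]
    rw [intCast_eq_iff (-D.rz) (by omega) (by omega), intCast_eq_iff (-D.rz) (by omega) (by omega)]
    refine or_congr Iff.rfl ?_
    rw [show 2 * D.rz + 2 * D.qz - 1 - (i : ℤ) + -D.rz = 2 * D.qz - 1 - (i - D.rz) by ring]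

theorem shareEnd_iff {a b : Bool × ℕ} (ha : a ∈ D.rainbowArcs) (hb : b ∈ D.rainbowArcs) :
    D.ShareEnd a b ↔ ∃ x, D.End a x ∧ D.End b x := by
  rw [ShareEnd]
  constructor
  · rintro ⟨z, hz⟩
    obtain ⟨x, rfl⟩ := ZMod.intCast_surjective z
    rw [Finset.mem_inter, intCast_mem_rEnds ha, intCast_mem_rEnds hb] at hz
    exact ⟨x, hz⟩
  · rintro ⟨x, hx⟩
    refine ⟨(x : ZMod D.p), ?_⟩
    rwa [Finset.mem_inter, intCast_mem_rEnds ha, intCast_mem_rEnds hb]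

theorem End.eq {a b : Bool × ℕ} (ha : a ∈ D.rainbowArcs) (hb : b ∈ D.rainbowArcs) (h : a.1 = b.1)
    {x : ℤ} (hx : D.End a x) (hy : D.End b x) : a = b := by
  rw [mem_rainbowArcs] at ha hb
  rw [End] at hx hy
  rw [← h] at hy
  have e : D.depth a = D.depth b := by omega
  refine Prod.ext h ?_
  rw [depth, depth, ← h] at e
  split_ifs at e <;> omega

theorem end_add {a : Bool × ℕ} (x k : ℤ) : D.End a (x + D.pz * k) ↔ D.End a x := by
  rw [End, End, show x + D.pz * k + D.off a.1 = x + D.off a.1 + D.pz * k by ring,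
    Int.add_mul_emod_self_left]

variable (hconn : D.Connected) (hA : D.algInt ≠ 0)

/-- The model of the diagram, turned upside down for the arcs of the top family. -/
def side (f : Bool) : CurveModel :=
  if f then (D.model hconn hA).flip else D.model hconn hA

theorem side_p (f : Bool) : (side hconn hA f).p = D.pz := by cases f <;> rfl

theorem side_B (f : Bool) (x : ℤ) :
    (side hconn hA f).B x ↔ (x + D.off f) % D.pz < 2 * D.qz := by cases f <;> rfl

theorem side_iB (f : Bool) (x : ℤ) :
    (side hconn hA f).iB x = x + (2 * D.qz - 1 - 2 * ((x + D.off f) % D.pz)) := by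
  cases f <;> rfl

theorem End.side_B {a : Bool × ℕ} (ha : a ∈ D.rainbowArcs) {x : ℤ} (hx : D.End a x) :
    (side hconn hA a.1).B x := by
  rw [mem_rainbowArcs] at ha
  rw [StdDiagram.side_B]
  rw [End] at hx
  omega

theorem exists_end {f : Bool} {x : ℤ} (hx : (side hconn hA f).B x) :
    ∃ a ∈ D.rainbowArcs, a.1 = f ∧ D.End a x := by
  obtain ⟨hp, hq, hr, hb⟩ := D.bounds
  rw [side_B] at hx
  have h0 := Int.emod_nonneg (x + D.off f) hp.ne'
  obtain ⟨i, h1, h2, h3⟩ : ∃ i : ℤ, 0 ≤ i ∧ i < D.qz ∧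
      ((x + D.off f) % D.pz = i ∨ (x + D.off f) % D.pz = 2 * D.qz - 1 - i) := by
    rcases lt_or_ge ((x + D.off f) % D.pz) D.qz with h | h
    · exact ⟨_, h0, h, Or.inl rfl⟩
    · exact ⟨2 * D.qz - 1 - (x + D.off f) % D.pz, by omega, by omega, Or.inr (by omega)⟩
  have e : D.depth (f, (if f then i + D.rz else i).toNat) = i := by
    cases f <;> simp [depth] <;> omega
  refine ⟨(f, (if f then i + D.rz else i).toNat), ?_, rfl, ?_⟩
  · rw [mem_rainbowArcs, e]
    exact ⟨h1, h2⟩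
  · rw [End, e]
    exact h3

theorem emod_side_iB {f : Bool} {x : ℤ} (hx : (side hconn hA f).B x) :
    ((side hconn hA f).iB x + D.off f) % D.pz = 2 * D.qz - 1 - (x + D.off f) % D.pz := by
  obtain ⟨hp, hq, hr, hb⟩ := D.bounds
  rw [StdDiagram.side_B] at hx
  rw [side_iB]
  obtain ⟨k, m, h1, h2, h3, h4⟩ := Int.exists_eq_mul_add hp (x + D.off f)
  rw [h4] at hx ⊢
  exact Int.emod_eq_of_eq_mul_add (a := k) (by omega) (by omega) (by omega)

theorem End.arch {a : Bool × ℕ} (ha : a ∈ D.rainbowArcs) {x : ℤ} (hx : D.End a x) :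
    D.End a ((side hconn hA a.1).iB x) := by
  have := emod_side_iB hconn hA (hx.side_B hconn hA ha)
  rw [End] at hx ⊢
  omega

theorem End.eq_or_arch {a : Bool × ℕ} (ha : a ∈ D.rainbowArcs) {x y : ℤ} (hx : D.End a x)
    (hy : D.End a y) : ∃ k, y = x + D.pz * k ∨ y = (side hconn hA a.1).iB x + D.pz * k := by
  have h1 := emod_side_iB hconn hA (hx.side_B hconn hA ha)
  rw [End] at hx hy
  have key : ∀ z, (y + D.off a.1) % D.pz = (z + D.off a.1) % D.pz → ∃ k, y = z + D.pz * k := by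
    intro z hz
    obtain ⟨k, hk⟩ := Int.ModEq.dvd (Int.ModEq.add_right_cancel' _ hz)
    exact ⟨-k, by linarith⟩
  have : (y + D.off a.1) % D.pz = (x + D.off a.1) % D.pz ∨
      (y + D.off a.1) % D.pz = ((side hconn hA a.1).iB x + D.off a.1) % D.pz := by omega
  rcases this with h | h
  · obtain ⟨k, hk⟩ := key _ h
    exact ⟨k, Or.inl hk⟩
  · obtain ⟨k, hk⟩ := key _ h
    exact ⟨k, Or.inr hk⟩

theorem rOrientRight_iff {a : Bool × ℕ} :
    D.rOrientRight a ↔ (side hconn hA a.1).Up (D.depth a - D.off a.1) := by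
  obtain ⟨f, i⟩ := a
  cases f
  · simp [rOrientRight, side, depth, off, model]
  · simp [rOrientRight, side, depth, off, model, CurveModel.flip]

theorem rOrientRight_iff_of_low {a : Bool × ℕ} {x : ℤ}
    (hx : (x + D.off a.1) % D.pz = D.depth a) :
    D.rOrientRight a ↔ (side hconn hA a.1).Up x := by
  have h1 := Int.emod_add_mul_ediv (x + D.off a.1) D.pz
  have h2 := (side hconn hA a.1).up_per (D.depth a - D.off a.1) ((x + D.off a.1) / D.pz)
  rw [side_p] at h2
  rw [rOrientRight_iff hconn hA, ← h2]
  rw [show D.depth a - D.off a.1 + D.pz * ((x + D.off a.1) / D.pz) = x by omega]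

/-- The orientation of a rainbow arc, read off at either of its ends. -/
theorem End.orient {a : Bool × ℕ} (ha : a ∈ D.rainbowArcs) {x : ℤ} (hx : D.End a x) (b : Bool) :
    (D.rOrientRight a ↔ b = true) ↔
      (side hconn hA a.1).DirB b x ∨ (side hconn hA a.1).DirB b ((side hconn hA a.1).iB x) := by
  set N := side hconn hA a.1 with hN
  have hd := mem_rainbowArcs.1 ha
  have key : ∀ x, (x + D.off a.1) % D.pz = D.depth a →
      ((D.rOrientRight a ↔ b = true) ↔ N.DirB b x ∨ N.DirB b (N.iB x)) := by
    intro x hx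
    have hB : N.B x := by rw [hN, StdDiagram.side_B]; omega
    have hlt : x < N.iB x := by rw [hN, side_iB]; omega
    have hlt' : ¬ N.iB x < N.iB (N.iB x) := by rw [N.hB.inv x hB]; omega
    rw [rOrientRight_iff_of_low hconn hA hx, ← hN, CurveModel.DirB, CurveModel.DirB,
      N.up_iB x hB]
    have hB' := N.hB.mem x hB
    simp only [hB, hB', hlt, hlt', true_and, true_iff, false_iff]
    cases b <;> simp
  have h1 := emod_side_iB hconn hA (hx.side_B hconn hA ha)
  have h2 := N.hB.inv x (hx.side_B hconn hA ha)
  rcases hx with hx | hx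
  · exact key x hx
  · rw [key (N.iB x) (by rw [hN]; omega), h2, or_comm]

theorem dirB_side_add (f b : Bool) (x k : ℤ) :
    (side hconn hA f).DirB b (x + D.pz * k) ↔ (side hconn hA f).DirB b x := by
  have := CurveModel.dirB_add (M := side hconn hA f) b x k
  rwa [side_p] at this

end

/-! ### Counting arcs of a diagram -/

section

variable {D : StdDiagram} (hconn : D.Connected) (hA : D.algInt ≠ 0)

theorem uCnt_eq (b : Bool) : D.uCnt b = CurveModel.cnt D.pz ((D.model hconn hA).ArcDir b) := by
  rw [uCnt, UpperStarts, CurveModel.cnt, Finset.filter_filter]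
  refine congrArg Finset.card (Finset.filter_congr fun k _ => ?_)
  rw [trueUp_spt, ArcRight]
  constructor
  · rintro ⟨⟨h1, h2⟩, h3⟩
    obtain ⟨y, hy⟩ := returns0_upper hconn hA h2 h1
    rw [(nxt0_upper hconn hA h2 hy).2] at h3
    exact ⟨h2, y, hy, h3⟩
  · rintro ⟨h2, y, hy, h3⟩
    obtain ⟨h4, h5⟩ := nxt0_upper hconn hA h2 hy
    rw [h5]
    exact ⟨⟨h4, h2⟩, h3⟩

theorem lCnt_eq (b : Bool) :
    D.lCnt b = CurveModel.cnt D.pz ((D.model hconn hA).flip.ArcDir b) := by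
  rw [lCnt, LowerStarts, CurveModel.cnt, Finset.filter_filter]
  refine congrArg Finset.card (Finset.filter_congr fun k _ => ?_)
  rw [trueUp_spt, ArcRight]
  constructor
  · rintro ⟨⟨h1, h2⟩, h3⟩
    obtain ⟨y, hy⟩ := returns0_lower hconn hA h2 h1
    rw [(nxt0_lower hconn hA h2 hy).2] at h3
    exact ⟨h2, y, hy, h3⟩
  · rintro ⟨h2, y, hy, h3⟩
    obtain ⟨h4, h5⟩ := nxt0_lower hconn hA h2 hy
    rw [h5]
    exact ⟨⟨h4, h2⟩, h3⟩

theorem famCnt_eq (f b : Bool) :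
    D.famCnt f b = CurveModel.cnt D.pz ((side hconn hA f).DirB b) := by
  have hp := D.bounds.1
  rw [famCnt, CurveModel.cnt]
  apply le_antisymm
  · refine Finset.card_le_card_of_forall_subsingleton (fun a (k : ℕ) => D.End a k) ?_ ?_
    · intro a ha
      rw [Finset.mem_filter] at ha
      obtain ⟨ha, rfl, hr⟩ := ha
      have hd := mem_rainbowArcs.1 ha
      have hx : D.End a (D.depth a - D.off a.1) := by
        left
        rw [sub_add_cancel]
        exact Int.emod_eq_of_lt hd.1 (by have := D.bounds; omega)
      obtain ⟨x, hx, hdir⟩ : ∃ x, D.End a x ∧ (side hconn hA a.1).DirB b x := by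
        rcases (hx.orient hconn hA ha b).1 hr with h | h
        · exact ⟨_, hx, h⟩
        · exact ⟨_, hx.arch hconn hA ha, h⟩
      obtain ⟨k, n, h1, h2, rfl⟩ := CurveModel.exists_nat_rep hp (dirB_side_add hconn hA a.1 b) hdir
      exact ⟨k, Finset.mem_filter.2 ⟨Finset.mem_range.2 h1, h2⟩, (end_add _ _).1 hx⟩
    · intro k _ a ha a' ha'
      simp only [Finset.mem_filter, Set.mem_ofPred_eq] at ha ha'
      exact ha.2.eq ha.1.1 ha'.1.1 (ha.1.2.1.trans ha'.1.2.1.symm) ha'.2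
  · refine Finset.card_le_card_of_forall_subsingleton (fun (k : ℕ) a => D.End a k) ?_ ?_
    · intro k hk
      have hdir := (Finset.mem_filter.1 hk).2
      obtain ⟨a, ha, rfl, hx⟩ := exists_end hconn hA hdir.1
      exact ⟨a, Finset.mem_filter.2 ⟨ha, rfl, (hx.orient hconn hA ha b).2 (Or.inl hdir)⟩, hx⟩
    · intro a ha k hk l hl
      rw [Finset.mem_filter] at ha
      obtain ⟨ha, rfl, -⟩ := ha
      simp only [Finset.mem_filter, Finset.mem_range, Set.mem_ofPred_eq] at hk hl
      obtain ⟨n, h | h⟩ := hk.2.eq_or_arch hconn hA ha hl.2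
      · have h1 := hk.1.1
        have h2 := hl.1.1
        have h0 : n = 0 := Int.eq_zero_of_mul_lt (p := D.pz) (by omega) (by omega)
        subst h0
        omega
      · have h1 := hl.1.2
        rw [h, dirB_side_add] at h1
        exact absurd hk.1.2.2.1 (((side hconn hA a.1).up_iB _ hk.1.2.1).1 h1.2.1)

theorem famCnt_false (b : Bool) :
    D.famCnt false b = CurveModel.cnt D.pz ((D.model hconn hA).DirB b) :=
  famCnt_eq hconn hA false b

theorem famCnt_true (b : Bool) :
    D.famCnt true b = CurveModel.cnt D.pz ((D.model hconn hA).DirT b) :=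
  famCnt_eq hconn hA true b

theorem cnt_le_cnt {p : ℤ} (hp : 0 < p) {L L' : ℤ → Prop} (hL' : ∀ x k, L' (x + p * k) ↔ L' x)
    (φ ψ : ℤ → ℤ) (h : ∀ x, L x → L' (φ x)) (hψ : ∀ x, L x → ψ (φ x) = x)
    (hs : ∀ x k, ψ (x + p * k) = ψ x + p * -k) :
    CurveModel.cnt p L ≤ CurveModel.cnt p L' := by
  refine Finset.card_le_card_of_forall_subsingleton (fun k l : ℕ => ∃ n, φ k = l + p * n) ?_ ?_
  · intro k hk
    obtain ⟨l, n, h1, h2, h3⟩ := CurveModel.exists_nat_rep hp hL' (h _ (Finset.mem_filter.1 hk).2)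
    exact ⟨l, Finset.mem_filter.2 ⟨Finset.mem_range.2 h1, h2⟩, n, h3⟩
  · intro l _ k hk k' hk'
    simp only [Finset.mem_filter, Finset.mem_range, Set.mem_ofPred_eq] at hk hk'
    obtain ⟨⟨h1, h2⟩, n, h3⟩ := hk
    obtain ⟨⟨h1', h2'⟩, n', h3'⟩ := hk'
    have e := hψ _ h2
    have e' := hψ _ h2'
    rw [h3, hs] at e
    rw [h3', hs] at e'
    have h5 : (k : ℤ) - k' = p * (n' - n) := by linarith
    have h0 : n' - n = 0 := Int.eq_zero_of_mul_lt (p := p) (by omega) (by omega)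
    rw [h0] at h5
    omega

theorem cnt_dirB_eq_cnt_dirT (b : Bool) : CurveModel.cnt D.pz ((D.model hconn hA).DirB b) =
    CurveModel.cnt D.pz ((D.model hconn hA).DirT b) := by
  have hp := D.bounds.1
  have hU : ∀ x, D.TrueUpPt (D.rot x) ↔ D.TrueUpPt x := fun x => by
    rw [TrueUpPt, TrueUpPt, upAt_rot hconn hA]
  have hF : ∀ x, D.footB (D.rot x) ↔ D.footT x := fun x => by
    rw [← footT_rot, rot_rot]
  have hR : ∀ x, D.footT x → D.rot (D.archT x) = D.archB (D.rot x) := fun x hx => by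
    have := archT_rot ((hF x).2 hx)
    rw [rot_rot] at this
    rw [this, rot_rot]
  apply le_antisymm
  · refine cnt_le_cnt hp ((D.model hconn hA).dirT_add b) (fun x => D.rot (D.archB x))
      (fun x => D.rot (D.archT x)) ?_ ?_ ?_
    · rintro x ⟨h1, h2, h3⟩
      change D.footB x at h1
      have h4 := D.rainbowB.mem x h1
      have h5 := D.rainbowB.inv x h1
      refine ⟨(footT_rot _).2 h4, ?_, ?_⟩
      · change ¬ D.TrueUpPt _
        rw [hU]
        exact fun h => ((D.model hconn hA).up_iB x h1).1 h h2
      · change _ < D.archT _ ↔ _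
        change x < D.archB x ↔ _ at h3
        rw [archT_rot h4, h5, ← h3, rot, rot]
        omega
    · rintro x ⟨h1, -, -⟩
      rw [archT_rot (D.rainbowB.mem x h1), D.rainbowB.inv x h1, rot_rot]
    · intro x k
      rw [D.rainbowT.iper, rot, rot]
      ring
  · refine cnt_le_cnt hp ((D.model hconn hA).dirB_add b) (fun x => D.rot (D.archT x))
      (fun x => D.rot (D.archB x)) ?_ ?_ ?_
    · rintro x ⟨h1, h2, h3⟩
      change D.footT x at h1
      have h4 := D.rainbowT.mem x h1
      have h5 := D.rainbowT.inv x h1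
      refine ⟨(hF _).2 h4, ?_, ?_⟩
      · change D.TrueUpPt _
        rw [hU]
        exact ((D.model hconn hA).up_iT x h1).2 h2
      · change _ < D.archB _ ↔ _
        change x < D.archT x ↔ _ at h3
        rw [← hR _ h4, h5, ← h3, rot, rot]
        omega
    · rintro x ⟨h1, -, -⟩
      rw [← hR _ (D.rainbowT.mem x h1), D.rainbowT.inv x h1, rot_rot]
    · intro x k
      rw [D.rainbowB.iper, rot, rot]
      ring

theorem virtuallyAlmostCoherent_iff :
    D.VirtuallyAlmostCoherent ↔ ∃ d, (D.model hconn hA).AlmostCoherent d := by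
  rw [← CurveModel.exists_cnt_arcDir_iff D.bounds.1 (cnt_dirB_eq_cnt_dirT hconn hA)]
  simp only [VirtuallyAlmostCoherent, uCnt_eq hconn hA, lCnt_eq hconn hA]
  rfl

end

/-! ### The exceptional rainbow arcs -/

section

variable {D : StdDiagram}

theorem ShareEnd.symm {a b : Bool × ℕ} (h : D.ShareEnd a b) : D.ShareEnd b a := by
  rwa [ShareEnd, Finset.inter_comm]

theorem ConnectedByTwo.symm {a b : Bool × ℕ} (h : D.ConnectedByTwo a b) :
    D.ConnectedByTwo b a := by
  obtain ⟨b1, b2, h1, h2, h3, h4, h5, h6, h7, h8, h9, h10⟩ := h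
  exact ⟨b2, b1, h2, h1, h6, h5, h4, h3, h7.symm, h10.symm, h9.symm, h8.symm⟩

theorem ShareEnd.fst_ne {a b : Bool × ℕ} (ha : a ∈ D.rainbowArcs) (hb : b ∈ D.rainbowArcs)
    (hne : a ≠ b) (h : D.ShareEnd a b) : a.1 ≠ b.1 := by
  obtain ⟨x, hx, hy⟩ := (shareEnd_iff ha hb).1 h
  exact fun e => hne (hx.eq ha hb e hy)

theorem ConnectedByTwo.fst_ne {a b : Bool × ℕ} (ha : a ∈ D.rainbowArcs) (hb : b ∈ D.rainbowArcs)
    (h : D.ConnectedByTwo a b) : a.1 ≠ b.1 := by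
  obtain ⟨b1, b2, h1, h2, h3, h4, h5, h6, h7, h8, h9, h10⟩ := h
  have e1 := h8.fst_ne ha h1 h3.symm
  have e2 := h9.fst_ne h1 h2 h7
  have e3 := h10.fst_ne h2 hb h6
  cases h : a.1 <;> cases h' : b1.1 <;> cases h'' : b2.1 <;> simp_all

variable (hconn : D.Connected) (hA : D.algInt ≠ 0)

theorem End.footB {a : Bool × ℕ} (ha : a ∈ D.rainbowArcs) (hf : a.1 = false) {x : ℤ}
    (hx : D.End a x) : (D.model hconn hA).B x ∧ D.End a ((D.model hconn hA).iB x) := by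
  obtain ⟨f, i⟩ := a
  subst hf
  exact ⟨hx.side_B hconn hA ha, hx.arch hconn hA ha⟩

theorem End.footT {a : Bool × ℕ} (ha : a ∈ D.rainbowArcs) (hf : a.1 = true) {x : ℤ}
    (hx : D.End a x) : (D.model hconn hA).T x ∧ D.End a ((D.model hconn hA).iT x) := by
  obtain ⟨f, i⟩ := a
  subst hf
  exact ⟨hx.side_B hconn hA ha, hx.arch hconn hA ha⟩

theorem End.orientB {a : Bool × ℕ} (ha : a ∈ D.rainbowArcs) (hf : a.1 = false) {x : ℤ}
    (hx : D.End a x) (b : Bool) : (D.rOrientRight a ↔ b = true) ↔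
      (D.model hconn hA).DirB b x ∨ (D.model hconn hA).DirB b ((D.model hconn hA).iB x) := by
  obtain ⟨f, i⟩ := a
  subst hf
  exact hx.orient hconn hA ha b

theorem End.orientT {a : Bool × ℕ} (ha : a ∈ D.rainbowArcs) (hf : a.1 = true) {x : ℤ}
    (hx : D.End a x) (b : Bool) : (D.rOrientRight a ↔ b = true) ↔
      (D.model hconn hA).DirT b x ∨ (D.model hconn hA).DirT b ((D.model hconn hA).iT x) := by
  obtain ⟨f, i⟩ := a
  subst hf
  exact hx.orient hconn hA ha b

/-- Two distinct arcs which share an end, both having a further end in common with a third arc. -/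
theorem exists_other_end {a b c : Bool × ℕ} (ha : a ∈ D.rainbowArcs) (hb : b ∈ D.rainbowArcs)
    (hc : c ∈ D.rainbowArcs) (hac : a.1 = c.1) (hne : c ≠ a) {x : ℤ} (hax : D.End a x)
    (hbx : D.End b x) (h : D.ShareEnd b c) : D.End c ((side hconn hA b.1).iB x) := by
  obtain ⟨y, hby, hcy⟩ := (shareEnd_iff hb hc).1 h
  obtain ⟨k, rfl | rfl⟩ := hbx.eq_or_arch hconn hA hb hby
  · rw [end_add] at hcy
    exact absurd (hcy.eq hc ha hac.symm hax) hne
  · rwa [end_add] at hcy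

theorem linked_of_connected {d : Bool} {a b : Bool × ℕ} (ha : a ∈ D.rainbowArcs)
    (hb : b ∈ D.rainbowArcs) (hfa : a.1 = false) (hfb : b.1 = true)
    (hda : D.rOrientRight a ↔ d = true) (hdb : D.rOrientRight b ↔ d = true)
    (h : D.ShareEnd a b ∨ D.ConnectedByTwo a b) :
    (D.model hconn hA).Linked ((D.model hconn hA).DirB d) ((D.model hconn hA).DirT d) := by
  set M := D.model hconn hA with hM
  rcases h with h | ⟨b1, b2, h1, h2, h3, h4, h5, h6, h7, h8, h9, h10⟩
  · obtain ⟨x, hax, hbx⟩ := (shareEnd_iff ha hb).1 h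
    obtain ⟨hB, -⟩ := hax.footB hconn hA ha hfa
    obtain ⟨hT, -⟩ := hbx.footT hconn hA hb hfb
    have uB := M.up_iB x hB
    have uT := M.up_iT x hT
    rcases (hax.orientB hconn hA ha hfa d).1 hda with e1 | e1 <;>
      rcases (hbx.orientT hconn hA hb hfb d).1 hdb with e2 | e2
    · exact absurd e1.2.1 e2.2.1
    · exact ⟨x, e1, Or.inl ⟨hT, e2⟩⟩
    · refine ⟨_, e1, Or.inr (Or.inl ?_)⟩
      rw [M.hB.inv x hB]
      exact e2
    · exact absurd (uT.2 (uB.1 e1.2.1)) e2.2.1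
  · have f1 : b1.1 = true := by
      have := h8.fst_ne ha h1 h3.symm
      rw [hfa] at this
      simpa using this.symm
    have f2 : b2.1 = false := by
      have := h10.fst_ne h2 hb h6
      rw [hfb] at this
      simpa using this
    obtain ⟨x, hax, hbx⟩ := (shareEnd_iff ha h1).1 h8
    have hv := exists_other_end hconn hA ha h1 h2 (hfa.trans f2.symm) h5 hax hbx h9
    rw [f1] at hv
    change D.End b2 (M.iT x) at hv
    obtain ⟨hB, -⟩ := hax.footB hconn hA ha hfa
    obtain ⟨hT, hx1⟩ := hbx.footT hconn hA h1 f1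
    obtain ⟨hB2, -⟩ := hv.footB hconn hA h2 f2
    have hw := exists_other_end hconn hA h1 h2 hb (f1.trans hfb.symm) h4.symm hx1 hv h10
    rw [f2] at hw
    change D.End b (M.iB (M.iT x)) at hw
    obtain ⟨hT2, -⟩ := hw.footT hconn hA hb hfb
    have uB := M.up_iB x hB
    have uT := M.up_iT x hT
    have uB2 := M.up_iB _ hB2
    have uT2 := M.up_iT _ hT2
    rcases (hax.orientB hconn hA ha hfa d).1 hda with e1 | e1 <;>
      rcases (hw.orientT hconn hA hb hfb d).1 hdb with e2 | e2
    · exact absurd e1.2.1 (by have := e2.2.1; tauto)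
    · exact ⟨x, e1, Or.inr (Or.inr (Or.inr ⟨hT, hB2, hT2, e2⟩))⟩
    · refine ⟨_, e1, Or.inr (Or.inr (Or.inl ?_))⟩
      rw [M.hB.inv x hB]
      exact ⟨hT, hB2, e2⟩
    · exact absurd e1.2.1 (by have := e2.2.1; tauto)

theorem connected_of_path {a b : Bool × ℕ} (ha : a ∈ D.rainbowArcs)
    (hb : b ∈ D.rainbowArcs) (hfa : a.1 = false) (hfb : b.1 = true) {x : ℤ} (hax : D.End a x)
    (hT : (D.model hconn hA).T x) (hB : (D.model hconn hA).B ((D.model hconn hA).iT x))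
    (hbx : D.End b ((D.model hconn hA).iB ((D.model hconn hA).iT x))) :
    D.ShareEnd a b ∨ D.ConnectedByTwo a b := by
  obtain ⟨b1, h1, f1, hx1⟩ := exists_end hconn hA (f := true) hT
  obtain ⟨b2, h2, f2, hx2⟩ := exists_end hconn hA (f := false) hB
  by_cases e1 : b1 = b
  · exact Or.inl ((shareEnd_iff ha hb).2 ⟨x, hax, e1 ▸ hx1⟩)
  have hx3 := (hx2.footB hconn hA h2 f2).2
  by_cases e2 : b2 = a
  · exact Or.inl ((shareEnd_iff ha hb).2 ⟨_, e2 ▸ hx3, hbx⟩)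
  have ne : ∀ {u v : Bool × ℕ}, u.1 = true → v.1 = false → u ≠ v := by
    rintro u v hu hv rfl
    simp [hu] at hv
  exact Or.inr ⟨b1, b2, h1, h2, ne f1 hfa, e1, e2, (ne hfb f2).symm, ne f1 f2,
    (shareEnd_iff ha h1).2 ⟨x, hax, hx1⟩,
    (shareEnd_iff h1 h2).2 ⟨_, (hx1.footT hconn hA h1 f1).2, hx2⟩,
    (shareEnd_iff h2 hb).2 ⟨_, hx3, hbx⟩⟩

theorem stronglyAlmostCoherent_of_almostCoherent {d : Bool}
    (h : (D.model hconn hA).AlmostCoherent d) : D.StronglyAlmostCoherent := by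
  set M := D.model hconn hA with hM
  obtain ⟨h1, h2, h3, x, hx, hl⟩ := h
  have c1 : D.famCnt false d = 1 := (famCnt_false hconn hA d).trans h1
  have c2 : D.famCnt true d = 1 := (famCnt_true hconn hA d).trans h2
  have c3 : 0 < D.famCnt false (!d) := by rw [famCnt_false hconn hA]; exact h3
  have c4 : 0 < D.famCnt true (!d) := by
    rw [famCnt_true hconn hA, ← cnt_dirB_eq_cnt_dirT hconn hA]; exact h3
  obtain ⟨a, ha⟩ := Finset.card_eq_one.1 c1
  obtain ⟨b, hb⟩ := Finset.card_eq_one.1 c2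
  have ha' : ∀ z, (z ∈ D.rainbowArcs ∧ z.1 = false ∧ (D.rOrientRight z ↔ d = true)) ↔ z = a :=
    fun z => by
      have := Finset.ext_iff.1 ha z
      rwa [Finset.mem_filter, Finset.mem_singleton] at this
  have hb' : ∀ z, (z ∈ D.rainbowArcs ∧ z.1 = true ∧ (D.rOrientRight z ↔ d = true)) ↔ z = b :=
    fun z => by
      have := Finset.ext_iff.1 hb z
      rwa [Finset.mem_filter, Finset.mem_singleton] at this
  obtain ⟨a1, a2, -⟩ := (ha' a).2 rfl
  obtain ⟨b1, b2, -⟩ := (hb' b).2 rfl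
  have endA : ∀ z, M.DirB d z → D.End a z := fun z hz => by
    obtain ⟨e, e1, e2, e3⟩ := exists_end hconn hA (f := false) hz.1
    rw [← (ha' e).1 ⟨e1, e2, (e3.orientB hconn hA e1 e2 d).2 (Or.inl hz)⟩]
    exact e3
  have endB : ∀ z, M.DirT d z → D.End b z := fun z hz => by
    obtain ⟨e, e1, e2, e3⟩ := exists_end hconn hA (f := true) hz.1
    rw [← (hb' e).1 ⟨e1, e2, (e3.orientT hconn hA e1 e2 d).2 (Or.inl hz)⟩]
    exact e3
  have hax := endA x hx
  have hax' := (hax.footB hconn hA a1 a2).2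
  refine ⟨d, d, by omega, by omega, a, b, ?_, ?_, ?_⟩
  · rintro rfl
    simp [a2] at b2
  · intro z
    rw [InconsArc, ite_self, ← ha', ← hb']
    cases z.1 <;> simp
  · rcases hl with ⟨l1, l2⟩ | l1 | ⟨l1, l2, l3⟩ | ⟨l1, l2, l3, l4⟩
    · have := (endB _ l2).footT hconn hA b1 b2
      rw [← hM, M.hT.inv x l1] at this
      exact Or.inl ((shareEnd_iff a1 b1).2 ⟨x, hax, this.2⟩)
    · exact Or.inl ((shareEnd_iff a1 b1).2 ⟨_, hax', endB _ l1⟩)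
    · exact connected_of_path hconn hA a1 b1 a2 b2 hax' l1 l2 (endB _ l3)
    · have := (endB _ l4).footT hconn hA b1 b2
      rw [← hM, M.hT.inv _ l3] at this
      exact connected_of_path hconn hA a1 b1 a2 b2 hax l1 l2 this.2

theorem almostCoherent_of_connected {dT dB : Bool}
    (hT : D.famCnt true dT ≤ D.famCnt true (!dT))
    (hB : D.famCnt false dB ≤ D.famCnt false (!dB)) {a b : Bool × ℕ}
    (hab : ∀ z, D.InconsArc dT dB z ↔ z = a ∨ z = b)
    (hfa : a.1 = false) (hfb : b.1 = true) (h : D.ShareEnd a b ∨ D.ConnectedByTwo a b) :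
    ∃ d, (D.model hconn hA).AlmostCoherent d := by
  have hp := D.bounds.1
  obtain ⟨ha, hda⟩ := (hab a).2 (Or.inl rfl)
  obtain ⟨hb, hdb⟩ := (hab b).2 (Or.inr rfl)
  simp only [hfa, Bool.false_eq_true, if_false] at hda
  simp only [hfb, if_true] at hdb
  have cB : D.famCnt false dB = 1 := by
    rw [famCnt, Finset.card_eq_one]
    refine ⟨a, ?_⟩
    ext z
    rw [Finset.mem_filter, Finset.mem_singleton]
    constructor
    · rintro ⟨h1, h2, h3⟩
      refine ((hab z).1 ⟨h1, by simpa [h2] using h3⟩).resolve_right ?_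
      rintro rfl
      simp [h2] at hfb
    · rintro rfl
      exact ⟨ha, hfa, hda⟩
  have cT : D.famCnt true dT = 1 := by
    rw [famCnt, Finset.card_eq_one]
    refine ⟨b, ?_⟩
    ext z
    rw [Finset.mem_filter, Finset.mem_singleton]
    constructor
    · rintro ⟨h1, h2, h3⟩
      refine ((hab z).1 ⟨h1, by simpa [h2] using h3⟩).resolve_left ?_
      rintro rfl
      simp [h2] at hfa
    · rintro rfl
      exact ⟨hb, hfb, hdb⟩
  rw [famCnt_false hconn hA] at cB
  rw [famCnt_false hconn hA, famCnt_false hconn hA] at hB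
  rw [famCnt_true hconn hA] at cT
  have cB' := (cnt_dirB_eq_cnt_dirT hconn hA dB).symm.trans cB
  refine ⟨dB, cB, cB', by change 0 < CurveModel.cnt D.pz _; omega, ?_⟩
  by_cases hd : dT = dB
  · subst hd
    exact linked_of_connected hconn hA ha hb hfa hfb hda hdb h
  · have hd' : dT = !dB := by cases dT <;> cases dB <;> simp_all
    rw [hd', ← cnt_dirB_eq_cnt_dirT hconn hA] at cT
    obtain ⟨c, hc, hfc, x, hax, hcx⟩ : ∃ c ∈ D.rainbowArcs, c.1 = true ∧
        ∃ x, D.End a x ∧ D.End c x := by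
      rcases h with h | ⟨b1, b2, h1, h2, h3, h4, h5, h6, h7, h8, h9, h10⟩
      · exact ⟨b, hb, hfb, (shareEnd_iff ha hb).1 h⟩
      · refine ⟨b1, h1, ?_, (shareEnd_iff ha h1).1 h8⟩
        have := h8.fst_ne ha h1 h3.symm
        rw [hfa] at this
        simpa using this.symm
    obtain ⟨hT', -⟩ := hcx.footT hconn hA hc hfc
    obtain ⟨hB', -⟩ := hax.footB hconn hA ha hfa
    have UB := CurveModel.unique_of_cnt hp ((D.model hconn hA).dirB_add dB) cB.le
    have UR := CurveModel.unique_of_cnt hp ((D.model hconn hA).dirB_add !dB) cT.le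
    have hg := (CurveModel.cnt_pos_iff hp ((D.model hconn hA).dirT_add dB)).1 (by omega)
    rcases (hax.orientB hconn hA ha hfa dB).1 hda with e | e
    · exact CurveModel.linked_of_dir_mixed UB UR hg e (Or.inl hT')
    · refine CurveModel.linked_of_dir_mixed UB UR hg e (Or.inr ?_)
      rwa [(D.model hconn hA).hB.inv x hB']

theorem stronglyAlmostCoherent_iff :
    D.StronglyAlmostCoherent ↔ ∃ d, (D.model hconn hA).AlmostCoherent d := by
  constructor
  · rintro ⟨dT, dB, hT, hB, a, b, hne, hab, h⟩
    have ha := ((hab a).2 (Or.inl rfl)).1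
    have hb := ((hab b).2 (Or.inr rfl)).1
    have hf : a.1 ≠ b.1 := by
      rcases h with h | h
      · exact h.fst_ne ha hb hne
      · exact h.fst_ne ha hb
    cases hfa : a.1
    · have hfb : b.1 = true := by
        rw [hfa] at hf
        simpa using hf.symm
      exact almostCoherent_of_connected hconn hA hT hB hab hfa hfb h
    · have hfb : b.1 = false := by
        rw [hfa] at hf
        simpa using hf.symm
      exact almostCoherent_of_connected hconn hA hT hB (fun z => by rw [hab, or_comm]) hfb hfa
        (h.imp ShareEnd.symm ConnectedByTwo.symm)
  · rintro ⟨d, h⟩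
    exact stronglyAlmostCoherent_of_almostCoherent hconn hA h

end

end StdDiagram

/-- Proposition 3.5.  A standard (1,1) diagram is virtually almost
coherent if and only if it is strongly almost coherent. -/
theorem virtuallyAlmostCoherent_iff_stronglyAlmostCoherent
    (D : StdDiagram) (hconn : D.Connected) (hA : D.algInt ≠ 0) :
    D.VirtuallyAlmostCoherent ↔ D.StronglyAlmostCoherent := by
  rw [StdDiagram.virtuallyAlmostCoherent_iff hconn hA,
    StdDiagram.stronglyAlmostCoherent_iff hconn hA]

end

end OneOneKnot
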